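/- arXiv:2110.14556 — 11 statements merged into one kernel-verified Lean document; each statement's English description precedes it below -/
import Mathlib

section
/- For every odd prime p and every integer c not divisible by p, the quadratic Gauss sum satisfies: the sum over x = 0, 1, …, p−1 of exp(2·π·i·c·x²/p) equals (legendreSym p c) · G_p, where G_p = √p if p ≡ 1 (mod 4) and G_p = i·√p if p ≡ 3 (mod 4), as complex numbers. -/
open Polynomial in
/-- Applying the Euler operator `X * d/dX` to `(X - 1) ^ n` at most `n` times. -/
lemma exists_iterate_X_mul_derivative_X_sub_one_pow {R : Type*} [CommRing R] (n i : ℕ)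
    (hi : i ≤ n) :
    ∃ g : R[X], (fun f : R[X] => X * derivative f)^[i] ((X - 1) ^ n) = (X - 1) ^ (n - i) * g ∧
      g.eval 1 = ∏ k ∈ Finset.range i, ((n : R) - k) := by
  induction i with
  | zero => exact ⟨1, by simp⟩
  | succ i ih =>
    obtain ⟨g, hg, hg1⟩ := ih (by omega)
    obtain ⟨j, rfl⟩ : ∃ j, n = j + 1 + i := ⟨n - (i + 1), by omega⟩
    refine ⟨X * ((j + 1 : R[X]) * g + (X - 1) * derivative g), ?_, ?_⟩
    · rw [Function.iterate_succ_apply', hg, Nat.add_sub_cancel,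
        show j + 1 + i - (i + 1) = j by omega]
      simp only [derivative_mul, derivative_pow, derivative_sub, derivative_X, derivative_one,
        Nat.add_sub_cancel, map_natCast]
      push_cast
      ring
    · rw [Finset.prod_range_succ, ← hg1]
      simp
      ring

open Polynomial in
lemma iterate_X_mul_derivative_sum_X_pow {R : Type*} [CommRing R] (n i : ℕ) :
    (fun f : R[X] => X * derivative f)^[i] (∑ j ∈ Finset.range n, X ^ j) =
      ∑ j ∈ Finset.range n, C ((j : R) ^ i) * X ^ j := by
  induction i with
  | zero => simp
  | succ i ih =>
    rw [Function.iterate_succ_apply', ih]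
    simp only [derivative_sum, Finset.mul_sum]
    refine Finset.sum_congr rfl fun j _ => ?_
    rw [derivative_C_mul_X_pow]
    rcases j with _ | j
    · simp
    · rw [Nat.add_sub_cancel, pow_succ ((j + 1 : ℕ) : R), pow_succ (X : R[X])]
      ring

open Polynomial in
/-- Modulo `p`, the Gauss sum polynomial agrees with a power of `X - 1` to leading order. -/
lemma exists_map_sum_legendreSym_mul_X_pow (p m : ℕ) [Fact p.Prime] (hpm : p = 2 * m + 1) :
    ∃ g : (ZMod p)[X],
      ∑ j ∈ Finset.range p, C ((legendreSym p j : ℤ) : ZMod p) * X ^ j = (X - 1) ^ m * g ∧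
      g.eval 1 = ∏ k ∈ Finset.range m, (-((k : ZMod p) + 1)) := by
  obtain ⟨g, hg, hg1⟩ :=
    exists_iterate_X_mul_derivative_X_sub_one_pow (R := ZMod p) (2 * m) m (by omega)
  refine ⟨g, ?_, ?_⟩
  · have hcyc : ((X : (ZMod p)[X]) - 1) ^ (2 * m) = ∑ j ∈ Finset.range p, X ^ j := by
      have h := cyclotomic_mul_prime_eq_pow_of_not_dvd (ZMod p) (p := p) (n := 1)
        (Fact.out : p.Prime).not_dvd_one
      rw [one_mul, cyclotomic_prime, cyclotomic_one] at h
      rw [h]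
      congr 1
      omega
    rw [hcyc, iterate_X_mul_derivative_sum_X_pow, show 2 * m - m = m by omega] at hg
    rw [← hg]
    refine Finset.sum_congr rfl fun j _ => ?_
    rw [legendreSym.eq_pow, show p / 2 = m by omega]
    simp
  · have h0 : ((2 * m + 1 : ℕ) : ZMod p) = 0 := by rw [← hpm]; simp
    rw [hg1]
    refine Finset.prod_congr rfl fun k _ => ?_
    push_cast at h0 ⊢
    linear_combination h0

open Polynomial in
lemma exists_prod_X_pow_sub_X_pow {R : Type*} [CommRing R] (m : ℕ) :
    ∃ r : R[X],
      ∏ k ∈ Finset.range m, ((X : R[X]) ^ (m * (k + 1)) - X ^ ((m + 1) * (k + 1))) =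
        (X - 1) ^ m * r ∧
      r.eval 1 = ∏ k ∈ Finset.range m, (-((k : R) + 1)) := by
  refine ⟨∏ k ∈ Finset.range m, (-(X ^ (m * (k + 1)) * ∑ i ∈ Finset.range (k + 1), X ^ i)), ?_, ?_⟩
  · rw [show ((X : R[X]) - 1) ^ m = ∏ _k ∈ Finset.range m, (X - 1) by simp,
      ← Finset.prod_mul_distrib]
    refine Finset.prod_congr rfl fun k _ => ?_
    have h := mul_geom_sum (X : R[X]) (k + 1)
    linear_combination X ^ (m * (k + 1)) * h
  · simp [eval_prod, eval_finsetSum]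

open Polynomial in
/-- The sign determination: if the Gauss sum is `ε` times the product of the differences
`ζ ^ (m k) - ζ ^ ((m + 1) k)`, with `ε` an integer, then `ε ≡ 1` modulo `p = 2 m + 1`. -/
lemma intCast_eq_one_of_sum_legendreSym_eq (p m : ℕ) [Fact p.Prime] (hpm : p = 2 * m + 1)
    {K : Type*} [Field K] [CharZero K] {ζ : K} (hζ : IsPrimitiveRoot ζ p) (ε : ℤ)
    (h : ∑ j ∈ Finset.range p, (legendreSym p j : K) * ζ ^ j =
      ε * ∏ k ∈ Finset.range m, (ζ ^ (m * (k + 1)) - ζ ^ ((m + 1) * (k + 1)))) :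
    (ε : ZMod p) = 1 := by
  have hp : p.Prime := Fact.out
  have hm : 0 < m := by have := hp.two_le; omega
  obtain ⟨g, hg, hg1⟩ := exists_map_sum_legendreSym_mul_X_pow p m hpm
  obtain ⟨r, hr, hr1⟩ := exists_prod_X_pow_sub_X_pow (R := ZMod p) m
  have hdvd : cyclotomic p ℤ ∣ ∑ j ∈ Finset.range p, C (legendreSym p j) * X ^ j -
      C ε * ∏ k ∈ Finset.range m, (X ^ (m * (k + 1)) - X ^ ((m + 1) * (k + 1))) := by
    rw [cyclotomic_eq_minpoly hζ hp.pos]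
    apply minpoly.isIntegrallyClosed_dvd (hζ.isIntegral hp.pos)
    simp [map_sum, map_prod, h]
  obtain ⟨q, hq⟩ := hdvd
  replace hq := congrArg (Polynomial.map (Int.castRingHom (ZMod p))) hq
  have hcyc : cyclotomic p (ZMod p) = (X - 1) ^ m * (X - 1) ^ m := by
    have h := cyclotomic_mul_prime_eq_pow_of_not_dvd (ZMod p) (p := p) (n := 1) hp.not_dvd_one
    rw [one_mul, cyclotomic_one] at h
    rw [h, ← pow_add]
    congr 1
    omega
  simp only [Polynomial.map_sub, Polynomial.map_mul, Polynomial.map_sum, Polynomial.map_prod,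
    Polynomial.map_pow, map_X, map_C, map_cyclotomic] at hq
  simp only [eq_intCast] at hq
  rw [hg, hr, hcyc] at hq
  have hX : ((X : (ZMod p)[X]) - 1) ^ m ≠ 0 :=
    pow_ne_zero _ (by simpa using X_sub_C_ne_zero (1 : ZMod p))
  have hq' : g - C (ε : ZMod p) * r = (X - 1) ^ m * q.map (Int.castRingHom (ZMod p)) :=
    mul_left_cancel₀ hX (by linear_combination hq)
  replace hq' := congrArg (eval 1) hq'
  simp only [eval_sub, eval_mul, eval_C, eval_pow, eval_X, eval_one, sub_self, zero_pow hm.ne',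
    zero_mul, hg1, hr1] at hq'
  have hne : ∏ k ∈ Finset.range m, (-((k : ZMod p) + 1)) ≠ 0 := by
    refine Finset.prod_ne_zero_iff.mpr fun k hk => neg_ne_zero.mpr ?_
    have hk' := Finset.mem_range.mp hk
    rw [← Nat.cast_succ, Ne, ZMod.natCast_eq_zero_iff]
    exact Nat.not_dvd_of_pos_of_lt k.succ_pos (by omega)
  exact mul_right_cancel₀ hne (by linear_combination -hq')

lemma prod_pow_sub_pow_sq {R : Type*} [CommRing R] [IsDomain R] (m : ℕ) {ζ : R}
    (hζ : IsPrimitiveRoot ζ (2 * m + 1)) :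
    (∏ k ∈ Finset.range m, (ζ ^ (m * (k + 1)) - ζ ^ ((m + 1) * (k + 1)))) ^ 2 =
      (-1) ^ m * (2 * m + 1) := by
  have h := hζ.prod_one_sub_pow_eq_order
  rw [two_mul, Finset.prod_range_add,
    ← Finset.prod_range_reflect (fun k => 1 - ζ ^ (m + k + 1)), ← Finset.prod_mul_distrib] at h
  push_cast at h
  rw [two_mul, ← h, ← Finset.prod_pow]
  rw [show (-1 : R) ^ m = ∏ _k ∈ Finset.range m, (-1) by simp, ← Finset.prod_mul_distrib]
  refine Finset.prod_congr rfl fun k hk => ?_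
  have hk' := Finset.mem_range.mp hk
  have h1 : ζ ^ (m + (m - 1 - k) + 1) * ζ ^ (k + 1) = 1 := by
    rw [← pow_add, show m + (m - 1 - k) + 1 + (k + 1) = 2 * m + 1 by omega, hζ.pow_eq_one]
  have h2 : (ζ ^ (m * (k + 1))) ^ 2 * ζ ^ (k + 1) = 1 := by
    rw [← pow_mul, ← pow_add, show m * (k + 1) * 2 + (k + 1) = (2 * m + 1) * (k + 1) by ring,
      pow_mul, hζ.pow_eq_one, one_pow]
  have h3 : (ζ ^ (m * (k + 1))) ^ 2 = ζ ^ (m + (m - 1 - k) + 1) := by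
    have hz : ζ ^ (k + 1) ≠ 0 := pow_ne_zero _ (hζ.ne_zero (by omega))
    exact mul_right_cancel₀ hz (h2.trans h1.symm)
  rw [show (m + 1) * (k + 1) = m * (k + 1) + (k + 1) by ring, pow_add]
  linear_combination (1 - ζ ^ (k + 1)) ^ 2 * h3 + (ζ ^ (k + 1) - 1) * h1

/-- The product of `ζ ^ (m k) - ζ ^ ((m + 1) k)` for the standard primitive root `ζ`. -/
lemma prod_exp_pow_sub_exp_pow (p m : ℕ) (hpm : p = 2 * m + 1) :
    ∏ k ∈ Finset.range m, (Complex.exp (2 * Real.pi * Complex.I / p) ^ (m * (k + 1)) -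
      Complex.exp (2 * Real.pi * Complex.I / p) ^ ((m + 1) * (k + 1))) =
      (∏ k ∈ Finset.range m, ((-1) ^ k * Complex.I)) * (Real.sqrt p : ℝ) := by
  set s : ℝ := ∏ k ∈ Finset.range m, (2 * Real.sin (Real.pi * (k + 1) / p)) with hs
  have hprod : ∏ k ∈ Finset.range m, (Complex.exp (2 * Real.pi * Complex.I / p) ^ (m * (k + 1)) -
      Complex.exp (2 * Real.pi * Complex.I / p) ^ ((m + 1) * (k + 1))) =
      (∏ k ∈ Finset.range m, ((-1) ^ k * Complex.I)) * (s : ℂ) := by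
    rw [hs, Complex.ofReal_prod, ← Finset.prod_mul_distrib]
    refine Finset.prod_congr rfl fun k _ => ?_
    have hp0 : (p : ℂ) ≠ 0 := by exact_mod_cast (by omega : p ≠ 0)
    have hm : (m : ℂ) = (p - 1) / 2 := by
      rw [hpm]
      push_cast
      ring
    have hpi : Complex.exp (Real.pi * (k + 1 : ℕ) * Complex.I) = (-1) ^ (k + 1) := by
      rw [← Complex.exp_pi_mul_I, ← Complex.exp_nat_mul]
      congr 1
      ring
    have h1 : Complex.exp (2 * Real.pi * Complex.I / p) ^ (m * (k + 1)) =
        (-1) ^ (k + 1) * Complex.exp (-(Real.pi * (k + 1) / p) * Complex.I) := by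
      rw [← hpi, ← Complex.exp_nat_mul, ← Complex.exp_add]
      congr 1
      push_cast
      rw [hm]
      field_simp
      ring
    have h2 : Complex.exp (2 * Real.pi * Complex.I / p) ^ ((m + 1) * (k + 1)) =
        (-1) ^ (k + 1) * Complex.exp ((Real.pi * (k + 1) / p) * Complex.I) := by
      rw [← hpi, ← Complex.exp_nat_mul, ← Complex.exp_add]
      congr 1
      push_cast
      rw [hm]
      field_simp
      ring
    have h3 := Complex.two_sin (Real.pi * (k + 1) / p)
    rw [h1, h2]
    push_cast
    rw [h3]
    linear_combination (-1) ^ k *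
      (Complex.exp ((Real.pi * (k + 1) / p) * Complex.I) -
        Complex.exp (-(Real.pi * (k + 1) / p) * Complex.I)) * Complex.I_sq
  have hpos : 0 < s := by
    refine Finset.prod_pos fun k hk => mul_pos two_pos (Real.sin_pos_of_pos_of_lt_pi ?_ ?_)
    · have : (0 : ℝ) < p := by exact_mod_cast (by omega : 0 < p)
      positivity
    · have hk' := Finset.mem_range.mp hk
      have h0 : (0 : ℝ) < p := by exact_mod_cast (by omega : 0 < p)
      have h1 : ((k : ℝ) + 1) < p := by exact_mod_cast (by omega : k + 1 < p)
      rw [div_lt_iff₀ h0]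
      exact mul_lt_mul_of_pos_left h1 Real.pi_pos
  have hsq := prod_pow_sub_pow_sq m (ζ := Complex.exp (2 * Real.pi * Complex.I / p))
    (by rw [← hpm]; exact Complex.isPrimitiveRoot_exp p (by omega))
  have hI : (∏ k ∈ Finset.range m, ((-1) ^ k * Complex.I)) ^ 2 = (-1) ^ m := by
    rw [← Finset.prod_pow]
    simp [mul_pow, ← pow_mul, pow_mul']
  rw [hprod, mul_pow, hI] at hsq
  have hs2 : s ^ 2 = p := by
    have h := mul_left_cancel₀ (pow_ne_zero m (by norm_num : (-1 : ℂ) ≠ 0)) hsq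
    rw [hpm]
    exact_mod_cast h
  rw [hprod, ← hs2, Real.sqrt_sq hpos.le]

lemma prod_neg_one_pow_mul_I (m : ℕ) :
    ∏ k ∈ Finset.range m, ((-1) ^ k * Complex.I) = if Even m then 1 else Complex.I := by
  induction m with
  | zero => simp
  | succ m ih =>
    rw [Finset.prod_range_succ, ih]
    rcases m.even_or_odd with h | h
    · simp [h, h.neg_one_pow, Nat.even_add_one]
    · simp [Nat.not_even_iff_odd.mpr h, h.neg_one_pow, Nat.even_add_one]

lemma sum_range_natCast_zmod {M : Type*} [AddCommMonoid M] (n : ℕ) [NeZero n] (f : ZMod n → M) :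
    ∑ j ∈ Finset.range n, f j = ∑ x, f x := by
  refine Finset.sum_bij (fun j _ => (j : ZMod n)) (by simp) ?_ ?_ (by simp)
  · intro a ha b hb hab
    rw [ZMod.natCast_eq_natCast_iff'] at hab
    rwa [Nat.mod_eq_of_lt (Finset.mem_range.mp ha),
      Nat.mod_eq_of_lt (Finset.mem_range.mp hb)] at hab
  · intro b _
    exact ⟨b.val, Finset.mem_range.mpr b.val_lt, ZMod.natCast_zmod_val b⟩

/-- The value of the quadratic Gauss sum, for the standard additive character. -/
lemma gaussSum_quadraticChar_stdAddChar (p : ℕ) [Fact p.Prime] (hp2 : p ≠ 2) :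
    gaussSum ((quadraticChar (ZMod p)).ringHomComp (Int.castRingHom ℂ)) ZMod.stdAddChar =
      if p % 4 = 1 then ((Real.sqrt p : ℝ) : ℂ) else Complex.I * ((Real.sqrt p : ℝ) : ℂ) := by
  have hp : p.Prime := Fact.out
  obtain ⟨m, hpm⟩ := hp.odd_of_ne_two hp2
  have hchar : ringChar (ZMod p) ≠ 2 := by rwa [ZMod.ringChar_zmod_n]
  have hζ := Complex.isPrimitiveRoot_exp p hp.ne_zero
  set ζ := Complex.exp (2 * Real.pi * Complex.I / p) with hζdef
  set G := gaussSum ((quadraticChar (ZMod p)).ringHomComp (Int.castRingHom ℂ)) ZMod.stdAddChar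
    with hG
  set P := ∏ k ∈ Finset.range m, (ζ ^ (m * (k + 1)) - ζ ^ ((m + 1) * (k + 1))) with hP
  have hsum : ∑ j ∈ Finset.range p, (legendreSym p j : ℂ) * ζ ^ j = G := by
    rw [hG, gaussSum]
    rw [← sum_range_natCast_zmod]
    refine Finset.sum_congr rfl fun j _ => ?_
    have h := ZMod.stdAddChar_coe (N := p) j
    simp only [Int.cast_natCast] at h
    rw [h, hζdef, ← Complex.exp_nat_mul]
    simp only [legendreSym, MulChar.ringHomComp_apply, Int.cast_natCast, eq_intCast]
    congr 2
    ring
  have hGsq : G ^ 2 = P ^ 2 := by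
    rw [hP, prod_pow_sub_pow_sq m (hpm ▸ hζ), hG, gaussSum_sq ?_
      ((quadraticChar_isQuadratic (ZMod p)).comp _) (ZMod.isPrimitive_stdAddChar p)]
    · have h := legendreSym.at_neg_one hp2
      rw [legendreSym, ZMod.χ₄_eq_neg_one_pow (by omega), show p / 2 = m by omega] at h
      push_cast at h
      rw [MulChar.ringHomComp_apply, h, ZMod.card]
      have hpc : (p : ℂ) = 2 * m + 1 := by exact_mod_cast hpm
      rw [hpc]
      simp
    · obtain ⟨a, ha⟩ := quadraticChar_exists_neg_one' hchar
      intro h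
      have := congrArg (fun χ : MulChar (ZMod p) ℂ => χ a) h
      simp [ha] at this
      norm_num at this
  have hGP : G = P := by
    rcases sq_eq_sq_iff_eq_or_eq_neg.mp hGsq with h | h
    · exact h
    · exfalso
      have h1 := intCast_eq_one_of_sum_legendreSym_eq p m hpm hζ (-1) (by rw [hsum, h, hP]; simp)
      push_cast at h1
      exact (Ring.neg_one_ne_one_of_char_ne_two hchar) h1
  rw [hGP, hP, hζdef, prod_exp_pow_sub_exp_pow p m hpm, prod_neg_one_pow_mul_I]
  have hiff : Even m ↔ p % 4 = 1 := by rw [Nat.even_iff]; omega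
  simp only [hiff]
  split_ifs <;> simp

/-- A sum of an additive character over squares is a Gauss sum. -/
lemma sum_addChar_mul_sq {F : Type*} [Field F] [Fintype F] [DecidableEq F] (hF : ringChar F ≠ 2)
    {R : Type*} [CommRing R] [IsDomain R] {ψ : AddChar F R} (hψ : ψ ≠ 1) :
    ∑ x : F, ψ (x ^ 2) = gaussSum ((quadraticChar F).ringHomComp (Int.castRingHom R)) ψ := by
  rw [← Finset.sum_fiberwise' Finset.univ (fun x : F => x ^ 2) ψ]
  have hcard (a : F) : ∑ x : F with x ^ 2 = a, ψ a = (quadraticChar F a : R) * ψ a + ψ a := by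
    have h := quadraticChar_card_sqrts hF a
    rw [Finset.sum_const, nsmul_eq_mul]
    have h' : ((Finset.univ.filter fun x : F => x ^ 2 = a).card : ℤ) = quadraticChar F a + 1 := by
      rw [← h]
      congr 2
      ext
      simp
    have h'' := congrArg (Int.cast : ℤ → R) h'
    push_cast at h''
    rw [h'']
    ring
  simp only [hcard, Finset.sum_add_distrib, AddChar.sum_eq_zero_of_ne_one hψ, add_zero]
  rfl

/-- For every odd prime `p` and every integer `c` not divisible by `p`,
the quadratic Gauss sum `∑_{x=0}^{p-1} exp(2πi c x²/p)` equals `(c/p) · G_p`, where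
`(c/p)` is the Legendre symbol and `G_p = √p` if `p ≡ 1 (mod 4)`, `G_p = i√p` if
`p ≡ 3 (mod 4)`. -/
theorem quadratic_gauss_sum_eval (p : ℕ) [hp : Fact p.Prime] (hp2 : p ≠ 2)
    (c : ℤ) (hc : ¬ (p : ℤ) ∣ c) :
    ∑ x ∈ Finset.range p,
        Complex.exp (2 * Real.pi * Complex.I * (c : ℂ) * (x : ℂ) ^ 2 / (p : ℂ)) =
      (legendreSym p c : ℂ) *
        (if p % 4 = 1 then ((Real.sqrt p : ℝ) : ℂ)
          else Complex.I * ((Real.sqrt p : ℝ) : ℂ)) := by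
  have hchar : ringChar (ZMod p) ≠ 2 := by rwa [ZMod.ringChar_zmod_n]
  have hc0 : (c : ZMod p) ≠ 0 := by rwa [Ne, ZMod.intCast_zmod_eq_zero_iff_dvd]
  set ψ : AddChar (ZMod p) ℂ := ZMod.stdAddChar.mulShift (c : ZMod p) with hψdef
  have hψ : ψ ≠ 1 := ZMod.isPrimitive_stdAddChar p hc0
  have hsum : ∑ x ∈ Finset.range p,
      Complex.exp (2 * Real.pi * Complex.I * (c : ℂ) * (x : ℂ) ^ 2 / (p : ℂ)) =
      ∑ x : ZMod p, ψ (x ^ 2) := by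
    rw [← sum_range_natCast_zmod]
    refine Finset.sum_congr rfl fun j _ => ?_
    have h := ZMod.stdAddChar_coe (N := p) (c * (j : ℤ) ^ 2)
    push_cast at h
    rw [hψdef, AddChar.mulShift_apply, h]
    congr 1
    ring
  rw [hsum, sum_addChar_mul_sq hchar hψ, hψdef, ← gaussSum_quadraticChar_stdAddChar p hp2]
  have h := gaussSum_mulShift ((quadraticChar (ZMod p)).ringHomComp (Int.castRingHom ℂ))
    ZMod.stdAddChar (Units.mk0 _ hc0)
  have hsq : (legendreSym p c : ℂ) ^ 2 = 1 := by exact_mod_cast legendreSym.sq_one p hc0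
  rw [← h, MulChar.ringHomComp_apply, Units.val_mk0, eq_intCast, ← legendreSym]
  linear_combination -(gaussSum ((quadraticChar (ZMod p)).ringHomComp (Int.castRingHom ℂ))
    (ZMod.stdAddChar.mulShift (c : ZMod p))) * hsq
end

section
/- Let p be an odd prime and set ζ = exp(2·π·i/p) ∈ ℂ and G_p = √p if p ≡ 1 (mod 4), G_p = i·√p if p ≡ 3 (mod 4). Then the sum of ζ^k over all k ∈ {1,…,p−1} that are quadratic residues modulo p equals (−1 + G_p)/2, and the sum of ζ^k over all k ∈ {1,…,p−1} that are quadratic non-residues modulo p equals (−1 − G_p)/2. In particular both sums lie in the ring ℤ[(1+G_p)/2]. -/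
open Polynomial in
theorem eval_one_iterate_X_mul_derivative {R : Type*} [CommRing R] (m : ℕ) (f : R[X]) :
    ((fun g : R[X] => X * derivative g)^[m] ((X - 1) ^ m * f)).eval 1 = m.factorial * f.eval 1 := by
  induction m generalizing f with
  | zero => simp
  | succ n ih =>
    have h : X * derivative ((X - 1) ^ (n + 1) * f) =
        (X - 1) ^ n * (X * (((n : R[X]) + 1) * f + (X - 1) * derivative f)) := by
      simp only [derivative_mul, derivative_pow, derivative_sub, derivative_X, derivative_one]
      simp
      ring
    rw [Function.iterate_succ_apply, h, ih]
    simp [Nat.factorial_succ]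
    ring

open Polynomial in
theorem iterate_X_mul_derivative_sum {R ι : Type*} [CommRing R] (m : ℕ) (s : Finset ι)
    (c : ι → R) (e : ι → ℕ) :
    (fun g : R[X] => X * derivative g)^[m] (∑ i ∈ s, C (c i) * X ^ e i) =
      ∑ i ∈ s, C (c i * (e i : R) ^ m) * X ^ e i := by
  induction m generalizing c with
  | zero => simp
  | succ n ih =>
    have h : X * derivative (∑ i ∈ s, C (c i) * X ^ e i) =
        ∑ i ∈ s, C (c i * e i) * X ^ e i := by
      rw [derivative_sum, Finset.mul_sum]
      refine Finset.sum_congr rfl fun i _ => ?_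
      rw [derivative_C_mul_X_pow]
      rcases Nat.eq_zero_or_pos (e i) with h | h
      · simp [h]
      · rw [mul_left_comm, ← pow_succ', Nat.sub_add_cancel h]
    rw [Function.iterate_succ_apply, h, ih]
    simp only [pow_succ', mul_assoc]

theorem prod_range_two_mul_eq_prod_mul_reflect {M : Type*} [CommMonoid M] (m : ℕ) (f : ℕ → M) :
    ∏ k ∈ Finset.range (2 * m), f (k + 1) =
      ∏ k ∈ Finset.range m, f (k + 1) * f (2 * m + 1 - (k + 1)) := by
  rw [two_mul, Finset.prod_range_add, Finset.prod_mul_distrib, ← Finset.prod_range_reflect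
    (fun k => f (m + k + 1))]
  congr 1
  refine Finset.prod_congr rfl fun k hk => ?_
  rw [Finset.mem_range] at hk
  congr 1
  omega

theorem factorial_half_sq_mul_neg_one_pow {p m : ℕ} [Fact p.Prime] (hpm : p = 2 * m + 1) :
    (m.factorial : ZMod p) ^ 2 * (-1) ^ m = -1 := by
  have h := ZMod.wilsons_lemma p
  rw [show p - 1 = 2 * m by omega, ← Finset.prod_range_add_one_eq_factorial, Nat.cast_prod,
    prod_range_two_mul_eq_prod_mul_reflect m (fun k => (k : ZMod p))] at h
  have hsign : ((-1 : ZMod p)) ^ m = ∏ _k ∈ Finset.range m, (-1) := by simp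
  refine Eq.trans ?_ h
  rw [hsign, ← Finset.prod_range_add_one_eq_factorial, Nat.cast_prod, ← Finset.prod_pow,
    ← Finset.prod_mul_distrib]
  refine Finset.prod_congr rfl fun k hk => ?_
  rw [Finset.mem_range] at hk
  rw [← hpm, Nat.cast_sub (by omega), CharP.cast_eq_zero (ZMod p) p]
  ring

open Polynomial in
theorem exists_prod_one_sub_X_pow {R : Type*} [CommRing R] (m : ℕ) :
    ∃ H : R[X], ∏ k ∈ Finset.range m, (1 - X ^ (k + 1)) = (X - 1) ^ m * H ∧
      H.eval 1 = (-1) ^ m * m.factorial := by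
  refine ⟨∏ k ∈ Finset.range m, -∑ i ∈ Finset.range (k + 1), X ^ i, ?_, ?_⟩
  · rw [← Finset.card_range m, ← Finset.prod_const, Finset.card_range, ← Finset.prod_mul_distrib]
    refine Finset.prod_congr rfl fun k _ => ?_
    rw [mul_neg, mul_geom_sum, neg_sub]
  · simp [eval_prod, eval_finsetSum, Finset.prod_neg, ← Finset.prod_range_add_one_eq_factorial]

open Polynomial in
/-- If the quadratic Gauss sum is `ε` times Kronecker's product, then `ε = 1` modulo `p`. -/
theorem intCast_eq_one_of_sum_quadraticChar_eq {p m : ℕ} [hp : Fact p.Prime] (hpm : p = 2 * m + 1)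
    (hm : m ≠ 0) {ζ : ℂ} (hζ : IsPrimitiveRoot ζ p) (M : ℕ) (ε : ℤ)
    (h : ∑ a : ZMod p, (quadraticChar (ZMod p) a : ℂ) * ζ ^ a.val =
      ε * (ζ ^ M * ∏ k ∈ Finset.range m, (1 - ζ ^ (k + 1)))) :
    (ε : ZMod p) = 1 := by
  have hchar : ringChar (ZMod p) ≠ 2 := by rw [ZMod.ringChar_zmod_n]; omega
  have hdvd : cyclotomic p ℤ ∣ ∑ a : ZMod p, C (quadraticChar (ZMod p) a) * X ^ a.val -
      C ε * (X ^ M * ∏ k ∈ Finset.range m, (1 - X ^ (k + 1))) := by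
    rw [cyclotomic_eq_minpoly hζ hp.out.pos]
    refine minpoly.isIntegrallyClosed_dvd (hζ.isIntegral hp.out.pos) ?_
    simpa [map_prod, sub_eq_zero] using h
  obtain ⟨Q, hQ⟩ := hdvd
  have hcyc : cyclotomic p (ZMod p) = (X - 1) ^ m * (X - 1) ^ m := by
    have := cyclotomic_mul_prime_eq_pow_of_not_dvd (ZMod p) (p := p) (n := 1)
      hp.out.not_dvd_one
    rw [one_mul, cyclotomic_one] at this
    rw [this, ← pow_add]
    congr 1
    omega
  obtain ⟨H, hH, hH1⟩ := exists_prod_one_sub_X_pow (R := ZMod p) m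
  replace hQ := congrArg (Polynomial.map (Int.castRingHom (ZMod p))) hQ
  simp only [Polynomial.map_sub, Polynomial.map_sum, Polynomial.map_mul, Polynomial.map_prod,
    Polynomial.map_pow, map_X, Polynomial.map_one, map_cyclotomic, hcyc, hH,
    Polynomial.map_C] at hQ
  simp only [eq_intCast (Int.castRingHom _)] at hQ
  replace hQ : ∑ a : ZMod p, C ((quadraticChar (ZMod p) a : ZMod p)) * X ^ a.val =
      (X - 1) ^ m * (C (ε : ZMod p) * X ^ M * H + (X - 1) ^ m * Q.map (Int.castRingHom _)) := by
    linear_combination hQ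
  replace hQ := congrArg (fun f => ((fun g : (ZMod p)[X] => X * derivative g)^[m] f).eval 1) hQ
  simp only [eval_one_iterate_X_mul_derivative, iterate_X_mul_derivative_sum] at hQ
  have hsum : ∑ a : ZMod p, (quadraticChar (ZMod p) a : ZMod p) * a ^ m = -1 := by
    have h2 : ∀ a : ZMod p, (quadraticChar (ZMod p) a : ZMod p) * a ^ m = a ^ (p - 1) := by
      intro a
      rw [quadraticChar_eq_pow_of_char_ne_two' hchar, ZMod.card, ← pow_add]
      congr 1
      omega
    simp only [h2]
    have h3 : ∀ a : ZMod p, a ^ (p - 1) = 1 - if a = 0 then 1 else 0 := by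
      intro a
      split_ifs with ha
      · simp [ha, show p - 1 ≠ 0 by omega]
      · rw [ZMod.pow_card_sub_one_eq_one ha, sub_zero]
    simp [h3]
  simp only [ZMod.natCast_zmod_val, eval_finsetSum, eval_add, eval_sub, eval_mul, eval_pow, eval_C,
    eval_X, eval_one, one_pow, mul_one, hsum, hH1, sub_self, zero_pow hm, zero_mul, add_zero] at hQ
  have hw := factorial_half_sq_mul_neg_one_pow hpm
  linear_combination (ε : ZMod p) * hw + hQ

open Complex in
theorem one_sub_exp_two_mul_I (x : ℂ) : 1 - exp (2 * x * I) = -I * (2 * sin x) * exp (x * I) := by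
  have h : exp (-x * I) * exp (x * I) = 1 := by rw [← exp_add]; simp
  rw [sin, show 2 * x * I = x * I + x * I by ring, exp_add]
  linear_combination (exp (-x * I) * exp (x * I) - exp (x * I) * exp (x * I)) * I_sq - h

open Complex in
theorem prod_two_mul_sin_eq_sqrt (m : ℕ) :
    ∏ k ∈ Finset.range m, 2 * Real.sin (Real.pi * (k + 1 : ℕ) / (2 * m + 1 : ℕ)) =
      Real.sqrt (2 * m + 1 : ℕ) := by
  set p := 2 * m + 1 with hpm
  have hp : (p : ℂ) ≠ 0 := by simp [hpm]; norm_cast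
  have hζ := isPrimitiveRoot_exp p (by omega)
  have hpos : ∀ k ∈ Finset.range m, 0 ≤ 2 * Real.sin (Real.pi * (k + 1 : ℕ) / p) := by
    intro k hk
    rw [Finset.mem_range] at hk
    refine mul_nonneg two_pos.le (Real.sin_nonneg_of_nonneg_of_le_pi (by positivity) ?_)
    rw [div_le_iff₀ (by positivity)]
    gcongr
    omega
  rw [eq_comm, Real.sqrt_eq_iff_mul_self_eq (by positivity) (Finset.prod_nonneg hpos),
    ← Finset.prod_mul_distrib]
  have h := hζ.prod_one_sub_pow_eq_order
  rw [prod_range_two_mul_eq_prod_mul_reflect m (fun k => 1 - exp (2 * Real.pi * I / p) ^ k)] at h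
  rw [eq_comm, ← ofReal_inj, ofReal_prod]
  trans ((2 * m : ℕ) : ℂ) + 1
  · rw [← h]
    refine Finset.prod_congr rfl fun k hk => ?_
    rw [Finset.mem_range] at hk
    have hinv : exp (2 * Real.pi * I / p) ^ (p - (k + 1)) =
        exp (2 * -(Real.pi * (k + 1 : ℕ) / p) * I) := by
      rw [pow_sub₀ _ (exp_ne_zero _) (by omega), hζ.pow_eq_one, one_mul, ← exp_nat_mul, ← exp_neg]
      congr 1
      ring
    have hpow : exp (2 * Real.pi * I / p) ^ (k + 1) =
        exp (2 * (Real.pi * (k + 1 : ℕ) / p) * I) := by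
      rw [← exp_nat_mul]
      congr 1
      ring
    rw [← hpm, hinv, hpow, one_sub_exp_two_mul_I, one_sub_exp_two_mul_I, sin_neg]
    have he : exp (-(Real.pi * (k + 1 : ℕ) / p) * I) * exp (Real.pi * (k + 1 : ℕ) / p * I) = 1 := by
      rw [← exp_add]; simp
    push_cast at he ⊢
    linear_combination (4 * sin (Real.pi * (k + 1) / p) ^ 2 * (I ^ 2 * he + I_sq))
  · rw [hpm]; push_cast; ring

open Complex in
theorem exists_pow_mul_prod_one_sub_pow (m : ℕ) :
    ∃ M : ℕ, exp (2 * Real.pi * I / (2 * m + 1 : ℕ)) ^ M *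
      ∏ k ∈ Finset.range m, (1 - exp (2 * Real.pi * I / (2 * m + 1 : ℕ)) ^ (k + 1)) =
        I ^ m ^ 2 * (Real.sqrt (2 * m + 1 : ℕ) : ℂ) := by
  rw [← prod_two_mul_sin_eq_sqrt]
  set p := 2 * m + 1 with hpm
  set ζ := exp (2 * Real.pi * I / p)
  set η := exp (Real.pi * I / p)
  have hp : (p : ℂ) ≠ 0 := by simp [hpm]; norm_cast
  have hη : η ^ p = -1 := by
    rw [← exp_nat_mul, mul_div_cancel₀ _ hp, exp_pi_mul_I]
  have hζη : ζ = η ^ 2 := by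
    simp only [ζ, η, ← exp_nat_mul]
    congr 1
    push_cast
    ring
  set T := ∑ k ∈ Finset.range m, (k + 1)
  have hT : 2 * T = m * (m + 1) := by
    have := Finset.sum_range_id_mul_two (m + 1)
    rw [Finset.sum_range_succ'] at this
    simp only [add_zero, Nat.add_sub_cancel] at this
    rw [mul_comm, this, mul_comm]
  have hprod : ∏ k ∈ Finset.range m, (1 - ζ ^ (k + 1)) = (-I) ^ m * η ^ T *
      (∏ k ∈ Finset.range m, 2 * Real.sin (Real.pi * (k + 1 : ℕ) / p) : ℝ) := by
    have hI : (-I) ^ m = ∏ _k ∈ Finset.range m, (-I) := by simp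
    rw [hI, ← Finset.prod_pow_eq_pow_sum, ofReal_prod, ← Finset.prod_mul_distrib,
      ← Finset.prod_mul_distrib]
    refine Finset.prod_congr rfl fun k _ => ?_
    have h1 : ζ ^ (k + 1) = exp (2 * (Real.pi * (k + 1 : ℕ) / p) * I) := by
      rw [← exp_nat_mul]
      congr 1
      ring
    have h2 : η ^ (k + 1) = exp (Real.pi * (k + 1 : ℕ) / p * I) := by
      rw [← exp_nat_mul]
      congr 1
      ring
    rw [h1, h2, one_sub_exp_two_mul_I]
    push_cast
    ring
  refine ⟨m * T, ?_⟩
  have hI : ζ ^ (m * T) * ((-I) ^ m * η ^ T) = I ^ m ^ 2 := by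
    have h1 : ζ ^ (m * T) * η ^ T = (-1) ^ T := by
      rw [hζη, ← pow_mul, ← pow_add, ← hη, ← pow_mul]
      congr 1
      rw [hpm]
      ring
    have h2 : (-I) ^ m = I ^ (3 * m) := by
      rw [pow_mul, I_pow_three]
    rw [mul_left_comm, h1, h2, ← I_sq, ← pow_mul, hT, ← pow_add,
      show 3 * m + m * (m + 1) = m ^ 2 + 4 * m by ring, pow_add, pow_mul I 4, I_pow_four, one_pow,
      mul_one]
  rw [hprod, ← hI]
  ring

theorem sq_eq_neg_one_pow_mul_of_quadraticChar {p m : ℕ} [hp : Fact p.Prime]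
    (hpm : p = 2 * m + 1) :
    (∑ a : ZMod p, (quadraticChar (ZMod p) a : ℂ) *
      Complex.exp (2 * Real.pi * Complex.I / p) ^ a.val) ^ 2 = (-1) ^ m * p := by
  have hchar : ringChar (ZMod p) ≠ 2 := by rw [ZMod.ringChar_zmod_n]; omega
  have h := gaussSum_sq (χ := (quadraticChar (ZMod p)).ringHomComp (Int.castRingHom ℂ))
    ((MulChar.ringHomComp_ne_one_iff (RingHom.injective_int _)).mpr (quadraticChar_ne_one hchar))
    ((quadraticChar_isQuadratic (ZMod p)).comp _) (ZMod.isPrimitive_stdAddChar p)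
  rw [MulChar.ringHomComp_apply, quadraticChar_neg_one hchar, ZMod.card,
    ZMod.χ₄_eq_neg_one_pow (by omega), show p / 2 = m by omega] at h
  rw [gaussSum] at h
  convert h using 2
  · refine Finset.sum_congr rfl fun a _ => ?_
    rw [MulChar.ringHomComp_apply]
    congr 1
    have := ZMod.stdAddChar_coe (N := p) (a.val : ℤ)
    rw [Int.cast_natCast, ZMod.natCast_zmod_val] at this
    rw [this, ← Complex.exp_nat_mul]
    congr 1
    push_cast
    ring
  · simp

/-- Gauss's evaluation of the quadratic Gauss sum, including the sign. -/
theorem sum_quadraticChar_mul_exp_pow {p m : ℕ} [hp : Fact p.Prime]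
    (hpm : p = 2 * m + 1) (hm : m ≠ 0) :
    ∑ a : ZMod p, (quadraticChar (ZMod p) a : ℂ) *
      Complex.exp (2 * Real.pi * Complex.I / p) ^ a.val = Complex.I ^ m ^ 2 * (Real.sqrt p : ℂ) := by
  obtain ⟨M, hM⟩ := exists_pow_mul_prod_one_sub_pow m
  rw [← hpm] at hM
  have hsq : (Complex.I ^ m ^ 2 * (Real.sqrt p : ℂ)) ^ 2 = (-1) ^ m * p := by
    rw [mul_pow, ← Complex.ofReal_pow, Real.sq_sqrt (by positivity), ← pow_mul, mul_comm (m ^ 2),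
      pow_mul, Complex.I_sq, Complex.ofReal_natCast]
    congr 1
    rcases Nat.even_or_odd m with h | h
    · rw [h.neg_one_pow, (h.pow_of_ne_zero two_ne_zero).neg_one_pow]
    · rw [h.neg_one_pow, h.pow.neg_one_pow]
  have hζ := Complex.isPrimitiveRoot_exp p hp.out.ne_zero
  rcases sq_eq_sq_iff_eq_or_eq_neg.mp
    ((sq_eq_neg_one_pow_mul_of_quadraticChar hpm).trans hsq.symm) with h | h
  · exact h
  · have h1 := intCast_eq_one_of_sum_quadraticChar_eq hpm hm hζ M (-1) (by rw [h, hM]; simp)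
    have : Fact (2 < p) := ⟨by omega⟩
    exact absurd (by simpa using h1) (ZMod.neg_one_ne_one (n := p))

theorem sum_zmod_eq_add_sum_Icc {M : Type*} [AddCommMonoid M] {p : ℕ} [NeZero p] (f : ZMod p → M) :
    ∑ a : ZMod p, f a = f 0 + ∑ k ∈ Finset.Icc 1 (p - 1), f k := by
  rw [← Finset.add_sum_erase _ _ (Finset.mem_univ (0 : ZMod p))]
  congr 1
  have hp := NeZero.pos p
  refine Finset.sum_nbij' ZMod.val Nat.cast ?_ ?_ ?_ ?_ ?_
  · intro a ha
    have h0 := (ZMod.val_ne_zero a).mpr (Finset.ne_of_mem_erase ha)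
    have h1 := ZMod.val_lt a
    rw [Finset.mem_Icc]
    omega
  · intro k hk
    rw [Finset.mem_Icc] at hk
    refine Finset.mem_erase.mpr ⟨?_, Finset.mem_univ _⟩
    rw [Ne, ZMod.natCast_eq_zero_iff]
    exact Nat.not_dvd_of_pos_of_lt (by omega) (by omega)
  · simp
  · intro k hk
    rw [Finset.mem_Icc] at hk
    exact ZMod.val_cast_of_lt (by omega)
  · simp

open Classical in
/-- Let `p` be an odd prime, `ζ = exp(2πi/p)`, and
`G_p = √p` if `p ≡ 1 (mod 4)`, `G_p = i√p` if `p ≡ 3 (mod 4)`.  Then the sum of `ζ^k`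
over quadratic residues `k ∈ {1,…,p-1}` equals `(-1+G_p)/2`, the sum over non-residues
equals `(-1-G_p)/2`, and both sums lie in `ℤ[(1+G_p)/2]`. -/
theorem sum_primitive_roots_over_residues (p : ℕ) [hp : Fact p.Prime] (hp2 : p ≠ 2) :
    let ζ : ℂ := Complex.exp (2 * Real.pi * Complex.I / (p : ℂ))
    let G : ℂ := if p % 4 = 1 then ((Real.sqrt p : ℝ) : ℂ)
      else Complex.I * ((Real.sqrt p : ℝ) : ℂ)
    (∑ k ∈ (Finset.Icc 1 (p - 1)).filter
        (fun k : ℕ => ∃ m : ℤ, (k : ZMod p) = (m : ZMod p) ^ 2), ζ ^ k = (-1 + G) / 2) ∧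
    (∑ k ∈ (Finset.Icc 1 (p - 1)).filter
        (fun k : ℕ => ¬ ∃ m : ℤ, (k : ZMod p) = (m : ZMod p) ^ 2), ζ ^ k = (-1 - G) / 2) ∧
    (∑ k ∈ (Finset.Icc 1 (p - 1)).filter
        (fun k : ℕ => ∃ m : ℤ, (k : ZMod p) = (m : ZMod p) ^ 2), ζ ^ k)
      ∈ Algebra.adjoin ℤ {(1 + G) / 2} ∧
    (∑ k ∈ (Finset.Icc 1 (p - 1)).filter
        (fun k : ℕ => ¬ ∃ m : ℤ, (k : ZMod p) = (m : ZMod p) ^ 2), ζ ^ k)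
      ∈ Algebra.adjoin ℤ {(1 + G) / 2} := by
  intro ζ G
  have hodd := hp.out.eq_two_or_odd'.resolve_left hp2
  obtain ⟨m, hpm⟩ := hodd
  have hm : m ≠ 0 := by
    rintro rfl
    exact hp.out.one_lt.ne' hpm
  have hG : Complex.I ^ m ^ 2 * (Real.sqrt p : ℂ) = G := by
    rcases Nat.even_or_odd' m with ⟨n, rfl | rfl⟩
    · have h4 : p % 4 = 1 := by omega
      simp only [G, h4, if_true]
      rw [mul_pow, pow_mul, show (2 ^ 2 : ℕ) = 4 by norm_num, Complex.I_pow_four, one_pow, one_mul]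
    · have h4 : ¬ p % 4 = 1 := by omega
      simp only [G, h4, if_false]
      rw [show (2 * n + 1) ^ 2 = 4 * (n ^ 2 + n) + 1 by ring, pow_succ, pow_mul, Complex.I_pow_four,
        one_pow, one_mul]
  have hval : ∀ k ∈ Finset.Icc 1 (p - 1), (k : ZMod p).val = k := by
    intro k hk
    rw [Finset.mem_Icc] at hk
    exact ZMod.val_cast_of_lt (by omega)
  have hchar : ∀ k ∈ Finset.Icc 1 (p - 1), (quadraticChar (ZMod p) k : ℂ) =
      if ∃ m : ℤ, (k : ZMod p) = (m : ZMod p) ^ 2 then 1 else -1 := by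
    intro k hk
    rw [Finset.mem_Icc] at hk
    have h0 : (k : ZMod p) ≠ 0 := by
      rw [Ne, ZMod.natCast_eq_zero_iff]
      exact Nat.not_dvd_of_pos_of_lt (by omega) (by omega)
    have hiff : (∃ m : ℤ, (k : ZMod p) = (m : ZMod p) ^ 2) ↔ IsSquare (k : ZMod p) := by
      rw [isSquare_iff_exists_sq, ZMod.intCast_surjective.exists]
    rw [hiff]
    split_ifs with h
    · rw [(quadraticChar_one_iff_isSquare h0).mpr h, Int.cast_one]
    · rw [quadraticChar_neg_one_iff_not_isSquare.mpr h, Int.cast_neg, Int.cast_one]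
  have hζ : IsPrimitiveRoot ζ p := Complex.isPrimitiveRoot_exp p hp.out.ne_zero
  have hadd : ∑ k ∈ Finset.Icc 1 (p - 1), ζ ^ k = -1 := by
    have h := hζ.geom_sum_eq_zero hp.out.one_lt
    rw [← Nat.sub_add_cancel hp.out.one_le, Finset.sum_range_succ', pow_zero,
      Finset.range_eq_Ico, Finset.sum_Ico_add' (fun k => ζ ^ k)] at h
    exact eq_neg_of_add_eq_zero_left h
  have hsub := sum_quadraticChar_mul_exp_pow hpm hm
  rw [hG, sum_zmod_eq_add_sum_Icc, quadraticChar_zero, Int.cast_zero, zero_mul, zero_add,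
    Finset.sum_congr rfl fun k hk => by rw [hchar k hk, hval k hk]] at hsub
  simp only [ite_mul, one_mul, neg_one_mul] at hsub
  rw [Finset.sum_ite, Finset.sum_neg_distrib] at hsub
  rw [← Finset.sum_filter_add_sum_filter_not _
    (fun k : ℕ => ∃ m : ℤ, (k : ZMod p) = (m : ZMod p) ^ 2)] at hadd
  have hres : ∑ k ∈ (Finset.Icc 1 (p - 1)).filter
      (fun k : ℕ => ∃ m : ℤ, (k : ZMod p) = (m : ZMod p) ^ 2), ζ ^ k = (-1 + G) / 2 := by
    linear_combination (hadd + hsub) / 2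
  have hnonres : ∑ k ∈ (Finset.Icc 1 (p - 1)).filter
      (fun k : ℕ => ¬ ∃ m : ℤ, (k : ZMod p) = (m : ZMod p) ^ 2), ζ ^ k = (-1 - G) / 2 := by
    linear_combination (hadd - hsub) / 2
  have hmem : (1 + G) / 2 ∈ Algebra.adjoin ℤ {(1 + G) / 2} :=
    Algebra.subset_adjoin (Set.mem_singleton _)
  refine ⟨hres, hnonres, ?_, ?_⟩
  · rw [hres, show (-1 + G) / 2 = (1 + G) / 2 - 1 by ring]
    exact sub_mem hmem (one_mem _)
  · rw [hnonres, show (-1 - G) / 2 = -((1 + G) / 2) by ring]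
    exact neg_mem hmem
end

section
/- Let p be an odd prime, ε = (−1)^((p−1)/2), K = CyclotomicField p ℚ, ζ ∈ K a primitive p-th root of unity, c an integer with p ∤ c, and γ = Σ_{x ∈ ZMod p} ζ^{c·x²}. Define p×p matrices over K indexed by ZMod p: 𝒮 with entries 𝒮_{x,y} = (ε·γ/p)·ζ^{−2cxy}, and 𝒯 = the diagonal matrix with 𝒯_{x,x} = ζ^{c·x²}. Let J be the permutation matrix with J_{x,y} = 1 if y = −x and 0 otherwise. Then 𝒮² = ε·J, 𝒮⁴ = 1 (the identity matrix), and (𝒮·𝒯)³ = 𝒮². -/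
open Finset in
/-- The sum of a function over the squares, counted with multiplicity, in terms of the quadratic
character. -/
theorem sum_comp_sq_eq_sum_quadraticChar {F R : Type*} [Field F] [Fintype F] [DecidableEq F]
    [CommRing R] (hF : ringChar F ≠ 2) (f : F → R) :
    ∑ x, f (x ^ 2) = ∑ a, ((quadraticChar F a : R) + 1) * f a := by
  rw [← sum_fiberwise_of_maps_to (g := fun x : F => x ^ 2) (t := univ) fun _ _ => mem_univ _]
  refine sum_congr rfl fun a _ => ?_
  have hcard := quadraticChar_card_sqrts hF a
  have hset : {x : F | x ^ 2 = a}.toFinset = univ.filter fun x : F => x ^ 2 = a := by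
    ext; simp
  rw [hset] at hcard
  rw [sum_congr rfl (g := fun _ => f a) fun x hx => by rw [(mem_filter.mp hx).2], sum_const,
    nsmul_eq_mul]
  congr 1
  exact_mod_cast congrArg (Int.cast : ℤ → R) hcard

/-- The quadratic Gauss sum `∑ ψ(x²)` of a primitive additive character squares to `χ(-1)·|F|`. -/
theorem sq_sum_addChar_sq {F K : Type*} [Field F] [Fintype F] [DecidableEq F] [Field K]
    [CharZero K] (hF : ringChar F ≠ 2) {ψ : AddChar F K} (hψ : ψ.IsPrimitive) :
    (∑ x, ψ (x ^ 2)) ^ 2 = (quadraticChar F (-1) : K) * Fintype.card F := by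
  have hne : (quadraticChar F).ringHomComp (Int.castRingHom K) ≠ 1 :=
    (MulChar.ringHomComp_ne_one_iff (Int.castRingHom K).injective_int).mpr
      (quadraticChar_ne_one hF)
  have hsum : ∑ x, ψ (x ^ 2) = gaussSum ((quadraticChar F).ringHomComp (Int.castRingHom K)) ψ := by
    have hψ1 : ψ ≠ 1 := by simpa using hψ one_ne_zero
    rw [sum_comp_sq_eq_sum_quadraticChar hF]
    simp [gaussSum, add_mul, Finset.sum_add_distrib, AddChar.sum_eq_zero_of_ne_one hψ1]
  rw [hsum, gaussSum_sq hne ((quadraticChar_isQuadratic F).comp _) hψ]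
  simp

open Matrix in
/-- The relations between the Weil representation matrices `S = (a ψ(-2xy))` and
`T = diag(ψ(x²))` over a finite field, where `a` is normalized by `a² |F| = ε = ±1` and
`a ∑ ψ(x²) = 1`. -/
theorem weilMatrix_relations {F K : Type*} [Field F] [Fintype F] [DecidableEq F] [Field K]
    (h2 : (2 : F) ≠ 0) {ψ : AddChar F K} (hψ : ψ.IsPrimitive) {a ε : K} (hε : ε ^ 2 = 1)
    (ha : a ^ 2 * Fintype.card F = ε) (haγ : a * ∑ x, ψ (x ^ 2) = 1) {S T J : Matrix F F K}
    (hS : ∀ x y, S x y = a * ψ (-(2 * x * y))) (hT : T = diagonal fun x => ψ (x ^ 2))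
    (hJ : ∀ x y, J x y = if y = -x then 1 else 0) :
    S ^ 2 = ε • J ∧ S ^ 4 = 1 ∧ (S * T) ^ 3 = S ^ 2 := by
  have hS2 : S ^ 2 = ε • J := by
    ext x z
    have hsum := AddChar.sum_mulShift (-(2 * (x + z))) hψ
    have hterm : ∀ y, S x y * S y z = a ^ 2 * ψ (y * -(2 * (x + z))) := fun y => by
      rw [hS, hS, mul_mul_mul_comm, ← AddChar.map_add_eq_mul, ← sq]
      congr 2; ring
    have hzero : -(2 * (x + z)) = 0 ↔ z = -x := by
      rw [neg_eq_zero, mul_eq_zero, or_iff_right h2, add_comm, add_eq_zero_iff_eq_neg]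
    rw [sq, mul_apply, Finset.sum_congr rfl fun y _ => hterm y, ← Finset.mul_sum, hsum,
      Matrix.smul_apply, hJ, smul_eq_mul, ← ha]
    simp only [hzero]
    split_ifs <;> simp
  have hJ2 : J * J = 1 := by
    ext x z
    rw [mul_apply, Finset.sum_eq_single (-x) (fun y _ hy => by simp [hJ, hy]) (by simp)]
    simp [hJ, one_apply, eq_comm (a := x) (b := z)]
  have hSTS : S * T * S * T = diagonal (fun x => ψ (-x ^ 2)) * S := by
    ext x z
    have hterm : ∀ y, (S * T) x y * S y z = a ^ 2 * ψ (-(x + z) ^ 2) * ψ ((y - (x + z)) ^ 2) :=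
      fun y => by
        rw [hT, mul_diagonal, hS, hS, mul_assoc (a ^ 2), ← AddChar.map_add_eq_mul,
          show -(x + z) ^ 2 + (y - (x + z)) ^ 2 = -(2 * x * y) + y ^ 2 + -(2 * y * z) by ring,
          AddChar.map_add_eq_mul, AddChar.map_add_eq_mul]
        ring
    have hshift : ∑ y, ψ ((y - (x + z)) ^ 2) = ∑ y, ψ (y ^ 2) :=
      (Equiv.subRight (x + z)).sum_comp fun y => ψ (y ^ 2)
    have hexp : ψ (-(x + z) ^ 2) * ψ (z ^ 2) = ψ (-x ^ 2) * ψ (-(2 * x * z)) := by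
      rw [← AddChar.map_add_eq_mul, ← AddChar.map_add_eq_mul]
      congr 1; ring
    have hprod : (S * T * S) x z = a * ψ (-(x + z) ^ 2) := by
      rw [mul_apply, Finset.sum_congr rfl fun y _ => hterm y, ← Finset.mul_sum, hshift]
      linear_combination a * ψ (-(x + z) ^ 2) * haγ
    rw [diagonal_mul, hS]
    nth_rewrite 2 [hT]
    rw [mul_diagonal, hprod]
    linear_combination a * hexp
  refine ⟨hS2, ?_, ?_⟩
  · rw [show 4 = 2 * 2 from rfl, pow_mul, hS2, sq, smul_mul_smul_comm, hJ2, ← sq, hε, one_smul]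
  · have hcube : (S * T) ^ 3 = diagonal (fun x => ψ (-x ^ 2)) * S ^ 2 * T := by
      rw [sq, ← mul_assoc, ← hSTS]
      simp only [pow_succ, pow_zero, one_mul, mul_assoc]
    rw [hcube, hS2, hT]
    ext x z
    rw [mul_diagonal, diagonal_mul, Matrix.smul_apply, hJ]
    split_ifs with h
    · have hinv : ψ (-x ^ 2) * ψ (z ^ 2) = 1 := by
        rw [h, neg_sq, ← AddChar.map_add_eq_mul, neg_add_cancel, AddChar.map_zero_eq_one]
      rw [smul_eq_mul]
      linear_combination ε * hinv
    · simp

/-- Relations of the Weil representation matrices: with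
`𝒮_{x,y} = (ε·γ/p)·ζ^{-2cxy}`, `𝒯 = diag(ζ^{c·x²})` and `J` the permutation matrix of
`x ↦ -x`, one has `𝒮² = ε·J`, `𝒮⁴ = 1` and `(𝒮𝒯)³ = 𝒮²`. -/
theorem weil_rep_matrix_relations
    (p : ℕ+) [hp : Fact (p : ℕ).Prime] (hp2 : (p : ℕ) ≠ 2)
    (ε : ℤ) (hε : ε = (-1) ^ (((p : ℕ) - 1) / 2))
    (ζ : CyclotomicField p ℚ) (hζ : IsPrimitiveRoot ζ (p : ℕ))
    (c : ℤ) (hc : ¬ ((p : ℕ) : ℤ) ∣ c)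
    (γ : CyclotomicField p ℚ)
    (hγ : γ = ∑ x : ZMod (p : ℕ), ζ ^ (c * ((x.val : ℤ)) ^ 2))
    (𝒮 𝒯 J : Matrix (ZMod (p : ℕ)) (ZMod (p : ℕ)) (CyclotomicField p ℚ))
    (hS : ∀ x y, 𝒮 x y = (ε : CyclotomicField p ℚ) * γ / ((p : ℕ) : CyclotomicField p ℚ) *
        ζ ^ (-(2 * c * (x.val : ℤ) * (y.val : ℤ))))
    (hT : 𝒯 = Matrix.diagonal fun x => ζ ^ (c * ((x.val : ℤ)) ^ 2))
    (hJ : ∀ x y, J x y = if y = -x then 1 else 0) :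
    𝒮 ^ 2 = (ε : CyclotomicField p ℚ) • J ∧ 𝒮 ^ 4 = 1 ∧ (𝒮 * 𝒯) ^ 3 = 𝒮 ^ 2 := by
  have hp0 : ((p : ℕ) : CyclotomicField p ℚ) ≠ 0 := Nat.cast_ne_zero.mpr hp.out.ne_zero
  have hF : ringChar (ZMod (p : ℕ)) ≠ 2 := by rwa [ZMod.ringChar_zmod_n]
  have hζc : IsPrimitiveRoot (ζ ^ c) (p : ℕ) :=
    hζ.zpow_of_gcd_eq_one c <| Int.isCoprime_iff_gcd_eq_one.mp <| IsCoprime.symm <|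
      (Nat.prime_iff_prime_int.mp hp.out).coprime_iff_not_dvd.mpr hc
  have hψ := AddChar.zmodChar_primitive_of_primitive_root (p : ℕ) hζc
  set ψ := AddChar.zmodChar (p : ℕ) hζc.pow_eq_one
  have hψ_int : ∀ n : ℤ, ψ (n : ZMod (p : ℕ)) = ζ ^ (c * n) := fun n => by
    rw [← zsmul_one, AddChar.map_zsmul_eq_zpow, zpow_mul]
    congr 1
    simpa using AddChar.zmodChar_apply' hζc.pow_eq_one 1
  have hψ_sq : ∀ x : ZMod (p : ℕ), ζ ^ (c * (x.val : ℤ) ^ 2) = ψ (x ^ 2) := fun x => by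
    rw [← hψ_int]; simp
  have hψ_mul : ∀ x y : ZMod (p : ℕ),
      ζ ^ (-(2 * c * (x.val : ℤ) * (y.val : ℤ))) = ψ (-(2 * x * y)) := fun x y => by
    rw [show -(2 * c * (x.val : ℤ) * (y.val : ℤ)) = c * -(2 * x.val * y.val) by ring, ← hψ_int]
    simp
  have hε2 : (ε : CyclotomicField p ℚ) ^ 2 = 1 := by
    rw [hε]; push_cast; rw [← pow_mul, mul_comm, pow_mul]; simp
  have hodd : (p : ℕ) % 2 = 1 := hp.out.eq_two_or_odd.resolve_left hp2
  have hχ : quadraticChar (ZMod (p : ℕ)) (-1) = ε := by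
    rw [quadraticChar_neg_one hF, ZMod.card, ZMod.χ₄_eq_neg_one_pow hodd, hε]
    congr 1; omega
  simp only [hψ_sq] at hγ hT
  simp only [hψ_mul] at hS
  have hγ2 : γ ^ 2 = ε * (p : ℕ) := by
    rw [hγ, sq_sum_addChar_sq hF hψ, hχ, ZMod.card]
  refine weilMatrix_relations (Ring.two_ne_zero hF) hψ hε2 ?_ ?_ hS hT hJ
  · rw [ZMod.card]
    field_simp
    linear_combination (ε : CyclotomicField p ℚ) ^ 2 * hγ2 + ε * (p : ℕ) * hε2
  · rw [← hγ]
    field_simp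
    linear_combination (ε : CyclotomicField p ℚ) * hγ2 + (p : ℕ) * hε2
end

section
/- Let p be an odd prime, ε = (−1)^((p−1)/2), K = CyclotomicField p ℚ, ζ ∈ K a primitive p-th root of unity, c an integer with p ∤ c, and γ = Σ_{x ∈ ZMod p} ζ^{c·x²}. Define p×p matrices over K indexed by ZMod p: 𝒮 with entries 𝒮_{x,y} = (ε·γ/p)·ζ^{−2cxy}, and 𝒯 = the diagonal matrix with 𝒯_{x,x} = ζ^{c·x²}. Then there exists a group homomorphism ρ from SL(2, ZMod p) to the group of invertible p×p matrices over K (indexed by ZMod p) such that ρ(s) = 𝒮 and ρ(t) = 𝒯, where s = [[0,−1],[1,0]] and t = [[1,1],[0,1]] in SL(2, ZMod p). (This is the Weil representation attached to the quadratic form Q(x) = c·x²/p.) -/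
namespace WeilRep

open Matrix

variable {F K : Type*} [Field F] [Fintype F] [DecidableEq F] [Field K]

variable (F K) in
/-- The quadratic character of a finite field `F`, with values in the field `K`. -/
noncomputable def quadChar : MulChar F K :=
  (quadraticChar F).ringHomComp (Int.castRingHom K)

theorem quadChar_apply (a : F) : quadChar F K a = (quadraticChar F a : K) := rfl

theorem quadChar_mul_self {a : F} (ha : a ≠ 0) : quadChar F K a * quadChar F K a = 1 := by
  rw [quadChar_apply, ← Int.cast_mul, ← sq, quadraticChar_sq_one ha, Int.cast_one]

theorem quadChar_inv (a : F) : quadChar F K a⁻¹ = quadChar F K a := by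
  rcases eq_or_ne a 0 with rfl | ha
  · rw [_root_.inv_zero]
  · have h : quadChar F K a⁻¹ * quadChar F K a = 1 := by
      rw [← map_mul, inv_mul_cancel₀ ha, map_one]
    calc quadChar F K a⁻¹ = quadChar F K a⁻¹ * (quadChar F K a * quadChar F K a) := by
          rw [quadChar_mul_self ha, mul_one]
      _ = quadChar F K a := by rw [← mul_assoc, h, one_mul]

theorem quadChar_isQuadratic : (quadChar F K).IsQuadratic :=
  (quadraticChar_isQuadratic F).comp _

theorem quadChar_ne_one [CharZero K] (hF : ringChar F ≠ 2) : quadChar F K ≠ 1 :=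
  (MulChar.ringHomComp_ne_one_iff (Int.castRingHom K).injective_int).mpr
    (quadraticChar_ne_one hF)

theorem gaussSum_quadChar_sq [CharZero K] (hF : ringChar F ≠ 2) {ψ : AddChar F K}
    (hψ : ψ.IsPrimitive) :
    gaussSum (quadChar F K) ψ ^ 2 = quadChar F K (-1) * Fintype.card F :=
  gaussSum_sq (quadChar_ne_one hF) quadChar_isQuadratic hψ

theorem gaussSum_quadChar_ne_zero [CharZero K] (hF : ringChar F ≠ 2) {ψ : AddChar F K}
    (hψ : ψ.IsPrimitive) : gaussSum (quadChar F K) ψ ≠ 0 := by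
  intro h
  have h2 := gaussSum_quadChar_sq hF hψ
  rw [h, zero_pow two_ne_zero, eq_comm, mul_eq_zero] at h2
  rcases h2 with h2 | h2
  · have := quadChar_mul_self (K := K) (neg_ne_zero.mpr (one_ne_zero (α := F)))
    simp [h2] at this
  · exact Fintype.card_ne_zero (Nat.cast_eq_zero.mp h2)

theorem sum_comp_sq (hF : ringChar F ≠ 2) (f : F → K) :
    ∑ x : F, f (x ^ 2) = ∑ y : F, (quadChar F K y + 1) * f y := by
  rw [← Finset.sum_fiberwise (s := Finset.univ) (g := fun x : F => x ^ 2)]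
  refine Finset.sum_congr rfl fun y _ => ?_
  rw [Finset.sum_congr rfl (g := fun _ => f y)
    (fun x hx => by rw [(Finset.mem_filter.mp hx).2]), Finset.sum_const, nsmul_eq_mul]
  have h := quadraticChar_card_sqrts hF y
  have h' : {x : F | x ^ 2 = y}.toFinset = Finset.univ.filter fun x : F => x ^ 2 = y := by
    ext; simp
  rw [h'] at h
  rw [quadChar_apply, ← Int.cast_one (R := K), ← Int.cast_add, ← h, Int.cast_natCast]

theorem sum_addChar_mul_sq (hF : ringChar F ≠ 2) {ψ : AddChar F K} (hψ : ψ.IsPrimitive)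
    {a : F} (ha : a ≠ 0) :
    ∑ x : F, ψ (a * x ^ 2) = quadChar F K a * gaussSum (quadChar F K) ψ := by
  rw [sum_comp_sq hF fun y => ψ (a * y)]
  have h0 : ∑ y : F, ψ (a * y) = 0 := by
    have := AddChar.sum_eq_zero_of_ne_one (hψ ha)
    simpa [AddChar.mulShift_apply] using this
  have h1 := gaussSum_mulShift (quadChar F K) ψ (Units.mk0 a ha)
  rw [Units.val_mk0] at h1
  rw [← h1, ← mul_assoc, quadChar_mul_self ha, one_mul]
  simp [add_mul, Finset.sum_add_distrib, h0, gaussSum, AddChar.mulShift_apply]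

theorem sum_addChar_quadratic (hF : ringChar F ≠ 2) {ψ : AddChar F K} (hψ : ψ.IsPrimitive)
    {a : F} (ha : a ≠ 0) (e : F) :
    ∑ x : F, ψ (a * (x - e) ^ 2) = quadChar F K a * gaussSum (quadChar F K) ψ := by
  rw [← sum_addChar_mul_sq hF hψ ha]
  exact Equiv.sum_comp (Equiv.subRight e) fun x => ψ (a * x ^ 2)

/-- The matrix by which an element of `SL(2, F)` acts in the Weil representation attached to an
additive character of `F`. -/
noncomputable def weilMatrix (ψ : AddChar F K) (g : SpecialLinearGroup (Fin 2) F) :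
    Matrix F F K := fun x y =>
  if g 1 0 = 0 then
    if y = g 0 0 * x then quadChar F K (g 0 0) * ψ (g 0 0 * g 0 1 * x ^ 2) else 0
  else (gaussSum (quadChar F K) ψ)⁻¹ * quadChar F K (g 1 0) *
    ψ ((g 0 0 * x ^ 2 - 2 * x * y + g 1 1 * y ^ 2) / g 1 0)

theorem weilMatrix_one (ψ : AddChar F K) : weilMatrix ψ 1 = 1 := by
  ext x y
  simp [weilMatrix, Matrix.one_apply, eq_comm]

theorem det_eq {R : Type*} [CommRing R] (g : SpecialLinearGroup (Fin 2) R) :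
    g 0 0 * g 1 1 - g 0 1 * g 1 0 = 1 := by
  rw [← Matrix.det_fin_two]; exact g.det_coe

theorem weilMatrix_upper_mul (ψ : AddChar F K) {u : SpecialLinearGroup (Fin 2) F}
    (hu : u 1 0 = 0) (g : SpecialLinearGroup (Fin 2) F) :
    weilMatrix ψ (u * g) = weilMatrix ψ u * weilMatrix ψ g := by
  have hdu := det_eq u
  have hdg := det_eq g
  have hα : u 0 0 ≠ 0 := by rintro h; simp [h, hu] at hdu
  have hα' : u 1 1 = (u 0 0)⁻¹ := by
    rw [hu, mul_zero, sub_zero] at hdu; exact eq_inv_of_mul_eq_one_right hdu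
  ext x z
  have hsum : (weilMatrix ψ u * weilMatrix ψ g) x z =
      quadChar F K (u 0 0) * ψ (u 0 0 * u 0 1 * x ^ 2) * weilMatrix ψ g (u 0 0 * x) z := by
    rw [Matrix.mul_apply, Finset.sum_eq_single (u 0 0 * x)]
    · simp [weilMatrix, hu]
    · intro y _ hy
      simp [weilMatrix, hu, hy]
    · simp
  rw [hsum]
  have e10 : (u * g) 1 0 = (u 0 0)⁻¹ * g 1 0 := by
    simp [Matrix.mul_apply, Fin.sum_univ_two, hu, hα']
  have e11 : (u * g) 1 1 = (u 0 0)⁻¹ * g 1 1 := by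
    simp [Matrix.mul_apply, Fin.sum_univ_two, hu, hα']
  have e00 : (u * g) 0 0 = u 0 0 * g 0 0 + u 0 1 * g 1 0 := by
    simp [Matrix.mul_apply, Fin.sum_univ_two]
  have e01 : (u * g) 0 1 = u 0 0 * g 0 1 + u 0 1 * g 1 1 := by
    simp [Matrix.mul_apply, Fin.sum_univ_two]
  simp only [weilMatrix, e10, e11, e00, e01]
  by_cases hk : g 1 0 = 0
  · simp only [hk, mul_zero, add_zero, if_true, sub_zero] at hdg ⊢
    have hz : u 0 0 * g 0 0 * x = g 0 0 * (u 0 0 * x) := by ring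
    rw [hz]
    split_ifs
    · rw [map_mul, mul_mul_mul_comm, ← AddChar.map_add_eq_mul]
      congr 2
      linear_combination (u 0 0 * u 0 1 * x ^ 2) * hdg
    · rw [mul_zero]
  · rw [if_neg hk, if_neg (mul_ne_zero (inv_ne_zero hα) hk), map_mul, quadChar_inv]
    have hψ : (u 0 0 * g 0 0 + u 0 1 * g 1 0) * x ^ 2 - 2 * x * z + (u 0 0)⁻¹ * g 1 1 * z ^ 2 =
        (u 0 0)⁻¹ * g 1 0 * (u 0 0 * u 0 1 * x ^ 2 +
          (g 0 0 * (u 0 0 * x) ^ 2 - 2 * (u 0 0 * x) * z + g 1 1 * z ^ 2) / g 1 0) := by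
      field_simp
      ring
    rw [hψ, mul_div_cancel_left₀ _ (mul_ne_zero (inv_ne_zero hα) hk), AddChar.map_add_eq_mul]
    ring

theorem weilMatrix_weyl_mul [CharZero K] (hF : ringChar F ≠ 2) {ψ : AddChar F K}
    (hψ : ψ.IsPrimitive) {s : SpecialLinearGroup (Fin 2) F}
    (hs : (s : Matrix (Fin 2) (Fin 2) F) = !![0, -1; 1, 0])
    (g : SpecialLinearGroup (Fin 2) F) :
    weilMatrix ψ (s * g) = weilMatrix ψ s * weilMatrix ψ g := by
  have hdg := det_eq g
  have hγ := gaussSum_quadChar_ne_zero hF hψ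
  have hγ2 := gaussSum_quadChar_sq hF hψ
  have h2 : (2 : F) ≠ 0 := Ring.two_ne_zero hF
  ext x z
  have e10 : (s * g) 1 0 = g 0 0 := by simp [hs, Matrix.mul_apply, Fin.sum_univ_two]
  have e11 : (s * g) 1 1 = g 0 1 := by simp [hs, Matrix.mul_apply, Fin.sum_univ_two]
  have e00 : (s * g) 0 0 = -g 1 0 := by simp [hs, Matrix.mul_apply, Fin.sum_univ_two]
  have e01 : (s * g) 0 1 = -g 1 1 := by simp [hs, Matrix.mul_apply, Fin.sum_univ_two]
  have hS : ∀ y, weilMatrix ψ s x y = (gaussSum (quadChar F K) ψ)⁻¹ * ψ (-(2 * x * y)) := by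
    intro y; simp [weilMatrix, hs]
  simp only [Matrix.mul_apply, hS]
  simp only [weilMatrix, e10, e11, e00, e01]
  by_cases hk : g 1 0 = 0
  · have ha : g 0 0 ≠ 0 := by rintro h; simp [h, hk] at hdg
    simp only [if_pos hk, if_neg ha]
    rw [Finset.sum_eq_single ((g 0 0)⁻¹ * z)]
    · rw [mul_inv_cancel_left₀ ha, if_pos rfl, mul_mul_mul_comm, ← AddChar.map_add_eq_mul]
      congr 2
      rw [hk]
      field_simp
      ring
    · intro y _ hy
      rw [if_neg, mul_zero]
      rintro rfl
      exact hy (inv_mul_cancel_left₀ ha _).symm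
    · simp
  · by_cases ha : g 0 0 = 0
    · simp only [if_neg hk, if_pos ha]
      have hterm : ∀ y, (gaussSum (quadChar F K) ψ)⁻¹ * ψ (-(2 * x * y)) *
          ((gaussSum (quadChar F K) ψ)⁻¹ * quadChar F K (g 1 0) *
            ψ ((g 0 0 * y ^ 2 - 2 * y * z + g 1 1 * z ^ 2) / g 1 0)) =
          (gaussSum (quadChar F K) ψ ^ 2)⁻¹ * quadChar F K (g 1 0) *
            ψ (g 1 1 * z ^ 2 / g 1 0) * ψ (y * (-2 * (x + z / g 1 0))) := by
        intro y
        have : -(2 * x * y) + (g 0 0 * y ^ 2 - 2 * y * z + g 1 1 * z ^ 2) / g 1 0 =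
          g 1 1 * z ^ 2 / g 1 0 + y * (-2 * (x + z / g 1 0)) := by
          rw [ha]; field_simp; ring
        rw [mul_assoc _ (ψ _) (ψ _), ← AddChar.map_add_eq_mul, ← this, AddChar.map_add_eq_mul]
        field_simp
      simp only [hterm]
      rw [← Finset.mul_sum, AddChar.sum_mulShift _ hψ]
      have hiff : -2 * (x + z / g 1 0) = 0 ↔ z = -g 1 0 * x := by
        rw [mul_eq_zero, or_iff_right (neg_ne_zero.mpr h2)]
        constructor
        · intro h; field_simp at h; linear_combination h
        · rintro rfl; field_simp; ring
      simp only [hiff]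
      split_ifs with h
      · have hc : (Fintype.card F : K) ≠ 0 := Nat.cast_ne_zero.mpr Fintype.card_ne_zero
        have hq := quadChar_mul_self (K := K) (neg_ne_zero.mpr (one_ne_zero (α := F)))
        have hq0 := left_ne_zero_of_mul_eq_one hq
        have hz : g 1 1 * z ^ 2 / g 1 0 = -g 1 0 * -g 1 1 * x ^ 2 := by
          rw [h]; field_simp
        rw [hz, hγ2, neg_eq_neg_one_mul (g 1 0), map_mul]
        generalize ψ (-1 * g 1 0 * -g 1 1 * x ^ 2) = w
        field_simp
        linear_combination (quadChar F K (g 1 0) * w) * hq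
      · simp
    · simp only [if_neg hk, if_neg ha]
      have hterm : ∀ y, (gaussSum (quadChar F K) ψ)⁻¹ * ψ (-(2 * x * y)) *
          ((gaussSum (quadChar F K) ψ)⁻¹ * quadChar F K (g 1 0) *
            ψ ((g 0 0 * y ^ 2 - 2 * y * z + g 1 1 * z ^ 2) / g 1 0)) =
          (gaussSum (quadChar F K) ψ ^ 2)⁻¹ * quadChar F K (g 1 0) *
            ψ ((-g 1 0 * x ^ 2 - 2 * x * z + g 0 1 * z ^ 2) / g 0 0) *
            ψ (g 0 0 * (g 1 0)⁻¹ * (y - (g 1 0 * x + z) / g 0 0) ^ 2) := by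
        intro y
        have : -(2 * x * y) + (g 0 0 * y ^ 2 - 2 * y * z + g 1 1 * z ^ 2) / g 1 0 =
          (-g 1 0 * x ^ 2 - 2 * x * z + g 0 1 * z ^ 2) / g 0 0 +
            g 0 0 * (g 1 0)⁻¹ * (y - (g 1 0 * x + z) / g 0 0) ^ 2 := by
          field_simp
          linear_combination z ^ 2 * hdg
        rw [mul_assoc _ (ψ _) (ψ _), ← AddChar.map_add_eq_mul, ← this, AddChar.map_add_eq_mul]
        field_simp
      simp only [hterm]
      rw [← Finset.mul_sum,
        sum_addChar_quadratic hF hψ (mul_ne_zero ha (inv_ne_zero hk)), map_mul, quadChar_inv]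
      have hq := quadChar_mul_self (K := K) hk
      generalize ψ ((-g 1 0 * x ^ 2 - 2 * x * z + g 0 1 * z ^ 2) / g 0 0) = w
      field_simp
      linear_combination (-quadChar F K (g 0 0) * w) * hq

theorem exists_upper_weyl_upper {E : Type*} [Field E] {s g : SpecialLinearGroup (Fin 2) E}
    (hs : (s : Matrix (Fin 2) (Fin 2) E) = !![0, -1; 1, 0]) (hk : g 1 0 ≠ 0) :
    ∃ u v : SpecialLinearGroup (Fin 2) E, u 1 0 = 0 ∧ v 1 0 = 0 ∧ g = u * (s * v) := by
  have hdg := det_eq g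
  have hg : (g : Matrix (Fin 2) (Fin 2) E) = !![1, g 0 0 / g 1 0; 0, 1] *
      (!![0, -1; 1, 0] * !![g 1 0, g 1 1; 0, (g 1 0)⁻¹]) := by
    have h01 : g 0 1 = -(g 1 0)⁻¹ + g 0 0 / g 1 0 * g 1 1 := by
      field_simp
      linear_combination -hdg
    ext i j
    fin_cases i <;> fin_cases j <;> simp [hk, h01]
  rw [← hs] at hg
  exact ⟨⟨!![1, g 0 0 / g 1 0; 0, 1], by simp [Matrix.det_fin_two]⟩,
    ⟨!![g 1 0, g 1 1; 0, (g 1 0)⁻¹], by simp [Matrix.det_fin_two, hk]⟩, rfl, rfl,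
    Subtype.ext hg⟩

/-- The Weil representation of `SL(2, F)` attached to a primitive additive character. -/
noncomputable def weilHom [CharZero K] (hF : ringChar F ≠ 2) {ψ : AddChar F K}
    (hψ : ψ.IsPrimitive) : SpecialLinearGroup (Fin 2) F →* Matrix F F K where
  toFun := weilMatrix ψ
  map_one' := weilMatrix_one ψ
  map_mul' h g := by
    by_cases hk : h 1 0 = 0
    · exact weilMatrix_upper_mul ψ hk g
    · let s : SpecialLinearGroup (Fin 2) F := ⟨!![0, -1; 1, 0], by simp [Matrix.det_fin_two]⟩
      obtain ⟨u, v, hu, hv, rfl⟩ := exists_upper_weyl_upper (s := s) rfl hk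
      have hs := weilMatrix_weyl_mul hF hψ (s := s) rfl
      rw [mul_assoc, mul_assoc, weilMatrix_upper_mul ψ hu, hs, weilMatrix_upper_mul ψ hv,
        weilMatrix_upper_mul ψ hu, hs, mul_assoc, mul_assoc]

end WeilRep

/-- Existence of the Weil representation of `SL(2, 𝔽_p)` attached to
the quadratic form `Q(x) = c·x²/p`: there is a group homomorphism `ρ` from
`SL(2, ZMod p)` to the invertible `p×p` matrices over the `p`-th cyclotomic field
sending `s = [[0,-1],[1,0]]` to `𝒮` and `t = [[1,1],[0,1]]` to `𝒯`. -/
theorem weil_rep_exists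
    (p : ℕ+) [hp : Fact (p : ℕ).Prime] (hp2 : (p : ℕ) ≠ 2)
    (ε : ℤ) (hε : ε = (-1) ^ (((p : ℕ) - 1) / 2))
    (ζ : CyclotomicField p ℚ) (hζ : IsPrimitiveRoot ζ (p : ℕ))
    (c : ℤ) (hc : ¬ ((p : ℕ) : ℤ) ∣ c)
    (γ : CyclotomicField p ℚ)
    (hγ : γ = ∑ x : ZMod (p : ℕ), ζ ^ (c * ((x.val : ℤ)) ^ 2))
    (𝒮 𝒯 : Matrix (ZMod (p : ℕ)) (ZMod (p : ℕ)) (CyclotomicField p ℚ))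
    (hS : ∀ x y, 𝒮 x y = (ε : CyclotomicField p ℚ) * γ / ((p : ℕ) : CyclotomicField p ℚ) *
        ζ ^ (-(2 * c * (x.val : ℤ) * (y.val : ℤ))))
    (hT : 𝒯 = Matrix.diagonal fun x => ζ ^ (c * ((x.val : ℤ)) ^ 2))
    (s t : Matrix.SpecialLinearGroup (Fin 2) (ZMod (p : ℕ)))
    (hs : (s : Matrix (Fin 2) (Fin 2) (ZMod (p : ℕ))) = !![0, -1; 1, 0])
    (ht : (t : Matrix (Fin 2) (Fin 2) (ZMod (p : ℕ))) = !![1, 1; 0, 1]) :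
    ∃ ρ : Matrix.SpecialLinearGroup (Fin 2) (ZMod (p : ℕ)) →*
        (Matrix (ZMod (p : ℕ)) (ZMod (p : ℕ)) (CyclotomicField p ℚ))ˣ,
      ((ρ s : (Matrix (ZMod (p : ℕ)) (ZMod (p : ℕ)) (CyclotomicField p ℚ))ˣ) :
          Matrix (ZMod (p : ℕ)) (ZMod (p : ℕ)) (CyclotomicField p ℚ)) = 𝒮 ∧
      ((ρ t : (Matrix (ZMod (p : ℕ)) (ZMod (p : ℕ)) (CyclotomicField p ℚ))ˣ) :
          Matrix (ZMod (p : ℕ)) (ZMod (p : ℕ)) (CyclotomicField p ℚ)) = 𝒯 := by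
  have hcop : IsCoprime c ((p : ℕ) : ℤ) :=
    ((Nat.prime_iff_prime_int.mp hp.out).coprime_iff_not_dvd.mpr hc).symm
  have hζc : IsPrimitiveRoot (ζ ^ c) (p : ℕ) :=
    hζ.zpow_of_gcd_eq_one c (Int.isCoprime_iff_gcd_eq_one.mp hcop)
  have hF : ringChar (ZMod (p : ℕ)) ≠ 2 := by rwa [ZMod.ringChar_zmod_n]
  let ψ : AddChar (ZMod (p : ℕ)) (CyclotomicField p ℚ) := AddChar.zmodChar (p : ℕ) hζc.pow_eq_one
  have hψ : ψ.IsPrimitive := AddChar.zmodChar_primitive_of_primitive_root _ hζc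
  have hψn (n : ℕ) : ψ (n : ZMod (p : ℕ)) = ζ ^ (c * (n : ℤ)) := by
    rw [zpow_mul, zpow_natCast]
    exact AddChar.zmodChar_apply' hζc.pow_eq_one n
  have hψsq (x : ZMod (p : ℕ)) : ψ (x ^ 2) = ζ ^ (c * (x.val : ℤ) ^ 2) := by
    have := hψn (x.val ^ 2)
    rwa [Nat.cast_pow, Nat.cast_pow, ZMod.natCast_zmod_val] at this
  have hψmul (x y : ZMod (p : ℕ)) :
      ψ (-(2 * x * y)) = ζ ^ (-(2 * c * (x.val : ℤ) * (y.val : ℤ))) := by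
    have := hψn (2 * x.val * y.val)
    simp only [Nat.cast_mul, Nat.cast_ofNat, ZMod.natCast_zmod_val] at this
    rw [AddChar.map_neg_eq_inv, this, zpow_neg]
    ring_nf
  have hγ' : γ = gaussSum (WeilRep.quadChar (ZMod (p : ℕ)) (CyclotomicField p ℚ)) ψ := by
    have := WeilRep.sum_addChar_mul_sq hF hψ one_ne_zero
    simp only [one_mul, map_one, hψsq] at this
    rw [hγ, this]
  have hε' : WeilRep.quadChar (ZMod (p : ℕ)) (CyclotomicField p ℚ) (-1) = (ε : ℤ) := by
    have hodd := hp.out.eq_two_or_odd.resolve_left hp2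
    rw [WeilRep.quadChar_apply, quadraticChar_neg_one hF, ZMod.card,
      ZMod.χ₄_eq_neg_one_pow hodd, hε, show (p : ℕ) / 2 = ((p : ℕ) - 1) / 2 by omega]
  have hγ0 : γ ≠ 0 := hγ' ▸ WeilRep.gaussSum_quadChar_ne_zero hF hψ
  have hγinv : (ε : CyclotomicField p ℚ) * γ / ((p : ℕ) : CyclotomicField p ℚ) = γ⁻¹ := by
    have hsq := WeilRep.gaussSum_quadChar_sq hF hψ
    have hεsq := WeilRep.quadChar_mul_self (K := CyclotomicField p ℚ)
      (neg_ne_zero.mpr (one_ne_zero (α := ZMod (p : ℕ))))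
    rw [← hγ', hε', ZMod.card] at hsq
    rw [hε'] at hεsq
    have hp0 : ((p : ℕ) : CyclotomicField p ℚ) ≠ 0 := Nat.cast_ne_zero.mpr hp.out.ne_zero
    field_simp
    linear_combination (ε : CyclotomicField p ℚ) * hsq + (p : ℕ) * hεsq
  refine ⟨(WeilRep.weilHom hF hψ).toHomUnits, ?_, ?_⟩
  · ext x y
    rw [hS, hγinv, ← hψmul]
    simp [WeilRep.weilHom, WeilRep.weilMatrix, hs, hγ']
  · ext x y
    rw [hT, Matrix.diagonal_apply, ← hψsq]
    simp [WeilRep.weilHom, WeilRep.weilMatrix, ht, eq_comm]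
end

section
/- Let p be an odd prime, r = (p−1)/2, ε = (−1)^r, K = CyclotomicField p ℚ, ζ ∈ K a primitive p-th root of unity, c an integer with p ∤ c, and γ = Σ_{x ∈ ZMod p} ζ^{c·x²}. Let S and T be the (r+1)×(r+1) matrices over K with: T diagonal, T_{jj} = ζ^{c·j²}; S_{j,0} = ε·γ/p for all 0 ≤ j ≤ r, S_{0,k} = 2·ε·γ/p for 1 ≤ k ≤ r, and S_{j,k} = (ε·γ/p)·(ζ^{2cjk} + ζ^{−2cjk}) for 1 ≤ j, k ≤ r. Then S² = ε·1, S⁴ = 1, and (S·T)³ = S². -/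
open Finset in
theorem ZMod.sum_eq_sum_range {F : Type*} [AddCommMonoid F] (n : ℕ) [NeZero n]
    (g : ZMod n → F) : ∑ x, g x = ∑ i ∈ range n, g i := by
  symm
  refine Finset.sum_bij (fun i _ => (i : ZMod n)) (fun _ _ => mem_univ _) ?_ ?_
    (fun _ _ => rfl)
  · intro a ha b hb h
    rw [mem_range] at ha hb
    rwa [ZMod.natCast_eq_natCast_iff', Nat.mod_eq_of_lt ha, Nat.mod_eq_of_lt hb] at h
  · exact fun b _ => ⟨b.val, mem_range.2 b.val_lt, ZMod.natCast_zmod_val b⟩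

/-- The weight by which `k ∈ {0, …, r}` counts in half the sum of an even function over
`ZMod (2 * r + 1)`. -/
def halfWeight (F : Type*) [Field F] {r : ℕ} (k : Fin (r + 1)) : F := if k = 0 then 1 / 2 else 1

open Finset in
theorem ZMod.sum_eq_two_mul_sum_of_even {F : Type*} [Field F] [CharZero F] {p r : ℕ} [NeZero p]
    (hpr : p = 2 * r + 1) {g : ZMod p → F} (hg : ∀ x, g (-x) = g x) :
    ∑ x, g x = 2 * ∑ k : Fin (r + 1), halfWeight F k * g (k : ℕ) := by
  have reflect : ∑ i ∈ range r, g ((r + 1 + i : ℕ) : ZMod p)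
      = ∑ i ∈ range r, g ((i + 1 : ℕ) : ZMod p) := by
    rw [← sum_range_reflect]
    refine sum_congr rfl fun i hi => ?_
    rw [mem_range] at hi
    rw [← hg]
    congr 1
    have h : (((i + 1) + (r + 1 + (r - 1 - i)) : ℕ) : ZMod p) = 0 := by
      rw [ZMod.natCast_eq_zero_iff]
      exact ⟨1, by omega⟩
    rw [Nat.cast_add] at h
    exact (eq_neg_of_add_eq_zero_left h).symm
  rw [ZMod.sum_eq_sum_range, show range p = range ((r + 1) + r) by congr 1; omega,
    sum_range_add, reflect, sum_range_succ', Fin.sum_univ_succ, sum_range]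
  simp only [halfWeight, Fin.succ_ne_zero, if_true, if_false, Fin.val_succ, Fin.val_zero, one_mul]
  ring

theorem AddChar.sum_sq_sq {F : Type*} [Field F] [CharZero F] {p r : ℕ} [Fact p.Prime]
    (hpr : p = 2 * r + 1) {ψ : AddChar (ZMod p) F} (hψ : ψ.IsPrimitive) :
    (∑ x, ψ (x ^ 2)) ^ 2 = (-1) ^ r * p := by
  have hchar : ringChar (ZMod p) ≠ 2 := by
    rw [ZMod.ringChar_zmod_n]
    omega
  let χ : MulChar (ZMod p) F := (quadraticChar (ZMod p)).ringHomComp (Int.castRingHom F)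
  have hsum : ∑ x, ψ (x ^ 2) = gaussSum χ ψ := by
    rw [← Finset.sum_fiberwise' Finset.univ (fun x : ZMod p => x ^ 2) ψ]
    have hcard (t : ZMod p) : ∑ i with i ^ 2 = t, ψ t = χ t * ψ t + ψ t := by
      have h := congrArg (Int.cast : ℤ → F) (quadraticChar_card_sqrts hchar t)
      rw [Set.toFinset_ofPred] at h
      rw [Finset.sum_const, nsmul_eq_mul]
      push_cast at h
      rw [h, add_mul, one_mul]
      rfl
    rw [Finset.sum_congr rfl fun t _ => hcard t, Finset.sum_add_distrib,
      AddChar.sum_eq_zero_of_ne_one (by simpa using hψ one_ne_zero), add_zero, gaussSum]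
  have hχ : χ ≠ 1 := (MulChar.ringHomComp_ne_one_iff Int.cast_injective).2
    (quadraticChar_ne_one hchar)
  rw [hsum, gaussSum_sq hχ ((quadraticChar_isQuadratic _).comp _) hψ, ZMod.card]
  congr 1
  have h : χ (-1) = ((quadraticChar (ZMod p) (-1) : ℤ) : F) := rfl
  rw [h, quadraticChar_neg_one hchar, ZMod.card, ZMod.χ₄_eq_neg_one_pow (by omega),
    show p / 2 = r by omega]
  simp

/-- The even kernel `ψ(2t) + ψ(-2t)` attached to an additive character `ψ`. -/
def AddChar.evenKernel {R F : Type*} [CommRing R] [Field F] (ψ : AddChar R F) (t : R) : F :=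
  ψ (2 * t) + ψ (-(2 * t))

namespace AddChar

variable {R F : Type*} [CommRing R] [Field F] (ψ : AddChar R F)

theorem evenKernel_neg (t : R) : ψ.evenKernel (-t) = ψ.evenKernel t := by
  simp only [evenKernel, mul_neg, neg_neg, add_comm]

theorem evenKernel_mul_evenKernel (s t : R) :
    ψ.evenKernel s * ψ.evenKernel t = ψ.evenKernel (s + t) + ψ.evenKernel (s - t) := by
  have h1 : 2 * (s + t) = 2 * s + 2 * t := by ring
  have h2 : -(2 * (s + t)) = -(2 * s) + -(2 * t) := by ring
  have h3 : 2 * (s - t) = 2 * s + -(2 * t) := by ring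
  have h4 : -(2 * (s - t)) = -(2 * s) + 2 * t := by ring
  rw [evenKernel, evenKernel, evenKernel, evenKernel, h2, h4, h1, h3]
  simp only [map_add_eq_mul]
  ring

theorem sum_evenKernel_mul_sq [Fintype R] (t : R) :
    ∑ x, ψ.evenKernel (t * x) * ψ (x ^ 2) = 2 * (∑ x, ψ (x ^ 2)) * ψ (-t ^ 2) := by
  have h1 : ∑ x, ψ (2 * (t * x)) * ψ (x ^ 2) = (∑ x, ψ (x ^ 2)) * ψ (-t ^ 2) := by
    rw [← Equiv.sum_comp (Equiv.addRight t) fun x => ψ (x ^ 2), Finset.sum_mul]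
    refine Finset.sum_congr rfl fun x _ => ?_
    rw [← map_add_eq_mul, ← map_add_eq_mul, Equiv.coe_addRight]
    congr 1
    ring
  have h2 : ∑ x, ψ (-(2 * (t * x))) * ψ (x ^ 2) = (∑ x, ψ (x ^ 2)) * ψ (-t ^ 2) := by
    rw [← h1, ← Equiv.sum_comp (Equiv.neg R)]
    refine Finset.sum_congr rfl fun x _ => ?_
    simp
  simp only [evenKernel, add_mul, Finset.sum_add_distrib, h1, h2]
  ring

theorem sum_evenKernel [Fintype R] [DecidableEq R] (h2 : IsUnit (2 : R)) (hψ : ψ.IsPrimitive)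
    (t : R) :
    ∑ x, ψ.evenKernel (t * x) = if t = 0 then 2 * (Fintype.card R : F) else 0 := by
  have h (b : R) : 2 * (t * b) = b * (2 * t) := by ring
  simp only [evenKernel, Finset.sum_add_distrib, h, ← mul_neg, sum_mulShift _ hψ, neg_eq_zero,
    h2.mul_right_eq_zero]
  split_ifs
  · ring
  · simp

end AddChar

section EvenWeilMatrices

variable {F : Type*} [Field F] {p r : ℕ}

/-- The matrix `S` of the even part of the Weil representation, scaled by `a`. -/
def evenWeilS (ψ : AddChar (ZMod p) F) (r : ℕ) (a : F) : Matrix (Fin (r + 1)) (Fin (r + 1)) F :=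
  fun j k => a * halfWeight F k * ψ.evenKernel ((j : ℕ) * (k : ℕ))

/-- The matrix `T` of the even part of the Weil representation. -/
def evenWeilT (ψ : AddChar (ZMod p) F) (r : ℕ) : Matrix (Fin (r + 1)) (Fin (r + 1)) F :=
  Matrix.diagonal fun j => ψ ((j : ℕ) ^ 2)

variable [CharZero F] [Fact p.Prime] {ψ : AddChar (ZMod p) F}

theorem evenWeilS_sq (hpr : p = 2 * r + 1) (hψ : ψ.IsPrimitive) (a : F) :
    evenWeilS ψ r a ^ 2 = (a ^ 2 * p) • (1 : Matrix (Fin (r + 1)) (Fin (r + 1)) F) := by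
  have h2 : IsUnit (2 : ZMod p) := by
    refine (ZMod.isUnit_iff_coprime 2 p).2 ?_
    rw [hpr]
    simp
  ext j l
  have hsum := ZMod.sum_eq_two_mul_sum_of_even hpr
    (g := fun x => ψ.evenKernel ((j : ℕ) * x) * ψ.evenKernel ((l : ℕ) * x))
    (fun x => by simp only [mul_neg, AddChar.evenKernel_neg])
  simp only [AddChar.evenKernel_mul_evenKernel, ← add_mul, ← sub_mul, Finset.sum_add_distrib,
    AddChar.sum_evenKernel ψ h2 hψ, ZMod.card] at hsum
  have hentry : (evenWeilS ψ r a ^ 2) j l = a ^ 2 * halfWeight F l *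
      ∑ k : Fin (r + 1), halfWeight F k *
        (ψ.evenKernel (((j : ℕ) + (l : ℕ)) * (k : ℕ)) +
          ψ.evenKernel (((j : ℕ) - (l : ℕ)) * (k : ℕ))) := by
    rw [sq, Matrix.mul_apply, Finset.mul_sum]
    refine Finset.sum_congr rfl fun k _ => ?_
    rw [add_mul, sub_mul, ← AddChar.evenKernel_mul_evenKernel, mul_comm ((l : ℕ) : ZMod p)]
    simp only [evenWeilS]
    ring
  have hadd : ((j : ℕ) : ZMod p) + (l : ℕ) = 0 ↔ j = 0 ∧ l = 0 := by
    rw [← Nat.cast_add, ZMod.natCast_eq_zero_iff]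
    constructor
    · intro h
      have := Nat.eq_zero_of_dvd_of_lt h (by omega)
      simp only [Fin.ext_iff, Fin.val_zero]
      omega
    · rintro ⟨rfl, rfl⟩
      simp
  have hsub : ((j : ℕ) : ZMod p) - (l : ℕ) = 0 ↔ j = l := by
    rw [sub_eq_zero, ZMod.natCast_eq_natCast_iff', Nat.mod_eq_of_lt (by omega),
      Nat.mod_eq_of_lt (by omega), Fin.ext_iff]
  simp only [hadd, hsub] at hsum
  rw [hentry, Matrix.smul_apply, Matrix.one_apply, smul_eq_mul]
  rw [← mul_right_inj' (two_ne_zero' F), mul_left_comm, ← hsum, halfWeight]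
  by_cases hjl : j = l
  · subst hjl
    by_cases hj : j = 0
    · simp only [hj, and_self, if_true]
      ring
    · simp only [hj, and_self, if_true, if_false]
      ring
  · have : ¬ (j = 0 ∧ l = 0) := fun h => hjl (h.1.trans h.2.symm)
    simp [hjl, this]

theorem evenWeilS_mul_T_mul_S (hpr : p = 2 * r + 1) (a : F) :
    evenWeilT ψ r * (evenWeilS ψ r a * evenWeilT ψ r * evenWeilS ψ r a) * evenWeilT ψ r =
      evenWeilS ψ r (a ^ 2 * ∑ x, ψ (x ^ 2)) := by
  ext j l
  have hsum := ZMod.sum_eq_two_mul_sum_of_even hpr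
    (g := fun x => ψ.evenKernel ((j : ℕ) * x) * ψ.evenKernel ((l : ℕ) * x) * ψ (x ^ 2))
    (fun x => by simp only [mul_neg, AddChar.evenKernel_neg, neg_sq])
  simp only [AddChar.evenKernel_mul_evenKernel, ← add_mul, ← sub_mul] at hsum
  simp only [add_mul (AddChar.evenKernel _ _), Finset.sum_add_distrib,
    AddChar.sum_evenKernel_mul_sq] at hsum
  have hentry : (evenWeilS ψ r a * evenWeilT ψ r * evenWeilS ψ r a) j l =
      a ^ 2 * halfWeight F l * ∑ k : Fin (r + 1), halfWeight F k *
        (ψ.evenKernel (((j : ℕ) + (l : ℕ)) * (k : ℕ)) * ψ ((k : ℕ) ^ 2) +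
          ψ.evenKernel (((j : ℕ) - (l : ℕ)) * (k : ℕ)) * ψ ((k : ℕ) ^ 2)) := by
    rw [Matrix.mul_apply, Finset.mul_sum]
    refine Finset.sum_congr rfl fun k _ => ?_
    rw [← add_mul (AddChar.evenKernel _ _), add_mul ((j : ℕ) : ZMod p), sub_mul,
      ← AddChar.evenKernel_mul_evenKernel, mul_comm ((l : ℕ) : ZMod p), evenWeilT,
      Matrix.mul_diagonal]
    simp only [evenWeilS]
    ring
  have hfin (s t : ZMod p) : ψ (s ^ 2) * (ψ (-(s + t) ^ 2) + ψ (-(s - t) ^ 2)) * ψ (t ^ 2) =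
      ψ.evenKernel (s * t) := by
    have h1 : -(2 * (s * t)) = s ^ 2 + -(s + t) ^ 2 + t ^ 2 := by ring
    have h2 : 2 * (s * t) = s ^ 2 + -(s - t) ^ 2 + t ^ 2 := by ring
    rw [AddChar.evenKernel, h1, h2]
    simp only [AddChar.map_add_eq_mul]
    ring
  have hhalf := mul_left_cancel₀ (two_ne_zero' F) (hsum.symm.trans
    (show _ = 2 * ((∑ x, ψ (x ^ 2)) * (ψ (-((j : ℕ) + (l : ℕ)) ^ 2) +
      ψ (-((j : ℕ) - (l : ℕ)) ^ 2))) by ring))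
  rw [evenWeilT, Matrix.mul_diagonal, Matrix.diagonal_mul, ← evenWeilT, hentry, hhalf, evenWeilS,
    ← hfin]
  ring

/-- The relations `S² = ε`, `S⁴ = 1`, `(ST)³ = S²` for the even part of the Weil
representation attached to a primitive additive character of `ZMod p`. -/
theorem evenWeil_relations (hpr : p = 2 * r + 1) (hψ : ψ.IsPrimitive) {a : F}
    (ha : a = (-1) ^ r * (∑ x, ψ (x ^ 2)) / p) :
    evenWeilS ψ r a ^ 2 = ((-1) ^ r : F) • (1 : Matrix (Fin (r + 1)) (Fin (r + 1)) F) ∧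
      evenWeilS ψ r a ^ 4 = 1 ∧
      (evenWeilS ψ r a * evenWeilT ψ r) ^ 3 = evenWeilS ψ r a ^ 2 := by
  have hp0 : (p : F) ≠ 0 := Nat.cast_ne_zero.2 (NeZero.ne p)
  have hγ := AddChar.sum_sq_sq hpr hψ
  have hε : ((-1) ^ r : F) * (-1) ^ r = 1 := by
    rw [← mul_pow]
    simp
  have haγ : a * ∑ x, ψ (x ^ 2) = 1 := by
    rw [ha, div_mul_eq_mul_div, mul_assoc, ← sq, hγ, ← mul_assoc, hε, one_mul, div_self hp0]
  have hap : a ^ 2 * p = (-1) ^ r := by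
    calc a ^ 2 * p = a * (a * p) := by ring
      _ = a * ((-1) ^ r * ∑ x, ψ (x ^ 2)) := by rw [ha, div_mul_cancel₀ _ hp0]
      _ = (-1) ^ r * (a * ∑ x, ψ (x ^ 2)) := by ring
      _ = (-1) ^ r := by rw [haγ, mul_one]
  have hsq := evenWeilS_sq hpr hψ a
  rw [hap] at hsq
  refine ⟨hsq, ?_, ?_⟩
  · rw [show 4 = 2 * 2 from rfl, pow_mul, hsq, sq, smul_mul_smul_comm, hε, one_smul, one_mul]
  · have h := evenWeilS_mul_T_mul_S (ψ := ψ) hpr a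
    rw [sq a, mul_assoc a, haγ, mul_one] at h
    rw [sq (evenWeilS ψ r a)]
    conv_rhs =>
      arg 2
      rw [← h]
    simp only [pow_succ, pow_zero, one_mul, mul_assoc]

end EvenWeilMatrices

theorem AddChar.zmodChar_intCast {F : Type*} [Field F] {n : ℕ} [NeZero n] {ζ : F}
    (hζ : ζ ^ n = 1) (m : ℤ) : AddChar.zmodChar n hζ (m : ZMod n) = ζ ^ m := by
  have h1 : AddChar.zmodChar n hζ 1 = ζ := by
    simpa using AddChar.zmodChar_apply' hζ 1
  rw [← zsmul_one, AddChar.map_zsmul_eq_zpow, h1]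


/-- Relations for the even (principal-series) part of the Weil
representation: with `T = diag(ζ^{c·j²})` and `S` as in \eqref{eqn:xi-S-matrix},
one has `S² = ε·1`, `S⁴ = 1` and `(S·T)³ = S²`. -/
theorem principal_series_matrix_relations
    (p : ℕ+) [hp : Fact (p : ℕ).Prime] (hp2 : (p : ℕ) ≠ 2)
    (r : ℕ) (hr : r = ((p : ℕ) - 1) / 2)
    (ε : ℤ) (hε : ε = (-1) ^ r)
    (ζ : CyclotomicField p ℚ) (hζ : IsPrimitiveRoot ζ (p : ℕ))
    (c : ℤ) (hc : ¬ ((p : ℕ) : ℤ) ∣ c)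
    (γ : CyclotomicField p ℚ)
    (hγ : γ = ∑ x : ZMod (p : ℕ), ζ ^ (c * ((x.val : ℤ)) ^ 2))
    (S T : Matrix (Fin (r + 1)) (Fin (r + 1)) (CyclotomicField p ℚ))
    (hT : T = Matrix.diagonal fun j : Fin (r + 1) => ζ ^ (c * ((j : ℕ) : ℤ) ^ 2))
    (hS0 : ∀ j, S j 0 = (ε : CyclotomicField p ℚ) * γ / ((p : ℕ) : CyclotomicField p ℚ))
    (hS1 : ∀ k, k ≠ 0 →
      S 0 k = 2 * ((ε : CyclotomicField p ℚ) * γ / ((p : ℕ) : CyclotomicField p ℚ)))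
    (hS2 : ∀ j k, j ≠ 0 → k ≠ 0 →
      S j k = (ε : CyclotomicField p ℚ) * γ / ((p : ℕ) : CyclotomicField p ℚ) *
        (ζ ^ (2 * c * ((j : ℕ) : ℤ) * ((k : ℕ) : ℤ)) +
          ζ ^ (-(2 * c * ((j : ℕ) : ℤ) * ((k : ℕ) : ℤ))))) :
    S ^ 2 = (ε : CyclotomicField p ℚ) • (1 : Matrix (Fin (r + 1)) (Fin (r + 1))
        (CyclotomicField p ℚ)) ∧
      S ^ 4 = 1 ∧ (S * T) ^ 3 = S ^ 2 := by
  have hpr : (p : ℕ) = 2 * r + 1 := by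
    have := hp.out.eq_two_or_odd
    omega
  let ψ₀ : AddChar (ZMod (p : ℕ)) (CyclotomicField p ℚ) := AddChar.zmodChar (p : ℕ) hζ.pow_eq_one
  let ψ := ψ₀.mulShift (c : ZMod (p : ℕ))
  have hc0 : (c : ZMod (p : ℕ)) ≠ 0 := by
    rwa [Ne, ZMod.intCast_zmod_eq_zero_iff_dvd]
  have hψ : ψ.IsPrimitive := AddChar.IsPrimitive.of_ne_one
    (AddChar.zmodChar_primitive_of_primitive_root (p : ℕ) hζ hc0)
  have hψ_int (m : ℤ) : ψ (m : ZMod (p : ℕ)) = ζ ^ (c * m) := by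
    rw [AddChar.mulShift_apply, ← Int.cast_mul, AddChar.zmodChar_intCast]
  have hγ' : γ = ∑ x, ψ (x ^ 2) := by
    rw [hγ]
    refine Finset.sum_congr rfl fun x _ => ?_
    rw [← hψ_int]
    simp
  have hε' : (ε : CyclotomicField p ℚ) = (-1) ^ r := by
    rw [hε]
    simp
  have hTeq : T = evenWeilT ψ r := by
    rw [hT, evenWeilT]
    congr 1
    funext j
    rw [← hψ_int]
    simp
  have hker (j k : ℕ) : ψ.evenKernel ((j : ZMod (p : ℕ)) * k) =
      ζ ^ (2 * c * (j : ℤ) * (k : ℤ)) + ζ ^ (-(2 * c * (j : ℤ) * (k : ℤ))) := by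
    rw [AddChar.evenKernel,
      show 2 * c * (j : ℤ) * (k : ℤ) = c * (2 * (j * k)) by ring, ← mul_neg c, ← hψ_int, ← hψ_int]
    simp
  have hSeq : S = evenWeilS ψ r
      ((ε : CyclotomicField p ℚ) * γ / ((p : ℕ) : CyclotomicField p ℚ)) := by
    ext j k
    rw [evenWeilS, hker, halfWeight]
    by_cases hk : k = 0
    · subst hk
      rw [hS0]
      simp
      ring
    · by_cases hj : j = 0
      · subst hj
        rw [hS1 k hk]
        simp [hk]
        ring
      · rw [hS2 j k hj hk, if_neg hk, mul_one]
  rw [hSeq, hTeq, hε', hγ']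
  exact evenWeil_relations hpr hψ rfl
end

section
/- Let p be an odd prime, r = (p−1)/2, ε = (−1)^r, K = CyclotomicField p ℚ, ζ ∈ K a primitive p-th root of unity, c an integer with p ∤ c, and γ = Σ_{x ∈ ZMod p} ζ^{c·x²}. Let S and T be the (r+1)×(r+1) matrices over K with: T diagonal, T_{jj} = ζ^{c·j²}; S_{j,0} = ε·γ/p for all 0 ≤ j ≤ r, S_{0,k} = 2·ε·γ/p for 1 ≤ k ≤ r, and S_{j,k} = (ε·γ/p)·(ζ^{2cjk} + ζ^{−2cjk}) for 1 ≤ j, k ≤ r. Then there exists a group homomorphism ξ from SL(2, ZMod p) to the group of invertible (r+1)×(r+1) matrices over K such that ξ(s) = S and ξ(t) = T, where s = [[0,−1],[1,0]] and t = [[1,1],[0,1]]. (This is the principal series Weil character of dimension (p+1)/2 attached to Q(x) = c·x²/p.) -/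
/-- The Weil operator attached to a `2 × 2` matrix `g` over `F`, acting on functions `F → K`:
a monomial operator when `g` is upper triangular and an integral operator with Gaussian kernel
otherwise. -/
noncomputable def weilOperator {F K : Type*} [Field F] [Fintype F] [DecidableEq F] [Field K]
    (χ : MulChar F K) (φ : AddChar F K) (κ : K) (g : Matrix (Fin 2) (Fin 2) F) :
    Module.End K (F → K) where
  toFun f x :=
    if g 1 0 = 0 then χ (g 0 0) * φ (g 0 0 * g 0 1 * x ^ 2) * f (g 0 0 * x)
    else κ * χ (g 1 0) *
      ∑ y, φ ((g 0 0 * x ^ 2 - 2 * x * y + g 1 1 * y ^ 2) / g 1 0) * f y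
  map_add' f₁ f₂ := by
    ext x
    by_cases h : g 1 0 = 0 <;> simp [h, mul_add, Finset.sum_add_distrib]
  map_smul' a f := by
    ext x
    by_cases h : g 1 0 = 0
    · simp [h, mul_left_comm]
    · simp only [h, if_false, Pi.smul_apply, smul_eq_mul, RingHom.id_apply, Finset.mul_sum]
      exact Finset.sum_congr rfl fun y _ => by ring

lemma MulChar.IsQuadratic.mul_self_apply {F K : Type*} [Field F] [Field K] {χ : MulChar F K}
    (hχ : χ.IsQuadratic) {a : F} (ha : a ≠ 0) :
    χ a * χ a = 1 := by
  have := (ha.isUnit.map χ).ne_zero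
  rcases hχ a with h | h | h <;> simp_all

section Weil

variable {F K : Type*} [Field F] [Fintype F] [DecidableEq F] [Field K]
  {χ : MulChar F K} {φ : AddChar F K} {κ γ : K}

lemma weilOperator_apply_of_eq_zero {g : Matrix (Fin 2) (Fin 2) F} (h : g 1 0 = 0)
    (f : F → K) (x : F) :
    weilOperator χ φ κ g f x = χ (g 0 0) * φ (g 0 0 * g 0 1 * x ^ 2) * f (g 0 0 * x) := by
  simp [weilOperator, h]

lemma weilOperator_apply_of_ne_zero {g : Matrix (Fin 2) (Fin 2) F} (h : g 1 0 ≠ 0)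
    (f : F → K) (x : F) :
    weilOperator χ φ κ g f x = κ * χ (g 1 0) *
      ∑ y, φ ((g 0 0 * x ^ 2 - 2 * x * y + g 1 1 * y ^ 2) / g 1 0) * f y := by
  simp [weilOperator, h]

lemma weilOperator_one : weilOperator χ φ κ 1 = 1 := by
  refine LinearMap.ext fun f => funext fun x => ?_
  simp [weilOperator_apply_of_eq_zero]

/-- Weil operators preserve parity. -/
lemma weilOperator_apply_neg (g : Matrix (Fin 2) (Fin 2) F) {f : F → K}
    (hf : ∀ x, f (-x) = f x) (x : F) :
    weilOperator χ φ κ g f (-x) = weilOperator χ φ κ g f x := by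
  by_cases h : g 1 0 = 0
  · simp [weilOperator_apply_of_eq_zero h, hf]
  · simp only [weilOperator_apply_of_ne_zero h]
    congr 1
    refine Fintype.sum_equiv (Equiv.neg F) _ _ fun y => ?_
    simp [hf]

lemma weilOperator_mul_of_upper (hχ : χ.IsQuadratic) {h g : Matrix (Fin 2) (Fin 2) F}
    (hh : h.det = 1) (hg : g.det = 1) (h0 : h 1 0 = 0) :
    weilOperator χ φ κ (h * g) = weilOperator χ φ κ h * weilOperator χ φ κ g := by
  rw [Matrix.det_fin_two] at hh hg
  simp only [h0, mul_zero, sub_zero] at hh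
  have ha : h 0 0 ≠ 0 := left_ne_zero_of_mul_eq_one hh
  have hd : h 1 1 ≠ 0 := right_ne_zero_of_mul_eq_one hh
  have hd' : h 1 1 = (h 0 0)⁻¹ := eq_inv_of_mul_eq_one_right hh
  have hχd : χ (h 1 1) = χ (h 0 0) := by
    have h1 : χ (h 0 0) * χ (h 1 1) = 1 := by rw [← map_mul, hh, map_one]
    have h2 := hχ.mul_self_apply ha
    exact mul_left_cancel₀ (ha.isUnit.map χ).ne_zero (h1.trans h2.symm)
  have e00 : (h * g) 0 0 = h 0 0 * g 0 0 + h 0 1 * g 1 0 := by simp [Matrix.mul_apply]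
  have e01 : (h * g) 0 1 = h 0 0 * g 0 1 + h 0 1 * g 1 1 := by simp [Matrix.mul_apply]
  have e10 : (h * g) 1 0 = h 1 1 * g 1 0 := by simp [Matrix.mul_apply, h0]
  have e11 : (h * g) 1 1 = h 1 1 * g 1 1 := by simp [Matrix.mul_apply, h0]
  refine LinearMap.ext fun f => funext fun x => ?_
  rw [Module.End.mul_apply, weilOperator_apply_of_eq_zero h0]
  by_cases hc : g 1 0 = 0
  · rw [weilOperator_apply_of_eq_zero hc, weilOperator_apply_of_eq_zero (by rw [e10, hc, mul_zero]),
      e00, e01, hc, mul_zero, add_zero, map_mul]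
    simp only [hc, mul_zero, sub_zero] at hg
    have : φ (h 0 0 * g 0 0 * (h 0 0 * g 0 1 + h 0 1 * g 1 1) * x ^ 2) =
        φ (h 0 0 * h 0 1 * x ^ 2) * φ (g 0 0 * g 0 1 * (h 0 0 * x) ^ 2) := by
      rw [← AddChar.map_add_eq_mul]
      congr 1
      linear_combination (h 0 0 * h 0 1 * x ^ 2) * hg
    rw [this, show h 0 0 * g 0 0 * x = g 0 0 * (h 0 0 * x) by ring]
    ring
  · rw [weilOperator_apply_of_ne_zero hc,
      weilOperator_apply_of_ne_zero (by rw [e10]; exact mul_ne_zero hd hc), e00, e10, e11,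
      map_mul, hχd]
    simp only [Finset.mul_sum]
    refine Finset.sum_congr rfl fun y _ => ?_
    have : φ (((h 0 0 * g 0 0 + h 0 1 * g 1 0) * x ^ 2 - 2 * x * y + h 1 1 * g 1 1 * y ^ 2) /
        (h 1 1 * g 1 0)) = φ (h 0 0 * h 0 1 * x ^ 2) *
          φ ((g 0 0 * (h 0 0 * x) ^ 2 - 2 * (h 0 0 * x) * y + g 1 1 * y ^ 2) / g 1 0) := by
      rw [← AddChar.map_add_eq_mul, hd']
      congr 1
      field_simp
      ring
    rw [this]
    ring

lemma weilOperator_mul_of_inversion (hF : (2 : F) ≠ 0) (hφ : φ.IsPrimitive)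
    (hγ : ∀ a ≠ 0, ∑ x, φ (a * x ^ 2) = χ a * γ) (hκ : κ ^ 2 * Fintype.card F = χ (-1))
    (hκγ : κ * γ = 1) {g : Matrix (Fin 2) (Fin 2) F} (hg : g.det = 1) :
    weilOperator χ φ κ (!![0, -1; 1, 0] * g) =
      weilOperator χ φ κ !![0, -1; 1, 0] * weilOperator χ φ κ g := by
  rw [Matrix.det_fin_two] at hg
  have e00 : ((!![0, -1; 1, 0] : Matrix (Fin 2) (Fin 2) F) * g) 0 0 = -g 1 0 := by simp [Matrix.mul_apply]
  have e01 : ((!![0, -1; 1, 0] : Matrix (Fin 2) (Fin 2) F) * g) 0 1 = -g 1 1 := by simp [Matrix.mul_apply]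
  have e10 : ((!![0, -1; 1, 0] : Matrix (Fin 2) (Fin 2) F) * g) 1 0 = g 0 0 := by simp [Matrix.mul_apply]
  have e11 : ((!![0, -1; 1, 0] : Matrix (Fin 2) (Fin 2) F) * g) 1 1 = g 0 1 := by simp [Matrix.mul_apply]
  refine LinearMap.ext fun f => funext fun x => ?_
  rw [Module.End.mul_apply, weilOperator_apply_of_ne_zero (g := !![0, -1; 1, 0]) (by simp)]
  have s00 : (!![0, -1; 1, 0] : Matrix (Fin 2) (Fin 2) F) 0 0 = 0 := rfl
  have s10 : (!![0, -1; 1, 0] : Matrix (Fin 2) (Fin 2) F) 1 0 = 1 := rfl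
  have s11 : (!![0, -1; 1, 0] : Matrix (Fin 2) (Fin 2) F) 1 1 = 0 := rfl
  simp only [s00, s10, s11, zero_mul, zero_sub, add_zero, div_one, map_one, mul_one]
  by_cases he : g 1 0 = 0
  · simp only [he, mul_zero, sub_zero] at hg
    have ha : g 0 0 ≠ 0 := left_ne_zero_of_mul_eq_one hg
    rw [weilOperator_apply_of_ne_zero (by rwa [e10]), e00, e10, e11, he, mul_assoc,
      Finset.mul_sum]
    congr 1
    symm
    refine Fintype.sum_equiv (Equiv.mulLeft₀ _ ha) _ _ fun y => ?_
    rw [weilOperator_apply_of_eq_zero he, Equiv.mulLeft₀_apply]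
    have : φ ((-0 * x ^ 2 - 2 * x * (g 0 0 * y) + g 0 1 * (g 0 0 * y) ^ 2) / g 0 0) =
        φ (-(2 * x * y)) * φ (g 0 0 * g 0 1 * y ^ 2) := by
      rw [← AddChar.map_add_eq_mul]
      congr 1
      field_simp
      ring
    rw [this]
    ring
  simp only [weilOperator_apply_of_ne_zero he, Finset.mul_sum]
  rw [Finset.sum_comm]
  by_cases ha : g 0 0 = 0
  · rw [weilOperator_apply_of_eq_zero (by rwa [e10]), e00, e01]
    have inner (z : F) : ∑ y, φ (-(2 * x * y)) * φ (-(2 * y * z) / g 1 0) =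
        if z = -g 1 0 * x then (Fintype.card F : K) else 0 := by
      have h1 := AddChar.sum_mulShift (-(2 * (x + z / g 1 0))) hφ
      have h2 : -(2 * (x + z / g 1 0)) = 0 ↔ z = -g 1 0 * x := by
        rw [neg_eq_zero, mul_eq_zero, or_iff_right hF]
        constructor <;> intro h
        · field_simp at h
          linear_combination h
        · subst h
          field_simp
          ring
      simp only [h2] at h1
      rw [show (if z = -g 1 0 * x then (Fintype.card F : K) else 0) =
        ((if z = -g 1 0 * x then Fintype.card F else 0 : ℕ) : K) by split_ifs <;> simp, ← h1]
      refine Finset.sum_congr rfl fun y _ => ?_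
      rw [← AddChar.map_add_eq_mul]
      congr 1
      field_simp
      ring
    have key (z : F) : ∑ y, κ * (φ (-(2 * x * y)) * (κ * χ (g 1 0) *
        (φ ((g 0 0 * y ^ 2 - 2 * y * z + g 1 1 * z ^ 2) / g 1 0) * f z))) =
        if z = -g 1 0 * x then κ ^ 2 * Fintype.card F * χ (g 1 0) *
          φ (g 1 1 * z ^ 2 / g 1 0) * f z else 0 := by
      calc _ = κ ^ 2 * χ (g 1 0) * φ (g 1 1 * z ^ 2 / g 1 0) * f z *
            ∑ y, φ (-(2 * x * y)) * φ (-(2 * y * z) / g 1 0) := by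
            rw [Finset.mul_sum]
            refine Finset.sum_congr rfl fun y _ => ?_
            rw [show (g 0 0 * y ^ 2 - 2 * y * z + g 1 1 * z ^ 2) / g 1 0 =
              -(2 * y * z) / g 1 0 + g 1 1 * z ^ 2 / g 1 0 by rw [ha]; ring,
              AddChar.map_add_eq_mul]
            ring
        _ = _ := by
            rw [inner]
            split_ifs <;> ring
    simp only [mul_assoc] at key ⊢
    simp only [key, Finset.sum_ite_eq', Finset.mem_univ, if_true]
    rw [← mul_assoc (κ ^ 2), hκ, ← mul_assoc (χ (-1)), ← map_mul, neg_one_mul]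
    congr 2
    congr 1
    field_simp
  · rw [weilOperator_apply_of_ne_zero (by rwa [e10]), e00, e10, e11, Finset.mul_sum]
    refine Finset.sum_congr rfl fun z _ => ?_
    have hχ' : χ (g 1 0) * χ (g 0 0 / g 1 0) = χ (g 0 0) := by
      rw [← map_mul, mul_div_cancel₀ _ he]
    have shift : ∑ y, φ (g 0 0 / g 1 0 * (y - (g 1 0 * x + z) / g 0 0) ^ 2) =
        χ (g 0 0 / g 1 0) * γ := by
      rw [← hγ _ (div_ne_zero ha he)]
      exact Fintype.sum_equiv (Equiv.subRight ((g 1 0 * x + z) / g 0 0)) _ _ fun y => rfl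
    calc _ = κ * (κ * γ) * (χ (g 1 0) * χ (g 0 0 / g 1 0)) *
          (φ ((-g 1 0 * x ^ 2 - 2 * x * z + g 0 1 * z ^ 2) / g 0 0) * f z) := by
          rw [hκγ, hχ']
          ring
      _ = κ * κ * χ (g 1 0) * φ ((-g 1 0 * x ^ 2 - 2 * x * z + g 0 1 * z ^ 2) / g 0 0) * f z *
          ∑ y, φ (g 0 0 / g 1 0 * (y - (g 1 0 * x + z) / g 0 0) ^ 2) := by
          rw [shift]
          ring
      _ = _ := by
          rw [Finset.mul_sum]
          refine Finset.sum_congr rfl fun y _ => ?_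
          have : φ (-(2 * x * y)) * φ ((g 0 0 * y ^ 2 - 2 * y * z + g 1 1 * z ^ 2) / g 1 0) =
              φ ((-g 1 0 * x ^ 2 - 2 * x * z + g 0 1 * z ^ 2) / g 0 0) *
                φ (g 0 0 / g 1 0 * (y - (g 1 0 * x + z) / g 0 0) ^ 2) := by
            rw [← AddChar.map_add_eq_mul, ← AddChar.map_add_eq_mul]
            congr 1
            field_simp
            linear_combination z ^ 2 * hg
          linear_combination (-κ * κ * χ (g 1 0) * f z) * this

/-- The Weil representation of `SL₂(F)` on functions on `F`. -/
lemma weilOperator_mul (hF : (2 : F) ≠ 0) (hχ : χ.IsQuadratic)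
    (hφ : φ.IsPrimitive)
    (hγ : ∀ a ≠ 0, ∑ x, φ (a * x ^ 2) = χ a * γ) (hκ : κ ^ 2 * Fintype.card F = χ (-1))
    (hκγ : κ * γ = 1) {h g : Matrix (Fin 2) (Fin 2) F} (hh : h.det = 1) (hg : g.det = 1) :
    weilOperator χ φ κ (h * g) = weilOperator χ φ κ h * weilOperator χ φ κ g := by
  by_cases h0 : h 1 0 = 0
  · exact weilOperator_mul_of_upper hχ hh hg h0
  set u : Matrix (Fin 2) (Fin 2) F := !![1, h 0 0 / h 1 0; 0, 1] with hu
  set b : Matrix (Fin 2) (Fin 2) F := !![h 1 0, h 1 1; 0, (h 1 0)⁻¹] with hb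
  set w : Matrix (Fin 2) (Fin 2) F := !![0, -1; 1, 0] with hw
  have hudet : u.det = 1 := by simp [hu]
  have hwdet : w.det = 1 := by simp [hw]
  have hbdet : b.det = 1 := by simp [hb, h0]
  have bruhat : h = u * (w * b) := by
    rw [Matrix.det_fin_two] at hh
    ext i j
    fin_cases i <;> fin_cases j <;> simp [hu, hw, hb, Matrix.mul_apply]
    · field_simp
    · field_simp
      linear_combination -hh
  have mul_u {m : Matrix (Fin 2) (Fin 2) F} (hm : m.det = 1) :
      weilOperator χ φ κ (u * m) = weilOperator χ φ κ u * weilOperator χ φ κ m :=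
    weilOperator_mul_of_upper hχ hudet hm (by simp [hu])
  have mul_w {m : Matrix (Fin 2) (Fin 2) F} (hm : m.det = 1) :
      weilOperator χ φ κ (w * m) = weilOperator χ φ κ w * weilOperator χ φ κ m :=
    weilOperator_mul_of_inversion hF hφ hγ hκ hκγ hm
  have mul_b {m : Matrix (Fin 2) (Fin 2) F} (hm : m.det = 1) :
      weilOperator χ φ κ (b * m) = weilOperator χ φ κ b * weilOperator χ φ κ m :=
    weilOperator_mul_of_upper hχ hbdet hm (by simp [hb])
  have hbg : (b * g).det = 1 := by rw [Matrix.det_mul, hbdet, hg, one_mul]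
  have hwb : (w * b).det = 1 := by rw [Matrix.det_mul, hwdet, hbdet, one_mul]
  have hwbg : (w * (b * g)).det = 1 := by rw [Matrix.det_mul, hwdet, hbg, one_mul]
  rw [bruhat, mul_u hwb, mul_w hbdet, Matrix.mul_assoc, Matrix.mul_assoc, mul_u hwbg, mul_w hbg,
    mul_b hg]
  simp only [mul_assoc]

/-- The quadratic Gauss sum twisted by `a` in terms of the Gauss sum of the quadratic
character. -/
lemma sum_addChar_mul_sq_s6 (hF : ringChar F ≠ 2) (hφ : φ.IsPrimitive) {a : F} (ha : a ≠ 0) :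
    ∑ x, φ (a * x ^ 2) = (quadraticChar F).ringHomComp (Int.castRingHom K) a *
      gaussSum ((quadraticChar F).ringHomComp (Int.castRingHom K)) φ := by
  have h1 : ∑ x, φ (a * x ^ 2) =
      ∑ y, ((quadraticChar F y : K) + 1) * φ (a * y) := by
    rw [← Fintype.sum_fiberwise (fun x : F => x ^ 2)]
    refine Finset.sum_congr rfl fun y _ => ?_
    have hcard := quadraticChar_card_sqrts hF y
    rw [Finset.sum_congr rfl (g := fun _ => φ (a * y)) fun x _ => by rw [x.2],
      Finset.sum_const, nsmul_eq_mul]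
    congr 1
    have h2 : (Finset.univ : Finset {x : F // x ^ 2 = y}).card =
        {x : F | x ^ 2 = y}.toFinset.card := by
      rw [Set.toFinset_card]
      rfl
    rw [h2]
    exact_mod_cast congrArg (Int.cast (R := K)) hcard
  have h3 : ∑ y, φ (a * y) = 0 := by
    have := AddChar.sum_mulShift a hφ
    simpa [ha, mul_comm] using this
  have h4 := gaussSum_mulShift ((quadraticChar F).ringHomComp (Int.castRingHom K)) φ (Units.mk0 a ha)
  rw [h1]
  simp only [add_mul, one_mul, Finset.sum_add_distrib, h3, add_zero]
  rw [← h4, ← mul_assoc, Units.val_mk0, (show MulChar.IsQuadratic _ from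
    (quadraticChar_isQuadratic F).comp _).mul_self_apply ha, one_mul]
  rfl

end Weil

section Even

variable {p : ℕ} [Fact p.Prime] {K : Type*} [Field K]

/-- The even function on `ZMod p` with prescribed values at the residues `0, …, p / 2`. -/
def evenExtension (K : Type*) [Field K] {p r : ℕ} [NeZero p] (hr : r = p / 2) :
    (Fin (r + 1) → K) →ₗ[K] (ZMod p → K) :=
  LinearMap.funLeft K K fun x =>
    ⟨x.valMinAbs.natAbs, Nat.lt_succ_of_le (hr ▸ ZMod.natAbs_valMinAbs_le x)⟩

/-- Restriction of functions on `ZMod p` to the residues `0, …, r`. -/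
def residueRestriction (K : Type*) [Field K] (p r : ℕ) :
    (ZMod p → K) →ₗ[K] (Fin (r + 1) → K) :=
  LinearMap.funLeft K K fun j => ((j : ℕ) : ZMod p)

variable {r : ℕ} (hr : r = p / 2)

lemma evenExtension_apply_neg (f : Fin (r + 1) → K) (x : ZMod p) :
    evenExtension K hr f (-x) = evenExtension K hr f x := by
  simp [evenExtension, LinearMap.funLeft_apply, ZMod.natAbs_valMinAbs_neg]

lemma natAbs_valMinAbs_natCast_of_le_half {j : ℕ} (hj : j ≤ p / 2) :
    (j : ZMod p).valMinAbs.natAbs = j := by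
  rw [ZMod.valMinAbs_natCast_of_le_half hj, Int.natAbs_natCast]

lemma residueRestriction_comp_evenExtension :
    residueRestriction K p r ∘ₗ evenExtension K hr = LinearMap.id := by
  refine LinearMap.ext fun f => funext fun j => ?_
  have : (j : ℕ) ≤ p / 2 := hr ▸ Nat.le_of_lt_succ j.2
  simp [evenExtension, residueRestriction, LinearMap.funLeft_apply,
    natAbs_valMinAbs_natCast_of_le_half this]

lemma evenExtension_residueRestriction {f : ZMod p → K} (hf : ∀ x, f (-x) = f x) :
    evenExtension K hr (residueRestriction K p r f) = f := by
  funext x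
  simp only [evenExtension, residueRestriction, LinearMap.funLeft_apply,
    ZMod.natCast_natAbs_valMinAbs]
  split_ifs
  · rfl
  · exact hf x

lemma natAbs_valMinAbs_eq_iff {k : ℕ} (hk : k ≤ p / 2) (x : ZMod p) :
    x.valMinAbs.natAbs = k ↔ x = k ∨ x = -k := by
  constructor
  · rintro rfl
    rw [ZMod.natCast_natAbs_valMinAbs]
    split_ifs <;> simp
  · rintro (rfl | rfl)
    · exact natAbs_valMinAbs_natCast_of_le_half hk
    · rw [ZMod.natAbs_valMinAbs_neg, natAbs_valMinAbs_natCast_of_le_half hk]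

lemma evenExtension_single (k : Fin (r + 1)) (x : ZMod p) :
    evenExtension K hr (Pi.single k 1) x =
      if x = ((k : ℕ) : ZMod p) ∨ x = -((k : ℕ) : ZMod p) then 1 else 0 := by
  have hk : (k : ℕ) ≤ p / 2 := hr ▸ Nat.le_of_lt_succ k.2
  simp only [evenExtension, LinearMap.funLeft_apply, Pi.single_apply, Fin.ext_iff,
    natAbs_valMinAbs_eq_iff hk]

lemma sum_mul_evenExtension_single_zero (F : ZMod p → K) :
    ∑ y, F y * evenExtension K hr (Pi.single 0 1) y = F 0 := by
  simp [evenExtension_single]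

lemma sum_mul_evenExtension_single (hp : p ≠ 2) (F : ZMod p → K) {k : Fin (r + 1)}
    (hk0 : k ≠ 0) :
    ∑ y, F y * evenExtension K hr (Pi.single k 1) y =
      F ((k : ℕ) : ZMod p) + F (-((k : ℕ) : ZMod p)) := by
  have hpp : p.Prime := Fact.out
  have hk : (k : ℕ) ≤ p / 2 := hr ▸ Nat.le_of_lt_succ k.2
  have hne : ((k : ℕ) : ZMod p) ≠ -((k : ℕ) : ZMod p) := by
    have h0 : ((k : ℕ) : ZMod p) ≠ 0 := by
      rw [Ne, ZMod.natCast_eq_zero_iff]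
      intro h
      have := Nat.le_of_dvd (Nat.pos_of_ne_zero fun h => hk0 (Fin.ext h)) h
      have := hpp.two_le
      lia
    have : Fact (2 < p) := ⟨lt_of_le_of_ne hpp.two_le hp.symm⟩
    intro h
    have := ZMod.neg_eq_self_iff ((k : ℕ) : ZMod p) |>.1 h.symm
    rcases this with h | h
    · exact h0 h
    · have := hpp.eq_two_or_odd
      lia
  simp only [evenExtension_single, mul_ite, mul_one, mul_zero]
  rw [← Finset.sum_filter, Finset.sum_congr (s₂ := {((k : ℕ) : ZMod p), -((k : ℕ) : ZMod p)})
    (by ext; simp) fun _ _ => rfl, Finset.sum_pair hne]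

open Matrix in
/-- The even part of the Weil representation of `SL(2, ZMod p)`, in the basis of even functions
dual to evaluation at `0, …, r`. -/
lemma exists_evenWeilRepresentation {χ : MulChar (ZMod p) K} {φ : AddChar (ZMod p) K} {κ γ : K}
    (hp : p ≠ 2) (hχ : χ.IsQuadratic) (hφ : φ.IsPrimitive)
    (hγ : ∀ a ≠ 0, ∑ x, φ (a * x ^ 2) = χ a * γ) (hκ : κ ^ 2 * p = χ (-1))
    (hκγ : κ * γ = 1) :
    ∃ ξ : SpecialLinearGroup (Fin 2) (ZMod p) →* (Matrix (Fin (r + 1)) (Fin (r + 1)) K)ˣ,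
      ∀ g, (ξ g : Matrix (Fin (r + 1)) (Fin (r + 1)) K) = LinearMap.toMatrix'
        (residueRestriction K p r ∘ₗ weilOperator χ φ κ (g : Matrix (Fin 2) (Fin 2) (ZMod p)) ∘ₗ
          evenExtension K hr) := by
  have h2 : (2 : ZMod p) ≠ 0 := Ring.two_ne_zero (by rwa [ZMod.ringChar_zmod_n])
  refine ⟨MonoidHom.toHomUnits
    { toFun := fun g => LinearMap.toMatrix'
        (residueRestriction K p r ∘ₗ weilOperator χ φ κ (g : Matrix (Fin 2) (Fin 2) (ZMod p)) ∘ₗ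
          evenExtension K hr)
      map_one' := ?_
      map_mul' := fun g h => ?_ }, fun g => rfl⟩
  · change LinearMap.toMatrix' (_ ∘ₗ weilOperator χ φ κ 1 ∘ₗ _) = 1
    rw [weilOperator_one, Module.End.one_eq_id, LinearMap.id_comp,
      residueRestriction_comp_evenExtension, LinearMap.toMatrix'_id]
  · change LinearMap.toMatrix' (_ ∘ₗ weilOperator χ φ κ
      ((g : Matrix (Fin 2) (Fin 2) (ZMod p)) * (h : Matrix (Fin 2) (Fin 2) (ZMod p))) ∘ₗ _) = _
    rw [← LinearMap.toMatrix'_comp, weilOperator_mul h2 hχ hφ hγ (by rwa [ZMod.card]) hκγ g.2 h.2]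
    congr 1
    refine LinearMap.ext fun f => ?_
    simp only [LinearMap.comp_apply, Module.End.mul_apply]
    rw [evenExtension_residueRestriction hr
      (weilOperator_apply_neg _ (evenExtension_apply_neg hr f))]

end Even

/-- Existence of the principal series Weil character of dimension
`(p+1)/2` attached to `Q(x) = c·x²/p`: there is a group homomorphism `ξ` from
`SL(2, ZMod p)` to the invertible `(r+1)×(r+1)` matrices over the `p`-th cyclotomic
field with `ξ(s) = S` and `ξ(t) = T`. -/
theorem principal_series_weil_character_exists
    (p : ℕ+) [hp : Fact (p : ℕ).Prime] (hp2 : (p : ℕ) ≠ 2)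
    (r : ℕ) (hr : r = ((p : ℕ) - 1) / 2)
    (ε : ℤ) (hε : ε = (-1) ^ r)
    (ζ : CyclotomicField p ℚ) (hζ : IsPrimitiveRoot ζ (p : ℕ))
    (c : ℤ) (hc : ¬ ((p : ℕ) : ℤ) ∣ c)
    (γ : CyclotomicField p ℚ)
    (hγ : γ = ∑ x : ZMod (p : ℕ), ζ ^ (c * ((x.val : ℤ)) ^ 2))
    (S T : Matrix (Fin (r + 1)) (Fin (r + 1)) (CyclotomicField p ℚ))
    (hT : T = Matrix.diagonal fun j : Fin (r + 1) => ζ ^ (c * ((j : ℕ) : ℤ) ^ 2))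
    (hS0 : ∀ j, S j 0 = (ε : CyclotomicField p ℚ) * γ / ((p : ℕ) : CyclotomicField p ℚ))
    (hS1 : ∀ k, k ≠ 0 →
      S 0 k = 2 * ((ε : CyclotomicField p ℚ) * γ / ((p : ℕ) : CyclotomicField p ℚ)))
    (hS2 : ∀ j k, j ≠ 0 → k ≠ 0 →
      S j k = (ε : CyclotomicField p ℚ) * γ / ((p : ℕ) : CyclotomicField p ℚ) *
        (ζ ^ (2 * c * ((j : ℕ) : ℤ) * ((k : ℕ) : ℤ)) +
          ζ ^ (-(2 * c * ((j : ℕ) : ℤ) * ((k : ℕ) : ℤ)))))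
    (s t : Matrix.SpecialLinearGroup (Fin 2) (ZMod (p : ℕ)))
    (hs : (s : Matrix (Fin 2) (Fin 2) (ZMod (p : ℕ))) = !![0, -1; 1, 0])
    (ht : (t : Matrix (Fin 2) (Fin 2) (ZMod (p : ℕ))) = !![1, 1; 0, 1]) :
    ∃ ξ : Matrix.SpecialLinearGroup (Fin 2) (ZMod (p : ℕ)) →*
        (Matrix (Fin (r + 1)) (Fin (r + 1)) (CyclotomicField p ℚ))ˣ,
      ((ξ s : (Matrix (Fin (r + 1)) (Fin (r + 1)) (CyclotomicField p ℚ))ˣ) :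
          Matrix (Fin (r + 1)) (Fin (r + 1)) (CyclotomicField p ℚ)) = S ∧
      ((ξ t : (Matrix (Fin (r + 1)) (Fin (r + 1)) (CyclotomicField p ℚ))ˣ) :
          Matrix (Fin (r + 1)) (Fin (r + 1)) (CyclotomicField p ℚ)) = T := by
  have hpp : (p : ℕ).Prime := hp.out
  have hodd : (p : ℕ) % 2 = 1 := hpp.eq_two_or_odd.resolve_left hp2
  have hr' : r = (p : ℕ) / 2 := by lia
  have hchar : ringChar (ZMod (p : ℕ)) ≠ 2 := by rwa [ZMod.ringChar_zmod_n]
  have hpK : ((p : ℕ) : CyclotomicField p ℚ) ≠ 0 := Nat.cast_ne_zero.2 hpp.ne_zero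
  have hcF : (c : ZMod (p : ℕ)) ≠ 0 := by rwa [Ne, ZMod.intCast_zmod_eq_zero_iff_dvd]
  set ψ := AddChar.zmodChar (p : ℕ) hζ.pow_eq_one with hψ
  have hψprim : ψ.IsPrimitive := AddChar.zmodChar_primitive_of_primitive_root (p : ℕ) hζ
  have hψ_int (n : ℤ) : ψ (n : ZMod (p : ℕ)) = ζ ^ n := by
    obtain ⟨m, rfl | rfl⟩ := n.eq_nat_or_neg
    · simp [hψ, AddChar.zmodChar_apply']
    · simp [hψ, AddChar.zmodChar_apply', AddChar.map_neg_eq_inv]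
  set φ := ψ.mulShift (c : ZMod (p : ℕ)) with hφdef
  have hφ : φ.IsPrimitive := by
    intro a ha
    rw [hφdef, AddChar.mulShift_mulShift]
    exact hψprim (mul_ne_zero hcF ha)
  have hφ_int (n : ℤ) : φ (n : ZMod (p : ℕ)) = ζ ^ (c * n) := by
    rw [hφdef, AddChar.mulShift_apply, ← Int.cast_mul, hψ_int]
  set χ := (quadraticChar (ZMod (p : ℕ))).ringHomComp (Int.castRingHom (CyclotomicField p ℚ))
    with hχdef
  have hχ : χ.IsQuadratic := (quadraticChar_isQuadratic _).comp _
  have hχ1 : χ ≠ 1 := by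
    intro h
    refine quadraticChar_ne_one hchar (MulChar.ext fun a => ?_)
    have := DFunLike.congr_fun h (a : ZMod (p : ℕ))
    simpa [hχdef, MulChar.one_apply] using this
  have hγ_gauss : γ = gaussSum χ φ := by
    have h := sum_addChar_mul_sq_s6 (K := CyclotomicField p ℚ) hchar hφ
      (one_ne_zero : (1 : ZMod (p : ℕ)) ≠ 0)
    rw [map_one, one_mul] at h
    rw [hγ, ← h]
    refine Finset.sum_congr rfl fun x _ => ?_
    rw [← hφ_int]
    simp
  have hε' : χ (-1) = ε := by
    rw [hχdef, MulChar.ringHomComp_apply, quadraticChar_neg_one hchar, ZMod.card,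
      ZMod.χ₄_eq_neg_one_pow hodd, hε, hr', Int.coe_castRingHom]
  have hε2 : (ε : CyclotomicField p ℚ) * ε = 1 := by
    rw [← hε']
    exact hχ.mul_self_apply (neg_ne_zero.2 one_ne_zero)
  have hγ2 : γ ^ 2 = ε * (p : ℕ) := by
    rw [hγ_gauss, gaussSum_sq hχ1 hχ hφ, hε', ZMod.card]
  set κ : CyclotomicField p ℚ := ε * γ / (p : ℕ) with hκdef
  obtain ⟨ξ, hξ⟩ := exists_evenWeilRepresentation (κ := κ) (γ := γ) hr' hp2 hχ hφ
    (fun a ha => by rw [hγ_gauss]; exact sum_addChar_mul_sq_s6 hchar hφ ha)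
    (by
      rw [hε', hκdef]
      field_simp
      linear_combination (ε ^ 2 : CyclotomicField p ℚ) * hγ2 + ε * (p : ℕ) * hε2)
    (by
      rw [hκdef]
      field_simp
      linear_combination (ε : CyclotomicField p ℚ) * hγ2 + (p : ℕ) * hε2)
  refine ⟨ξ, ?_, ?_⟩
  · have hs_apply (f : ZMod (p : ℕ) → CyclotomicField p ℚ) (x : ZMod (p : ℕ)) :
        weilOperator χ φ κ !![0, -1; 1, 0] f x = κ * ∑ y, φ (-(2 * x * y)) * f y := by
      rw [weilOperator_apply_of_ne_zero (by simp)]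
      simp
    rw [hξ, hs]
    ext j k
    rw [LinearMap.toMatrix'_apply, LinearMap.comp_apply, LinearMap.comp_apply,
      residueRestriction, LinearMap.funLeft_apply, hs_apply]
    by_cases hk : k = 0
    · rw [hk, sum_mul_evenExtension_single_zero, hS0]
      simp
    · rw [sum_mul_evenExtension_single hr' hp2 _ hk]
      by_cases hj : j = 0
      · rw [hj, hS1 k hk]
        simp
        ring
      · rw [hS2 j k hj hk, add_comm]
        congr 2
        · rw [show (2 * c * ((j : ℕ) : ℤ) * ((k : ℕ) : ℤ)) =
            c * (2 * ((j : ℕ) : ℤ) * ((k : ℕ) : ℤ)) by ring, ← hφ_int]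
          simp
        · rw [show -(2 * c * ((j : ℕ) : ℤ) * ((k : ℕ) : ℤ)) =
            c * -(2 * ((j : ℕ) : ℤ) * ((k : ℕ) : ℤ)) by ring, ← hφ_int]
          simp
  · rw [hξ, ht, hT]
    ext j k
    rw [LinearMap.toMatrix'_apply, LinearMap.comp_apply, LinearMap.comp_apply,
      residueRestriction, LinearMap.funLeft_apply, weilOperator_apply_of_eq_zero (by simp)]
    have h1 := congrFun (LinearMap.congr_fun (residueRestriction_comp_evenExtension
      (K := CyclotomicField p ℚ) hr') (Pi.single k 1)) j
    rw [LinearMap.comp_apply, residueRestriction, LinearMap.funLeft_apply,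
      LinearMap.id_apply] at h1
    have h2 := hφ_int (((j : ℕ) : ℤ) ^ 2)
    push_cast at h2
    simp [h1, h2, Matrix.diagonal_apply, Pi.single_apply]
end

section
/- Let p be an odd prime, r = (p−1)/2, K = CyclotomicField p ℚ, ζ ∈ K a primitive p-th root of unity, c an integer with p ∤ c, and g = Σ_{x ∈ ZMod p} ζ^{x²}. Let T be the (r+1)×(r+1) diagonal matrix over K with T_{jj} = ζ^{c·j²} and let V be the Vandermonde matrix with V_{j,k} = ζ^{c·j²·k} (0 ≤ j, k ≤ r); V is invertible. Then every entry of T' = V⁻¹ · T · V lies in the ring ℤ[(1+g)/2]: for all j, k there exist integers a, b with T'_{j,k} = a + b·(1+g)/2. -/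
open Polynomial Finset

/-- The quadratic Gauss sum as a sum twisted by the quadratic character. -/
theorem AddChar.sum_sq_eq_sum_quadraticChar {F K : Type*} [Field F] [Fintype F] [DecidableEq F]
    [CommRing K] [IsDomain K] (hF : ringChar F ≠ 2) {ψ : AddChar F K} (hψ : ψ ≠ 1) :
    ∑ x, ψ (x ^ 2) = ∑ y, ((quadraticChar F y : ℤ) : K) * ψ y := by
  have hfib : ∑ x, ψ (x ^ 2) = ∑ y, (((quadraticChar F y : ℤ) : K) + 1) * ψ y := by
    rw [← Finset.sum_fiberwise (s := univ) (g := fun x : F => x ^ 2)]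
    refine Finset.sum_congr rfl fun y _ => ?_
    have hcard : ((#{x : F | x ^ 2 = y} : ℕ) : ℤ) = quadraticChar F y + 1 := by
      rw [← quadraticChar_card_sqrts hF y]
      congr 2
      ext x
      simp
    rw [Finset.sum_congr rfl fun x hx => congrArg ψ (Finset.mem_filter.1 hx).2, Finset.sum_const,
      nsmul_eq_mul]
    congr 1
    exact_mod_cast congrArg (Int.cast (R := K)) hcard
  simp_rw [hfib, add_mul, one_mul, Finset.sum_add_distrib, AddChar.sum_eq_zero_of_ne_one hψ,
    add_zero]

/-- An integral combination of character values whose coefficients depend only on the class modulo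
nonzero squares lies in the ring generated by `(1 + g) / 2`, with `g` the quadratic Gauss sum. -/
theorem AddChar.exists_sum_eq_of_sq_invariant {F K : Type*} [Field F] [Fintype F]
    [Field K] [CharZero K] (hF : ringChar F ≠ 2) {ψ : AddChar F K} (hψ : ψ ≠ 1)
    (f : F → ℤ) (hf : ∀ b, b ≠ 0 → ∀ i, f (b ^ 2 * i) = f i) :
    ∃ a b : ℤ, ∑ i, (f i : K) * ψ i = a + b * ((1 + ∑ x, ψ (x ^ 2)) / 2) := by
  classical
  obtain ⟨n, hn⟩ := quadraticChar_exists_neg_one hF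
  have hn0 : n ≠ 0 := by rintro rfl; simp at hn
  have key : ∀ i, 2 * f i = (f 1 + f n) + quadraticChar F i * (f 1 - f n)
      + if i = 0 then 2 * f 0 - f 1 - f n else 0 := by
    intro i
    rcases eq_or_ne i 0 with rfl | hi
    · simp
    rcases quadraticChar_dichotomy hi with h | h
    · obtain ⟨b, rfl⟩ := (quadraticChar_one_iff_isSquare hi).1 h
      have := hf b (left_ne_zero_of_mul hi) 1
      rw [mul_one, sq] at this
      rw [h, this, if_neg hi]
      ring
    · have hq : quadraticChar F (i * n) = 1 := by rw [map_mul, h, hn]; norm_num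
      obtain ⟨b, hb⟩ := (quadraticChar_one_iff_isSquare (mul_ne_zero hi hn0)).1 hq
      have hb0 : b ≠ 0 := by
        rintro rfl
        exact mul_ne_zero hi hn0 (by simpa using hb)
      have := hf (b / n) (div_ne_zero hb0 hn0) n
      have he : (b / n) ^ 2 * n = i := by
        field_simp
        rw [sq, ← hb, mul_comm]
      rw [he] at this
      rw [h, this, if_neg hi]
      ring
  refine ⟨f 0 - f 1, f 1 - f n, ?_⟩
  have hsum : 2 * ∑ i, (f i : K) * ψ i
      = (f 1 - f n) * ∑ x, ψ (x ^ 2) + (2 * f 0 - f 1 - f n) := by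
    have h1 : ∀ i, 2 * ((f i : K) * ψ i) = ((f 1 : K) + f n) * ψ i
        + ((f 1 : K) - f n) * (((quadraticChar F i : ℤ) : K) * ψ i)
        + if i = 0 then (2 * f 0 - f 1 - f n : K) else 0 := by
      intro i
      have h2 := congrArg (Int.cast (R := K)) (key i)
      push_cast at h2
      rw [← mul_assoc, h2]
      split_ifs with hi
      · subst hi
        simp
      · ring
    rw [Finset.mul_sum, Finset.sum_congr rfl fun i _ => h1 i, Finset.sum_add_distrib,
      Finset.sum_add_distrib, ← Finset.mul_sum, ← Finset.mul_sum,
      AddChar.sum_eq_zero_of_ne_one hψ, AddChar.sum_sq_eq_sum_quadraticChar hF hψ]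
    simp
  push_cast
  linear_combination hsum / 2

/-- The coefficients of `∏ (X - ψ s)`, over a set `S` stable under multiplication by nonzero
squares, lie in the ring generated by `(1 + g) / 2`, with `g` the quadratic Gauss sum. -/
theorem AddChar.exists_coeff_prod_X_sub_C_eq {F K : Type*} [Field F] [Fintype F]
    [Field K] [CharZero K] (hF : ringChar F ≠ 2) {ψ : AddChar F K} (hψ : ψ ≠ 1)
    (S : Finset F) (hS : ∀ b, b ≠ 0 → ∀ s ∈ S, b ^ 2 * s ∈ S) (m : ℕ) :
    ∃ a b : ℤ, (∏ s ∈ S, (X - C (ψ s))).coeff m = a + b * ((1 + ∑ x, ψ (x ^ 2)) / 2) := by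
  classical
  let φ : AddMonoidAlgebra ℤ F →ₐ[ℤ] K := AddMonoidAlgebra.lift ℤ K F ψ.toMonoidHom
  let P : (AddMonoidAlgebra ℤ F)[X] := ∏ s ∈ S, (X - C (AddMonoidAlgebra.single s 1))
  have hP : P.map (φ : AddMonoidAlgebra ℤ F →+* K) = ∏ s ∈ S, (X - C (ψ s)) := by
    simp [P, φ, Polynomial.map_prod]
  have hinv : ∀ b : F, b ≠ 0 → ∀ i, (P.coeff m).coeff (b ^ 2 * i) = (P.coeff m).coeff i := by
    intro b hb i
    have hb2 : b ^ 2 ≠ 0 := pow_ne_zero 2 hb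
    let σ : AddMonoidAlgebra ℤ F →+* AddMonoidAlgebra ℤ F :=
      AddMonoidAlgebra.mapDomainRingHom ℤ (AddMonoidHom.mulLeft (b ^ 2))
    have hσ : P.map σ = P := by
      simp only [P, Polynomial.map_prod, Polynomial.map_sub, Polynomial.map_X, Polynomial.map_C]
      refine Finset.prod_equiv (Equiv.mulLeft₀ (b ^ 2) hb2) (fun s => ⟨hS b hb s, fun h => ?_⟩)
        fun s _ => by simp [σ]
      have := hS b⁻¹ (inv_ne_zero hb) _ h
      rwa [Equiv.mulLeft₀_apply, ← mul_assoc, ← mul_pow, inv_mul_cancel₀ hb, one_pow, one_mul] at this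
    have hc : σ (P.coeff m) = P.coeff m := by rw [← Polynomial.coeff_map, hσ]
    conv_lhs => rw [← hc]
    exact Finsupp.mapDomain_apply (mul_right_injective₀ hb2) _ _
  obtain ⟨a, b, hab⟩ := AddChar.exists_sum_eq_of_sq_invariant hF hψ _ hinv
  refine ⟨a, b, ?_⟩
  rw [← hP, Polynomial.coeff_map, ← hab]
  change φ (P.coeff m) = _
  rw [AddMonoidAlgebra.lift_apply, Finsupp.sum_fintype _ _ (by simp)]
  simp

/-- Conjugating `diagonal θ` by the Vandermonde matrix of `θ` gives the companion matrix of
`∏ (X - θ j)`. -/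
theorem Matrix.diagonal_mul_vandermonde {K : Type*} [CommRing K] [Nontrivial K] {r : ℕ}
    (θ : Fin (r + 1) → K) :
    Matrix.diagonal θ * Matrix.vandermonde θ = Matrix.vandermonde θ *
      Matrix.of fun i k : Fin (r + 1) =>
        if (k : ℕ) = r then -(∏ j, (X - C (θ j))).coeff i
        else if (i : ℕ) = k + 1 then 1 else 0 := by
  ext j k
  rw [Matrix.diagonal_mul, Matrix.mul_apply]
  simp only [Matrix.vandermonde_apply, Matrix.of_apply]
  by_cases hk : (k : ℕ) = r
  · simp only [hk]
    have hmonic : (∏ j, (X - C (θ j))).Monic := monic_prod_of_monic _ _ fun j _ => monic_X_sub_C _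
    have hdeg : (∏ j, (X - C (θ j))).natDegree = r + 1 := by simp
    have hroot : (∏ j, (X - C (θ j))).eval (θ j) = 0 := by
      rw [Polynomial.eval_prod]
      exact Finset.prod_eq_zero (Finset.mem_univ j) (by simp)
    have hlead := hmonic.coeff_natDegree
    rw [Polynomial.eval_eq_sum_range, Finset.sum_range_succ, hlead, hdeg, Finset.sum_range] at hroot
    simp only [if_true, mul_comm (θ j ^ _), neg_mul, Finset.sum_neg_distrib]
    linear_combination hroot
  · have hlt : (k : ℕ) + 1 < r + 1 := by omega
    simp only [if_neg hk]
    rw [Finset.sum_eq_single (⟨k + 1, hlt⟩ : Fin (r + 1))]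
    · simp [pow_succ']
    · intro i _ hi
      rw [if_neg fun h => hi (Fin.ext h), mul_zero]
    · simp

/-- Every square in `ZMod p` is the square of some natural number `j ≤ p / 2`. -/
theorem ZMod.exists_fin_sq_eq {p r : ℕ} [NeZero p] (hr : p / 2 = r) (x : ZMod p) :
    ∃ j : Fin (r + 1), ((j : ℕ) : ZMod p) ^ 2 = x ^ 2 := by
  refine ⟨⟨x.valMinAbs.natAbs, by have := x.natAbs_valMinAbs_le; omega⟩, ?_⟩
  have h : ((x.valMinAbs.natAbs : ℤ) ^ 2) = x.valMinAbs ^ 2 := Int.natAbs_sq _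
  have := congrArg (Int.cast (R := ZMod p)) h
  push_cast at this
  simpa using this

/-- Squaring is injective on `{0, …, (p - 1) / 2}` modulo an odd prime `p`. -/
theorem ZMod.fin_sq_injective {p r : ℕ} [Fact p.Prime] (hr : p = 2 * r + 1) :
    Function.Injective fun j : Fin (r + 1) => ((j : ℕ) : ZMod p) ^ 2 := by
  intro j k h
  have hj := j.2
  have hk := k.2
  rcases sq_eq_sq_iff_eq_or_eq_neg.1 h with h | h
  · rw [ZMod.natCast_eq_natCast_iff, Nat.ModEq, Nat.mod_eq_of_lt (by omega),
      Nat.mod_eq_of_lt (by omega)] at h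
    exact Fin.ext h
  · rw [eq_neg_iff_add_eq_zero, ← Nat.cast_add, ZMod.natCast_eq_zero_iff] at h
    have := Nat.eq_zero_of_dvd_of_lt h (by omega)
    exact Fin.ext (by omega)

/-- (Theorem `thm1` of the paper.)  The conjugated matrix
`T' = V⁻¹·T·V`, where `T = diag(ζ^{c·j²})` and `V` is the Vandermonde matrix
`V_{j,k} = ζ^{c·j²·k}`, has all its entries in the quadratic ring `ℤ[(1+g)/2]`, the
ring of integers of `ℚ(√(εp))`. -/
theorem conjugated_T_matrix_entries_in_quadratic_ring
    (p : ℕ+) [hp : Fact (p : ℕ).Prime] (hp2 : (p : ℕ) ≠ 2)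
    (r : ℕ) (hr : r = ((p : ℕ) - 1) / 2)
    (ζ : CyclotomicField p ℚ) (hζ : IsPrimitiveRoot ζ (p : ℕ))
    (c : ℤ) (hc : ¬ ((p : ℕ) : ℤ) ∣ c)
    (g : CyclotomicField p ℚ)
    (hg : g = ∑ x : ZMod (p : ℕ), ζ ^ ((x.val : ℤ) ^ 2))
    (T V : Matrix (Fin (r + 1)) (Fin (r + 1)) (CyclotomicField p ℚ))
    (hT : T = Matrix.diagonal fun j : Fin (r + 1) => ζ ^ (c * ((j : ℕ) : ℤ) ^ 2))
    (hV : ∀ j k : Fin (r + 1), V j k = ζ ^ (c * ((j : ℕ) : ℤ) ^ 2 * ((k : ℕ) : ℤ))) :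
    IsUnit V ∧
      ∀ j k : Fin (r + 1), ∃ a b : ℤ,
        (V⁻¹ * T * V) j k = (a : CyclotomicField p ℚ) +
          (b : CyclotomicField p ℚ) * ((1 + g) / 2) := by
  have hpr : (p : ℕ) = 2 * r + 1 := by
    have := hp.out.eq_two_or_odd
    omega
  let ψ : AddChar (ZMod (p : ℕ)) (CyclotomicField p ℚ) := AddChar.zmodChar p hζ.pow_eq_one
  have hψ_int : ∀ n : ℤ, ψ (n : ZMod (p : ℕ)) = ζ ^ n := by
    intro n
    have h1 : ψ 1 = ζ := by
      have := AddChar.zmodChar_apply' hζ.pow_eq_one 1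
      rwa [Nat.cast_one, pow_one] at this
    rw [← h1, ← AddChar.map_zsmul_eq_zpow, zsmul_one]
  have hψ_inj : Function.Injective ψ := by
    intro x y hxy
    exact ZMod.val_injective _ (hζ.pow_inj x.val_lt y.val_lt hxy)
  have hψ : ψ ≠ 1 := by
    intro h
    have : ψ 1 = ψ 0 := by rw [h]; simp
    exact one_ne_zero (hψ_inj this)
  have hF : ringChar (ZMod (p : ℕ)) ≠ 2 := by rwa [ZMod.ringChar_zmod_n]
  have hc0 : (c : ZMod (p : ℕ)) ≠ 0 := by rwa [Ne, ZMod.intCast_zmod_eq_zero_iff_dvd]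
  let s : Fin (r + 1) → ZMod (p : ℕ) := fun j => c * ((j : ℕ) : ZMod (p : ℕ)) ^ 2
  have hs : Function.Injective s :=
    (mul_right_injective₀ hc0).comp (ZMod.fin_sq_injective hpr)
  have hθ : ∀ j : Fin (r + 1), ζ ^ (c * ((j : ℕ) : ℤ) ^ 2) = ψ (s j) := by
    intro j
    rw [← hψ_int]
    simp [s]
  have hg' : g = ∑ x, ψ (x ^ 2) := by
    rw [hg]
    refine Finset.sum_congr rfl fun x _ => ?_
    rw [← hψ_int]
    simp
  have hV' : V = Matrix.vandermonde (ψ ∘ s) := by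
    ext j k
    rw [hV, Matrix.vandermonde_apply, zpow_mul, hθ, zpow_natCast, Function.comp_apply]
  have hT' : T = Matrix.diagonal (ψ ∘ s) := by
    rw [hT]
    exact congrArg _ (funext hθ)
  have hdet : IsUnit V.det := by
    rw [hV', isUnit_iff_ne_zero, Matrix.det_vandermonde_ne_zero_iff]
    exact hψ_inj.comp hs
  refine ⟨(Matrix.isUnit_iff_isUnit_det V).2 hdet, fun j k => ?_⟩
  rw [Matrix.mul_assoc, hT', hV', Matrix.diagonal_mul_vandermonde, ← hV',
    Matrix.nonsing_inv_mul_cancel_left _ _ hdet, Matrix.of_apply]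
  split_ifs
  · have hprod : ∏ i, (X - C ((ψ ∘ s) i)) = ∏ x ∈ univ.image s, (X - C (ψ x)) := by
      rw [Finset.prod_image hs.injOn]
      rfl
    obtain ⟨a, b, hab⟩ := AddChar.exists_coeff_prod_X_sub_C_eq hF hψ (univ.image s) (by
      intro b _ x hx
      obtain ⟨i, -, rfl⟩ := Finset.mem_image.1 hx
      obtain ⟨i', hi'⟩ := ZMod.exists_fin_sq_eq (r := r) (by omega) (b * ((i : ℕ) : ZMod (p : ℕ)))
      refine Finset.mem_image.2 ⟨i', Finset.mem_univ _, ?_⟩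
      simp only [s, hi']
      ring) j
    refine ⟨-a, -b, ?_⟩
    rw [hprod, hab, hg']
    push_cast
    ring
  · exact ⟨1, 0, by simp⟩
  · exact ⟨0, 0, by simp⟩
end

section
/- Let p ≥ 5 be a prime, r = (p−1)/2, ε = (−1)^r, K = CyclotomicField p ℚ, ζ ∈ K a primitive p-th root of unity, c an integer with p ∤ c, and γ = Σ_{x ∈ ZMod p} ζ^{c·x²}. Let S and T be the (r+1)×(r+1) matrices over K with: T diagonal, T_{jj} = ζ^{c·j²}; S_{j,0} = ε·γ/p for all 0 ≤ j ≤ r, S_{0,k} = 2·ε·γ/p for 1 ≤ k ≤ r, and S_{j,k} = (ε·γ/p)·(ζ^{2cjk} + ζ^{−2cjk}) for 1 ≤ j, k ≤ r; and let V be the Vandermonde matrix V_{j,k} = ζ^{c·j²·k}. Then every entry of V⁻¹ · S · V and every entry of V⁻¹ · T · V lies in the subring ℤ[ζ] of K, i.e., in Algebra.adjoin ℤ {ζ}. -/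
open Polynomial in
/-- If `W` has columns obtained by evaluating polynomials over a subring `A` at points of `A`, then
multiplying it by the inverse of the Vandermonde matrix at these points gives a matrix over `A`. -/
theorem Matrix.inv_vandermonde_mul_apply_mem {K ι : Type*} [Field K] {n : ℕ} {A : Subalgebra ℤ K}
    (v : Fin n → A) (W : Matrix (Fin n) ι K)
    (hW : ∀ k, ∃ P : A[X], ∀ j, W j k = (P.eval (v j) : A)) (i : Fin n) (k : ι) :
    ((Matrix.vandermonde fun j => (v j : K))⁻¹ * W) i k ∈ A := by
  set V := Matrix.vandermonde fun j => (v j : K) with hV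
  by_cases hdet : IsUnit V.det
  swap
  · rw [Matrix.nonsing_inv_apply_not_isUnit _ hdet]
    simp
  choose P hP using hW
  have hmonic : (∏ j, (X - C (v j))).Monic := monic_prod_of_monic _ _ fun j _ => monic_X_sub_C _
  let Q : ι → A[X] := fun k => P k %ₘ ∏ j, (X - C (v j))
  have hdeg (k : ι) : (Q k).degree < n := by
    refine (degree_modByMonic_lt _ hmonic).trans_le ?_
    simp [degree_prod]
  have hWQ : W = V * Matrix.of fun (l : Fin n) k => ((Q k).coeff l : K) := by
    ext j k
    have hroot : (∏ j, (X - C (v j))).eval (v j) = 0 := by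
      rw [eval_prod]
      exact Finset.prod_eq_zero (Finset.mem_univ j) (by simp)
    have hQ : (P k).eval (v j) = (Q k).eval (v j) := by
      conv_lhs => rw [← modByMonic_add_div (P k) (∏ j, (X - C (v j)))]
      simp [Q, hroot]
    rw [hP, hQ, Matrix.mul_apply, eval_eq_sum_degreeLTEquiv (mem_degreeLT.2 (hdeg k))]
    simp [hV, Matrix.vandermonde_apply, degreeLTEquiv, mul_comm]
  rw [hWQ, ← Matrix.mul_assoc, Matrix.nonsing_inv_mul _ hdet, Matrix.one_mul]
  exact ((Q k).coeff i).2

open MulChar in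
/-- The square of the quadratic Gauss sum, written as a sum over squares. -/
theorem AddChar.sum_sq_pow_two {F R : Type*} [Field F] [Fintype F] [CommRing R] [IsDomain R]
    [CharZero R] (hF : ringChar F ≠ 2) {ψ : AddChar F R} (hψ : ψ.IsPrimitive) :
    (∑ x, ψ (x ^ 2)) ^ 2 = (-1) ^ (Fintype.card F / 2) * Fintype.card F := by
  classical
  let χ : MulChar F R := (quadraticChar F).ringHomComp (Int.castRingHom R)
  have hsum : ∑ x, ψ (x ^ 2) = gaussSum χ ψ := by
    have h0 : ∑ a, ψ a = 0 := by
      simpa using AddChar.sum_mulShift (1 : F) hψ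
    calc ∑ x, ψ (x ^ 2) = ∑ a, ∑ x with x ^ 2 = a, ψ (x ^ 2) :=
          (Finset.sum_fiberwise _ _ _).symm
      _ = ∑ a, (quadraticChar F a + 1 : ℤ) * ψ a := by
          refine Finset.sum_congr rfl fun a _ => ?_
          rw [← quadraticChar_card_sqrts hF a, Finset.sum_congr rfl
            (g := fun _ => ψ a) (by simp +contextual)]
          simp
      _ = gaussSum χ ψ := by
          simp [gaussSum, χ, add_mul, Finset.sum_add_distrib, h0]
  have hχ : χ ≠ 1 :=
    (ringHomComp_ne_one_iff (RingHom.injective_int _)).2 (quadraticChar_ne_one hF)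
  rw [hsum, gaussSum_sq hχ ((quadraticChar_isQuadratic F).comp _) hψ]
  simp [χ, quadraticChar_neg_one hF,
    ZMod.χ₄_eq_neg_one_pow (FiniteField.odd_card_of_char_ne_two hF)]

/-- A sum over `ZMod p` with `p` odd, grouped into pairs of opposite classes. -/
theorem ZMod.sum_eq_zero_add_sum_add_neg {M : Type*} [AddCommMonoid M] {p r : ℕ} [NeZero p]
    (hp : p = 2 * r + 1) (f : ZMod p → M) :
    ∑ x, f x = f 0 + ∑ l : Fin r, (f (l + 1 : ℕ) + f (-(l + 1 : ℕ))) := by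
  have hval : ∑ x, f x = ∑ i ∈ Finset.range (2 * r + 1), f i := by
    rw [← hp]
    refine Finset.sum_nbij' (fun x => x.val) (fun i => (i : ZMod p)) ?_ ?_ ?_ ?_ ?_ <;>
      simp +contextual [ZMod.val_lt, Nat.mod_eq_of_lt]
  rw [hval, Finset.sum_range_succ', two_mul, Finset.sum_range_add,
    ← Finset.sum_range_reflect (fun x => f ((r + x + 1 : ℕ) : ZMod p)), ← Finset.sum_add_distrib,
    add_comm, Finset.sum_range]
  congr 1
  · simp
  refine Finset.sum_congr rfl fun l _ => ?_
  congr 2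
  rw [eq_neg_iff_add_eq_zero, ← Nat.cast_add, ZMod.natCast_eq_zero_iff]
  exact ⟨1, by have := l.2; omega⟩

open Polynomial in
/-- Up to the normalisation by the Gauss sum, the sum of an additive character over the values of
`k x² + 2 j x` is an integral polynomial in `ψ (j ^ 2)`, independent of `j`. -/
theorem AddChar.exists_polynomial_sum_quadratic {p : ℕ} [Fact p.Prime] (hp : p ≠ 2) {K : Type*}
    [Field K] [CharZero K] {ψ : AddChar (ZMod p) K} (hψ : ψ.IsPrimitive) {A : Subalgebra ℤ K}
    (hA : ∀ x, ψ x ∈ A) (k : ZMod p) :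
    ∃ P : A[X], ∀ j : ZMod p, (∑ x, ψ (x ^ 2))⁻¹ * ∑ x, ψ (k * x ^ 2 + 2 * j * x) =
      (P.eval ⟨ψ (j ^ 2), hA _⟩ : A) := by
  have hchar : ringChar (ZMod p) ≠ 2 := by rwa [ZMod.ringChar_zmod_n]
  have hp0 : (p : K) ≠ 0 := Nat.cast_ne_zero.2 (Fact.out : p.Prime).ne_zero
  have h2 : (2 : ZMod p) ≠ 0 := Ring.two_ne_zero hchar
  have hsq {φ : AddChar (ZMod p) K} (hφ : φ.IsPrimitive) :
      (∑ x, φ (x ^ 2)) ^ 2 = (-1) ^ (p / 2) * p := by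
    simpa using AddChar.sum_sq_pow_two hchar hφ
  set γ := ∑ x, ψ (x ^ 2) with hγ
  have hγ0 : γ ≠ 0 := by
    intro h
    have := hsq hψ
    rw [← hγ, h] at this
    simp [hp0] at this
  by_cases hk : k = 0
  · subst hk
    let γA : A := ∑ x, ⟨ψ (x ^ 2), hA _⟩
    have hγA : (γA : K) = γ := by simp [γA, hγ]
    refine ⟨C ((-1) ^ (p / 2)) * (C γA - ∑ x : ZMod p, X ^ (x ^ 2).val
      + ∑ x : ZMod p, X ^ x.val), fun j => ?_⟩
    have hpow (x : ZMod p) : ψ (j ^ 2) ^ x.val = ψ (x * j ^ 2) := by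
      rw [← AddChar.map_nsmul_eq_pow, nsmul_eq_mul, ZMod.natCast_zmod_val]
    have hγp : γ⁻¹ * p = (-1) ^ (p / 2) * γ := by
      rw [inv_mul_eq_iff_eq_mul₀ hγ0]
      calc (p : K) = ((-1) ^ (p / 2)) ^ 2 * p := by
            rw [← pow_mul, mul_comm _ 2, pow_mul]; simp
        _ = (-1) ^ (p / 2) * ((-1) ^ (p / 2) * p) := by ring
        _ = _ := by rw [← hsq hψ]; ring
    have hlin : ∑ x, ψ (0 * x ^ 2 + 2 * j * x) = if j = 0 then (p : K) else 0 := by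
      have := AddChar.sum_mulShift (2 * j) hψ
      simpa [h2, mul_comm] using this
    have hlin' : ∑ x, ψ (x * j ^ 2) = if j = 0 then (p : K) else 0 := by
      rw [AddChar.sum_mulShift (j ^ 2) hψ]
      by_cases hj : j = 0 <;> simp [hj]
    have hsqr : ∑ x, ψ (x ^ 2 * j ^ 2) = if j = 0 then (p : K) else γ := by
      split_ifs with hj
      · simp [hj]
      · simp_rw [← mul_pow]
        exact Equiv.sum_comp (Equiv.mulRight₀ j hj) fun x => ψ (x ^ 2)
    rw [hlin]
    simp only [eval_mul, eval_add, eval_sub, eval_C, eval_finsetSum, eval_pow, eval_X]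
    push_cast
    simp only [hpow, hγA, hlin', hsqr]
    split_ifs
    · rw [hγp]; ring
    · ring
  · have hk' : (ψ.mulShift k).IsPrimitive := AddChar.IsPrimitive.of_ne_one (hψ hk)
    obtain ⟨s, hs⟩ : ∃ s : ℤ, γ⁻¹ * ∑ x, ψ (k * x ^ 2) = s := by
      have h : (∑ x, ψ (k * x ^ 2)) ^ 2 = γ ^ 2 := (hsq hk').trans (hsq hψ).symm
      rcases sq_eq_sq_iff_eq_or_eq_neg.1 h with h | h
      · exact ⟨1, by simp [h, hγ0]⟩
      · exact ⟨-1, by simp [h, hγ0]⟩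
    refine ⟨C (s : A) * X ^ (-k⁻¹).val, fun j => ?_⟩
    have hpow : ψ (j ^ 2) ^ (-k⁻¹).val = ψ (-k⁻¹ * j ^ 2) := by
      rw [← AddChar.map_nsmul_eq_pow, nsmul_eq_mul, ZMod.natCast_zmod_val]
    have hsum : ∑ x, ψ (k * x ^ 2 + 2 * j * x) = (∑ x, ψ (k * x ^ 2)) * ψ (-k⁻¹ * j ^ 2) := by
      rw [← Equiv.sum_comp (Equiv.addRight (k⁻¹ * j)) fun x => ψ (k * x ^ 2), Finset.sum_mul]
      refine Finset.sum_congr rfl fun x _ => ?_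
      rw [← AddChar.map_add_eq_mul]
      congr 1
      simp only [Equiv.coe_addRight]
      field_simp
      ring
    rw [hsum, ← mul_assoc, hs]
    simp [hpow]

/-- (Wang's theorem, Thm. `thm:WangsThm` of the paper.)  For a prime
`p ≥ 5`, the entries of `V⁻¹·S·V` and `V⁻¹·T·V` all lie in `ℤ[ζ] = Algebra.adjoin ℤ {ζ}`,
the ring of integers of the `p`-th cyclotomic field. -/
theorem wang_integral_model
    (p : ℕ+) [hp : Fact (p : ℕ).Prime] (hp5 : 5 ≤ (p : ℕ))
    (r : ℕ) (hr : r = ((p : ℕ) - 1) / 2)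
    (ε : ℤ) (hε : ε = (-1) ^ r)
    (ζ : CyclotomicField p ℚ) (hζ : IsPrimitiveRoot ζ (p : ℕ))
    (c : ℤ) (hc : ¬ ((p : ℕ) : ℤ) ∣ c)
    (γ : CyclotomicField p ℚ)
    (hγ : γ = ∑ x : ZMod (p : ℕ), ζ ^ (c * ((x.val : ℤ)) ^ 2))
    (S T V : Matrix (Fin (r + 1)) (Fin (r + 1)) (CyclotomicField p ℚ))
    (hT : T = Matrix.diagonal fun j : Fin (r + 1) => ζ ^ (c * ((j : ℕ) : ℤ) ^ 2))
    (hS0 : ∀ j, S j 0 = (ε : CyclotomicField p ℚ) * γ / ((p : ℕ) : CyclotomicField p ℚ))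
    (hS1 : ∀ k, k ≠ 0 →
      S 0 k = 2 * ((ε : CyclotomicField p ℚ) * γ / ((p : ℕ) : CyclotomicField p ℚ)))
    (hS2 : ∀ j k, j ≠ 0 → k ≠ 0 →
      S j k = (ε : CyclotomicField p ℚ) * γ / ((p : ℕ) : CyclotomicField p ℚ) *
        (ζ ^ (2 * c * ((j : ℕ) : ℤ) * ((k : ℕ) : ℤ)) +
          ζ ^ (-(2 * c * ((j : ℕ) : ℤ) * ((k : ℕ) : ℤ)))))
    (hV : ∀ j k : Fin (r + 1), V j k = ζ ^ (c * ((j : ℕ) : ℤ) ^ 2 * ((k : ℕ) : ℤ))) :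
    (∀ j k : Fin (r + 1), (V⁻¹ * S * V) j k ∈ Algebra.adjoin ℤ {ζ}) ∧
      (∀ j k : Fin (r + 1), (V⁻¹ * T * V) j k ∈ Algebra.adjoin ℤ {ζ}) := by
  obtain ⟨hp2, hpr⟩ : (p : ℕ) ≠ 2 ∧ (p : ℕ) = 2 * r + 1 := by
    have := hp.out.odd_of_ne_two (by omega)
    obtain ⟨m, hm⟩ := this
    omega
  have hp0 : ((p : ℕ) : CyclotomicField p ℚ) ≠ 0 := Nat.cast_ne_zero.2 hp.out.ne_zero
  have hζ0 : ζ ≠ 0 := hζ.ne_zero hp.out.ne_zero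
  have hcp : (c : ZMod (p : ℕ)) ≠ 0 := by rwa [Ne, ZMod.intCast_zmod_eq_zero_iff_dvd]
  let e : AddChar (ZMod (p : ℕ)) (CyclotomicField p ℚ) := AddChar.zmodChar p hζ.pow_eq_one
  have he : e.IsPrimitive := AddChar.zmodChar_primitive_of_primitive_root p hζ
  let ψ := e.mulShift (c : ZMod (p : ℕ))
  have hψ : ψ.IsPrimitive := AddChar.IsPrimitive.of_ne_one (he hcp)
  have hzpow (n : ℤ) : ζ ^ n = e n := by
    have h1 : e 1 = ζ := by
      have := AddChar.zmodChar_apply' hζ.pow_eq_one 1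
      simpa using this
    rw [← zsmul_one, AddChar.map_zsmul_eq_zpow, h1]
  have hA (x : ZMod (p : ℕ)) : ψ x ∈ Algebra.adjoin ℤ {ζ} :=
    pow_mem (Algebra.self_mem_adjoin_singleton ℤ ζ) _
  have hγψ : γ = ∑ x, ψ (x ^ 2) := by
    rw [hγ]
    refine Finset.sum_congr rfl fun x _ => ?_
    simp [hzpow, ψ]
  have hγsq : γ ^ 2 = ε * (p : ℕ) := by
    have h := AddChar.sum_sq_pow_two (by rwa [ZMod.ringChar_zmod_n]) hψ
    rw [hγψ, h, hε, ZMod.card, show (p : ℕ) / 2 = r by omega]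
    push_cast
    rfl
  have hγ0 : γ ≠ 0 := by
    intro h
    rw [h, hε] at hγsq
    simp [hp0] at hγsq
  have hg : (ε : CyclotomicField p ℚ) * γ / ((p : ℕ) : CyclotomicField p ℚ) = γ⁻¹ := by
    have hε2 : (ε : CyclotomicField p ℚ) ^ 2 = 1 := by
      rw [hε, ← Int.cast_pow, ← pow_mul, mul_comm r, pow_mul]
      simp
    rw [div_eq_iff hp0, eq_inv_mul_iff_mul_eq₀ hγ0]
    linear_combination (ε : CyclotomicField p ℚ) * hγsq +
      ((p : ℕ) : CyclotomicField p ℚ) * hε2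
  let v : Fin (r + 1) → Algebra.adjoin ℤ {ζ} := fun j => ⟨ψ ((j : ℕ) ^ 2), hA _⟩
  have hVv : V = Matrix.vandermonde fun j => (v j : CyclotomicField p ℚ) := by
    ext j k
    rw [hV, Matrix.vandermonde_apply, zpow_mul, zpow_natCast, hzpow]
    simp [v, ψ]
  have hVψ (j k : Fin (r + 1)) : V j k = ψ ((k : ℕ) * (j : ℕ) ^ 2) := by
    rw [hV, hzpow]
    simp only [ψ, AddChar.mulShift_apply]
    push_cast
    congr 1
    ring
  have hSψ (j : Fin (r + 1)) (l : Fin r) : S j l.succ =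
      γ⁻¹ * (ψ (2 * (j : ℕ) * (l + 1 : ℕ)) + ψ (2 * (j : ℕ) * -(l + 1 : ℕ))) := by
    by_cases hj : j = 0
    · subst hj
      rw [hS1 _ l.succ_ne_zero, hg]
      simp
      ring
    · rw [hS2 _ _ hj l.succ_ne_zero, hg, hzpow, hzpow]
      simp only [ψ, AddChar.mulShift_apply, Fin.val_succ]
      push_cast
      ring_nf
  have hSV (j k : Fin (r + 1)) :
      (S * V) j k = γ⁻¹ * ∑ x, ψ ((k : ℕ) * x ^ 2 + 2 * (j : ℕ) * x) := by
    rw [Matrix.mul_apply, Fin.sum_univ_succ, ZMod.sum_eq_zero_add_sum_add_neg hpr, mul_add,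
      Finset.mul_sum]
    congr 1
    · rw [hS0, hg, hVψ]
      simp
    · refine Finset.sum_congr rfl fun l _ => ?_
      rw [hSψ, hVψ, mul_assoc, add_mul, ← AddChar.map_add_eq_mul, ← AddChar.map_add_eq_mul,
        Fin.val_succ, neg_sq, add_comm (2 * _ * _), add_comm (2 * _ * _)]
  simp only [Matrix.mul_assoc]
  constructor
  · rw [hVv]
    refine Matrix.inv_vandermonde_mul_apply_mem v _ fun k => ?_
    rw [← hVv]
    obtain ⟨P, hP⟩ := AddChar.exists_polynomial_sum_quadratic hp2 hψ hA ((k : ℕ) : ZMod (p : ℕ))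
    refine ⟨P, fun j => ?_⟩
    rw [hSV, hγψ, hP]
  · rw [hVv]
    refine Matrix.inv_vandermonde_mul_apply_mem v _ fun k => ⟨Polynomial.X ^ ((k : ℕ) + 1), ?_⟩
    intro j
    rw [hT, Matrix.diagonal_mul, Matrix.vandermonde_apply, hzpow]
    simp [v, ψ, pow_succ']
end

section
/- Let p be an odd prime, r = (p−1)/2, K = CyclotomicField p ℚ, ζ ∈ K a primitive p-th root of unity, and c an integer with p ∤ c. Let V be the (r+1)×(r+1) Vandermonde matrix over K with V_{j,k} = ζ^{c·j²·k}. For each unit w ∈ (ZMod p)ˣ, let τ_w be the unique ring automorphism of K with τ_w(ζ) = ζ^n, where n is a natural number representing w² in ZMod p. Then there exists a bijection σ : Fin (r+1) → Fin (r+1) with σ(0) = 0 and, for every j, either (σ(j) : ZMod p) = w·j or (σ(j) : ZMod p) = −w·j, such that applying τ_w to every entry of V permutes its rows by σ: τ_w(V_{j,k}) = V_{σ(j),k} for all j, k. -/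
/-- Every residue is, up to sign, the absolute value of its least absolute representative. -/
lemma ZMod.natCast_natAbs_valMinAbs_eq_or_neg {m : ℕ} (x : ZMod m) :
    ((x.valMinAbs.natAbs : ℕ) : ZMod m) = x ∨ ((x.valMinAbs.natAbs : ℕ) : ZMod m) = -x := by
  rcases Int.natAbs_eq x.valMinAbs with h | h
  · left
    conv_rhs => rw [← ZMod.coe_valMinAbs x, h]
    simp
  · right
    conv_rhs => rw [← ZMod.coe_valMinAbs x, h]
    simp

lemma ZMod.eq_or_eq_neg_of_natAbs_valMinAbs_eq {m : ℕ} {x y : ZMod m}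
    (h : x.valMinAbs.natAbs = y.valMinAbs.natAbs) : x = y ∨ x = -y := by
  rcases Int.natAbs_eq_natAbs_iff.mp h with h | h
  · exact Or.inl (ZMod.valMinAbs_inj.mp h)
  · right
    rw [← ZMod.coe_valMinAbs x, h]
    simp

/-- Integer powers of a root of unity depend only on the exponent modulo the order. -/
lemma zpow_eq_zpow_of_pow_eq_one {G : Type*} [GroupWithZero G] {m : ℕ} {x : G} (hx : x ≠ 0)
    (h : x ^ m = 1) {a b : ℤ} (hab : (a : ZMod m) = b) : x ^ a = x ^ b := by
  obtain ⟨d, hd⟩ := (ZMod.intCast_eq_intCast_iff_dvd_sub a b m).mp hab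
  rw [show b = a + m * d by linarith, zpow_add₀ hx, zpow_mul, zpow_natCast, h, one_zpow, mul_one]

/-- Multiplication by a unit permutes the representatives `0, …, r` of the residues up to sign. -/
lemma ZMod.exists_perm_fin_eq_mul_or_neg {m r : ℕ} [NeZero m] (hr : r = m / 2) (w : (ZMod m)ˣ) :
    ∃ σ : Fin (r + 1) ≃ Fin (r + 1), σ 0 = 0 ∧ ∀ j : Fin (r + 1),
      ((σ j : ℕ) : ZMod m) = (w : ZMod m) * ((j : ℕ) : ZMod m) ∨
        ((σ j : ℕ) : ZMod m) = -((w : ZMod m) * ((j : ℕ) : ZMod m)) := by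
  let f : Fin (r + 1) → Fin (r + 1) := fun j =>
    ⟨((w : ZMod m) * ((j : ℕ) : ZMod m)).valMinAbs.natAbs,
      Nat.lt_succ_of_le ((ZMod.natAbs_valMinAbs_le _).trans_eq hr.symm)⟩
  have hself (j : Fin (r + 1)) : (((j : ℕ) : ZMod m)).valMinAbs.natAbs = j := by
    rw [ZMod.valMinAbs_natCast_of_le_half ((Nat.le_of_lt_succ j.isLt).trans_eq hr), Int.natAbs_natCast]
  have hf : Function.Injective f := by
    intro a b hab
    have key : ((a : ℕ) : ZMod m) = (b : ℕ) ∨ ((a : ℕ) : ZMod m) = -(b : ℕ) := by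
      rcases ZMod.eq_or_eq_neg_of_natAbs_valMinAbs_eq (congrArg Fin.val hab) with h | h
      · exact Or.inl (w.mul_right_inj.mp h)
      · exact Or.inr (w.mul_right_inj.mp (h.trans (mul_neg _ _).symm))
    apply Fin.ext
    rw [← hself a, ← hself b]
    rcases key with h | h
    · rw [h]
    · rw [h, ZMod.natAbs_valMinAbs_neg]
  refine ⟨Equiv.ofBijective f (Finite.injective_iff_bijective.mp hf), ?_, fun j => ?_⟩
  · apply Fin.ext
    simp [f]
  · exact ZMod.natCast_natAbs_valMinAbs_eq_or_neg _


/-- The Galois action on the Vandermonde matrix `V_{j,k} = ζ^{c·j²·k}`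
permutes its rows: for `w ∈ (ZMod p)ˣ` and `τ_w` the automorphism of the cyclotomic
field with `τ_w(ζ) = ζ^{w²}`, there is a bijection `σ` of `{0,…,r}` fixing `0`, with
`σ(j) ≡ ±w·j (mod p)`, such that `τ_w(V_{j,k}) = V_{σ(j),k}` for all `j, k`. -/
theorem galois_action_permutes_vandermonde_rows
    (p : ℕ+) [hp : Fact (p : ℕ).Prime] (hp2 : (p : ℕ) ≠ 2)
    (r : ℕ) (hr : r = ((p : ℕ) - 1) / 2)
    (ζ : CyclotomicField p ℚ) (hζ : IsPrimitiveRoot ζ (p : ℕ))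
    (c : ℤ) (hc : ¬ ((p : ℕ) : ℤ) ∣ c)
    (V : Matrix (Fin (r + 1)) (Fin (r + 1)) (CyclotomicField p ℚ))
    (hV : ∀ j k : Fin (r + 1), V j k = ζ ^ (c * ((j : ℕ) : ℤ) ^ 2 * ((k : ℕ) : ℤ)))
    (w : (ZMod (p : ℕ))ˣ) (n : ℕ) (hn : (n : ZMod (p : ℕ)) = (w : ZMod (p : ℕ)) ^ 2)
    (τ : CyclotomicField p ℚ ≃+* CyclotomicField p ℚ) (hτ : τ ζ = ζ ^ n) :
    ∃ σ : Fin (r + 1) ≃ Fin (r + 1), σ 0 = 0 ∧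
      (∀ j : Fin (r + 1), (((σ j : ℕ) : ZMod (p : ℕ)) =
          (w : ZMod (p : ℕ)) * ((j : ℕ) : ZMod (p : ℕ)) ∨
        ((σ j : ℕ) : ZMod (p : ℕ)) =
          -((w : ZMod (p : ℕ)) * ((j : ℕ) : ZMod (p : ℕ))))) ∧
      ∀ j k : Fin (r + 1), τ (V j k) = V (σ j) k := by
  have hodd : r = (p : ℕ) / 2 := by
    have := hp.out.eq_two_or_odd
    omega
  obtain ⟨σ, h0, hσ⟩ := ZMod.exists_perm_fin_eq_mul_or_neg hodd w
  refine ⟨σ, h0, hσ, fun j k => ?_⟩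
  have hsq : ((σ j : ℕ) : ZMod (p : ℕ)) ^ 2 = (w : ZMod (p : ℕ)) ^ 2 * ((j : ℕ) : ZMod p) ^ 2 := by
    rcases hσ j with h | h <;> rw [h] <;> ring
  rw [hV, hV, map_zpow₀, hτ, ← zpow_natCast, ← zpow_mul]
  apply zpow_eq_zpow_of_pow_eq_one (hζ.ne_zero hp.out.ne_zero) hζ.pow_eq_one
  push_cast
  rw [hsq, hn]
  ring
end

section
/- Let p be an odd prime, r = (p−1)/2, ε = (−1)^r, K = CyclotomicField p ℚ, ζ ∈ K a primitive p-th root of unity, c an integer with p ∤ c, and γ = Σ_{x ∈ ZMod p} ζ^{c·x²}. Let S and T be the (r+1)×(r+1) matrices over K with: T diagonal, T_{jj} = ζ^{c·j²}; S_{j,0} = ε·γ/p for all 0 ≤ j ≤ r, S_{0,k} = 2·ε·γ/p for 1 ≤ k ≤ r, and S_{j,k} = (ε·γ/p)·(ζ^{2cjk} + ζ^{−2cjk}) for 1 ≤ j, k ≤ r. Let w ∈ (ZMod p)ˣ, let τ_w be the unique ring automorphism of K with τ_w(ζ) = ζ^{w²}, and let σ : Fin (r+1) → Fin (r+1) be any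 bijection such that for every j, (σ(j) : ZMod p) = w·j or (σ(j) : ZMod p) = −w·j. Then for all j, k: τ_w(S_{j,k}) = S_{σ(j),σ(k)} and τ_w(T_{j,k}) = T_{σ(j),σ(k)}. -/
/-- Powers of a primitive root only depend on the exponent modulo its order. -/
theorem IsPrimitiveRoot.zpow_eq_zpow_of_intCast_eq {K : Type*} [Field K] {ζ : K} {p : ℕ}
    (hζ : IsPrimitiveRoot ζ p) (hp : p ≠ 0) {a b : ℤ} (h : (a : ZMod p) = b) :
    ζ ^ a = ζ ^ b := by
  have h1 := (hζ.zpow_eq_one_iff_dvd (b - a)).mpr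
    ((ZMod.intCast_eq_intCast_iff_dvd_sub a b p).mp h)
  rw [← sub_add_cancel b a, zpow_add₀ (hζ.ne_zero hp), h1, one_mul]

/-- A homomorphism raising `ζ` to the `n`-th power multiplies exponents by `n` modulo `p`. -/
theorem IsPrimitiveRoot.map_zpow_eq_of_intCast_eq {K : Type*} [Field K] {ζ : K} {p : ℕ}
    (hζ : IsPrimitiveRoot ζ p) (hp : p ≠ 0) {τ : K ≃+* K} {n : ℕ} (hτ : τ ζ = ζ ^ n)
    {a b : ℤ} (h : (n : ZMod p) * a = b) : τ (ζ ^ a) = ζ ^ b := by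
  rw [map_zpow₀, hτ, ← zpow_natCast, ← zpow_mul]
  exact hζ.zpow_eq_zpow_of_intCast_eq hp (by push_cast; exact h)

/-- The quadratic Gauss sum is fixed by the automorphisms `ζ ↦ ζ ^ (w ^ 2)`. -/
theorem IsPrimitiveRoot.map_sum_zpow_sq {K : Type*} [Field K] {ζ : K} {p : ℕ} [NeZero p]
    (hζ : IsPrimitiveRoot ζ p) {τ : K ≃+* K} {n : ℕ} (hτ : τ ζ = ζ ^ n) (w : (ZMod p)ˣ)
    (hn : (n : ZMod p) = (w : ZMod p) ^ 2) (c : ℤ) :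
    τ (∑ x : ZMod p, ζ ^ (c * (x.val : ℤ) ^ 2)) = ∑ x : ZMod p, ζ ^ (c * (x.val : ℤ) ^ 2) := by
  rw [map_sum]
  refine Fintype.sum_equiv w.mulLeft _ _ fun x => ?_
  refine hζ.map_zpow_eq_of_intCast_eq (NeZero.ne p) hτ ?_
  push_cast
  simp only [ZMod.natCast_val, ZMod.cast_id', id_eq, Units.mulLeft_apply, hn]
  ring


/-- Compatibility of the Galois action with the principal series Weil
matrices: if `τ_w(ζ) = ζ^{w²}` and `σ` is a bijection of `{0,…,r}` with
`σ(j) ≡ ±w·j (mod p)`, then `τ_w(S_{j,k}) = S_{σ(j),σ(k)}` and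
`τ_w(T_{j,k}) = T_{σ(j),σ(k)}`. -/
theorem galois_action_on_weil_matrices
    (p : ℕ+) [hp : Fact (p : ℕ).Prime] (hp2 : (p : ℕ) ≠ 2)
    (r : ℕ) (hr : r = ((p : ℕ) - 1) / 2)
    (ε : ℤ) (hε : ε = (-1) ^ r)
    (ζ : CyclotomicField p ℚ) (hζ : IsPrimitiveRoot ζ (p : ℕ))
    (c : ℤ) (hc : ¬ ((p : ℕ) : ℤ) ∣ c)
    (γ : CyclotomicField p ℚ)
    (hγ : γ = ∑ x : ZMod (p : ℕ), ζ ^ (c * ((x.val : ℤ)) ^ 2))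
    (S T : Matrix (Fin (r + 1)) (Fin (r + 1)) (CyclotomicField p ℚ))
    (hT : T = Matrix.diagonal fun j : Fin (r + 1) => ζ ^ (c * ((j : ℕ) : ℤ) ^ 2))
    (hS0 : ∀ j, S j 0 = (ε : CyclotomicField p ℚ) * γ / ((p : ℕ) : CyclotomicField p ℚ))
    (hS1 : ∀ k, k ≠ 0 →
      S 0 k = 2 * ((ε : CyclotomicField p ℚ) * γ / ((p : ℕ) : CyclotomicField p ℚ)))
    (hS2 : ∀ j k, j ≠ 0 → k ≠ 0 →
      S j k = (ε : CyclotomicField p ℚ) * γ / ((p : ℕ) : CyclotomicField p ℚ) *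
        (ζ ^ (2 * c * ((j : ℕ) : ℤ) * ((k : ℕ) : ℤ)) +
          ζ ^ (-(2 * c * ((j : ℕ) : ℤ) * ((k : ℕ) : ℤ)))))
    (w : (ZMod (p : ℕ))ˣ) (n : ℕ) (hn : (n : ZMod (p : ℕ)) = (w : ZMod (p : ℕ)) ^ 2)
    (τ : CyclotomicField p ℚ ≃+* CyclotomicField p ℚ) (hτ : τ ζ = ζ ^ n)
    (σ : Fin (r + 1) ≃ Fin (r + 1))
    (hσ : ∀ j : Fin (r + 1), (((σ j : ℕ) : ZMod (p : ℕ)) =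
        (w : ZMod (p : ℕ)) * ((j : ℕ) : ZMod (p : ℕ)) ∨
      ((σ j : ℕ) : ZMod (p : ℕ)) =
        -((w : ZMod (p : ℕ)) * ((j : ℕ) : ZMod (p : ℕ))))) :
    ∀ j k : Fin (r + 1), τ (S j k) = S (σ j) (σ k) ∧ τ (T j k) = T (σ j) (σ k) := by
  have hp0 : (p : ℕ) ≠ 0 := p.ne_zero
  have : NeZero (p : ℕ) := ⟨hp0⟩
  have hτγ : τ γ = γ := by rw [hγ]; exact hζ.map_sum_zpow_sq hτ w hn c
  have hσ0 : σ 0 = 0 := by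
    have h : ((σ 0 : ℕ) : ZMod (p : ℕ)) = 0 := by simpa using hσ 0
    rw [ZMod.natCast_eq_zero_iff] at h
    have hlt : (σ 0 : ℕ) < p := by
      have := (σ 0).isLt
      have := hp.out.two_le
      omega
    exact Fin.ext (Nat.eq_zero_of_dvd_of_lt h hlt)
  have hσne : ∀ {j}, j ≠ 0 → σ j ≠ 0 := fun hj h => hj (σ.injective (h.trans hσ0.symm))
  intro j k
  constructor
  · rcases eq_or_ne k 0 with rfl | hk
    · simp [hσ0, hS0, hτγ]
    rcases eq_or_ne j 0 with rfl | hj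
    · simp [hσ0, hS1 _ hk, hS1 _ (hσne hk), hτγ, map_ofNat τ 2]
    have hpair : τ (ζ ^ (2 * c * ((j : ℕ) : ℤ) * ((k : ℕ) : ℤ)) +
          ζ ^ (-(2 * c * ((j : ℕ) : ℤ) * ((k : ℕ) : ℤ)))) =
        ζ ^ (2 * c * ((σ j : ℕ) : ℤ) * ((σ k : ℕ) : ℤ)) +
          ζ ^ (-(2 * c * ((σ j : ℕ) : ℤ) * ((σ k : ℕ) : ℤ))) := by
      have hprod : ((σ j : ℕ) : ZMod (p : ℕ)) * (σ k : ℕ) = n * ((j : ℕ) * (k : ℕ)) ∨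
          ((σ j : ℕ) : ZMod (p : ℕ)) * (σ k : ℕ) = -(n * ((j : ℕ) * (k : ℕ))) := by
        rw [hn]
        rcases hσ j with h1 | h1 <;> rcases hσ k with h2 | h2 <;> rw [h1, h2]
        · left; ring
        · right; ring
        · right; ring
        · left; ring
      rw [map_add]
      rcases hprod with h | h
      · congr 1 <;> refine hζ.map_zpow_eq_of_intCast_eq hp0 hτ ?_ <;> push_cast
        · linear_combination (-2 * (c : ZMod (p : ℕ))) * h
        · linear_combination (2 * (c : ZMod (p : ℕ))) * h
      · rw [add_comm]
        congr 1 <;> refine hζ.map_zpow_eq_of_intCast_eq hp0 hτ ?_ <;> push_cast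
        · linear_combination (-2 * (c : ZMod (p : ℕ))) * h
        · linear_combination (2 * (c : ZMod (p : ℕ))) * h
    rw [hS2 j k hj hk, hS2 _ _ (hσne hj) (hσne hk), map_mul, hpair]
    simp [hτγ]
  · subst hT
    rcases eq_or_ne j k with rfl | hjk
    · rw [Matrix.diagonal_apply_eq, Matrix.diagonal_apply_eq]
      refine hζ.map_zpow_eq_of_intCast_eq hp0 hτ ?_
      push_cast
      rw [hn]
      rcases hσ j with h | h <;> rw [h] <;> ring
    · rw [Matrix.diagonal_apply_ne _ hjk, Matrix.diagonal_apply_ne _ (σ.injective.ne hjk), map_zero]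
end

section
/- Let p be an odd prime, r = (p−1)/2, ε = (−1)^r, K = CyclotomicField p ℚ, ζ ∈ K a primitive p-th root of unity, c an integer with p ∤ c, and γ = Σ_{x ∈ ZMod p} ζ^{c·x²}. Let S and T be the (r+1)×(r+1) matrices over K with: T diagonal, T_{jj} = ζ^{c·j²}; S_{j,0} = ε·γ/p for all 0 ≤ j ≤ r, S_{0,k} = 2·ε·γ/p for 1 ≤ k ≤ r, and S_{j,k} = (ε·γ/p)·(ζ^{2cjk} + ζ^{−2cjk}) for 1 ≤ j, k ≤ r. Let ξ be any group homomorphism from SL(2, ZMod p) to the invertible (r+1)×(r+1) matrices over K with ξ(s) = S and ξ(t) = T, where s = [[0,−1],[1,0]] and t = [[1,1],[0,1]]. Let w ∈ (ZMod p)ˣ, let τ_w be the unique ring automorphism of K with τ_w(ζ) = ζ^{w²}, and let σ : Fin (r+1) → Fin (r+1) be any bijection such that for every j, (σ(j) : ZMod p) = w·j or (σ(j) : ZMod p) = −w·j. Then for every g ∈ SL(2, ZMod p) and all indices j, k: τ_w((ξ(g))_{j,k}) = (ξ(g))_{σ(j),σ(k)}. -/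
open Matrix in
/-- `SL(2, ZMod p)` is generated by its standard generators `s` and `t`. -/
theorem Matrix.SpecialLinearGroup.closure_pair_eq_top_zmod (p : ℕ) [Fact p.Prime]
    {s t : SpecialLinearGroup (Fin 2) (ZMod p)}
    (hs : (s : Matrix (Fin 2) (Fin 2) (ZMod p)) = !![0, -1; 1, 0])
    (ht : (t : Matrix (Fin 2) (Fin 2) (ZMod p)) = !![1, 1; 0, 1]) :
    Subgroup.closure {s, t} = ⊤ := by
  have hs_mem : s ∈ Subgroup.closure {s, t} := Subgroup.subset_closure (by simp)
  have ht_mem : t ∈ Subgroup.closure {s, t} := Subgroup.subset_closure (by simp)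
  have ht_pow (m : ℕ) : ((t ^ m : SpecialLinearGroup (Fin 2) (ZMod p)) :
      Matrix (Fin 2) (Fin 2) (ZMod p)) = !![1, (m : ZMod p); 0, 1] := by
    induction m with
    | zero => simp [Matrix.one_fin_two]
    | succ m ih =>
      rw [pow_succ, SpecialLinearGroup.coe_mul, ih, ht]
      simp [add_comm]
  have hupper (b : ZMod p) : t ^ b.val = SpecialLinearGroup.transvection zero_ne_one b := by
    ext i j
    rw [ht_pow, ZMod.natCast_zmod_val]
    fin_cases i <;> fin_cases j <;> simp [SpecialLinearGroup.transvection_coe]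
  have hlower (b : ZMod p) :
      s * t ^ (-b).val * s⁻¹ = SpecialLinearGroup.transvection one_ne_zero b := by
    rw [mul_inv_eq_iff_eq_mul]
    ext i j
    rw [SpecialLinearGroup.coe_mul, SpecialLinearGroup.coe_mul, ht_pow, ZMod.natCast_zmod_val, hs]
    fin_cases i <;> fin_cases j <;>
      simp [SpecialLinearGroup.transvection_coe, Matrix.mul_apply]
  refine eq_top_iff.mpr fun g _ ↦ SL2.transvection_induction _ (fun i j hij b ↦ ?_)
    (fun _ _ ↦ mul_mem) g
  fin_cases i <;> fin_cases j
  · exact absurd rfl hij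
  · exact hupper b ▸ pow_mem ht_mem _
  · exact hlower b ▸ mul_mem (mul_mem hs_mem (pow_mem ht_mem _)) (inv_mem hs_mem)
  · exact absurd rfl hij

theorem IsPrimitiveRoot.zpow_eq_zpow_of_zmod_eq {L : Type*} [Field L] {ζ : L} {p : ℕ}
    [NeZero p] (hζ : IsPrimitiveRoot ζ p) {a b : ℤ} (hab : (a : ZMod p) = b) : ζ ^ a = ζ ^ b := by
  obtain ⟨m, hm⟩ := (ZMod.intCast_eq_intCast_iff_dvd_sub a b p).mp hab
  obtain rfl : b = a + p * m := by lia
  rw [zpow_add₀ (hζ.ne_zero (NeZero.ne p)), zpow_mul, zpow_natCast, hζ.pow_eq_one, one_zpow,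
    mul_one]

/-- A ring automorphism `ζ ↦ ζ ^ w ^ 2` fixes the quadratic Gauss sum. -/
theorem IsPrimitiveRoot.map_quadraticGaussSum {L : Type*} [Field L] {ζ : L} {p : ℕ}
    [NeZero p] (hζ : IsPrimitiveRoot ζ p) (c : ℤ) (w : (ZMod p)ˣ) {n : ℕ}
    (hn : (n : ZMod p) = (w : ZMod p) ^ 2) (τ : L ≃+* L) (hτ : τ ζ = ζ ^ n) :
    τ (∑ x : ZMod p, ζ ^ (c * (x.val : ℤ) ^ 2)) = ∑ x : ZMod p, ζ ^ (c * (x.val : ℤ) ^ 2) := by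
  rw [map_sum]
  refine Fintype.sum_bijective _ w.mulLeft_bijective _ _ fun x ↦ ?_
  rw [map_zpow₀, hτ, ← zpow_natCast, ← zpow_mul]
  apply hζ.zpow_eq_zpow_of_zmod_eq
  push_cast
  simp only [ZMod.natCast_zmod_val, hn]
  ring


/-- (Theorem `thm2` of the paper.)  The Galois automorphism `τ_w`
acts on the explicit model `ξ` of the principal series Weil character (determined by
`ξ(s) = S`, `ξ(t) = T`) by the simultaneous row/column permutation `σ`:
`τ_w(ξ(g)_{j,k}) = ξ(g)_{σ(j),σ(k)}` for all `g ∈ SL(2, 𝔽_p)`. -/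
theorem galois_action_on_weil_character_model
    (p : ℕ+) [hp : Fact (p : ℕ).Prime] (hp2 : (p : ℕ) ≠ 2)
    (r : ℕ) (hr : r = ((p : ℕ) - 1) / 2)
    (ε : ℤ) (hε : ε = (-1) ^ r)
    (ζ : CyclotomicField p ℚ) (hζ : IsPrimitiveRoot ζ (p : ℕ))
    (c : ℤ) (hc : ¬ ((p : ℕ) : ℤ) ∣ c)
    (γ : CyclotomicField p ℚ)
    (hγ : γ = ∑ x : ZMod (p : ℕ), ζ ^ (c * ((x.val : ℤ)) ^ 2))
    (S T : Matrix (Fin (r + 1)) (Fin (r + 1)) (CyclotomicField p ℚ))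
    (hT : T = Matrix.diagonal fun j : Fin (r + 1) => ζ ^ (c * ((j : ℕ) : ℤ) ^ 2))
    (hS0 : ∀ j, S j 0 = (ε : CyclotomicField p ℚ) * γ / ((p : ℕ) : CyclotomicField p ℚ))
    (hS1 : ∀ k, k ≠ 0 →
      S 0 k = 2 * ((ε : CyclotomicField p ℚ) * γ / ((p : ℕ) : CyclotomicField p ℚ)))
    (hS2 : ∀ j k, j ≠ 0 → k ≠ 0 →
      S j k = (ε : CyclotomicField p ℚ) * γ / ((p : ℕ) : CyclotomicField p ℚ) *
        (ζ ^ (2 * c * ((j : ℕ) : ℤ) * ((k : ℕ) : ℤ)) +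
          ζ ^ (-(2 * c * ((j : ℕ) : ℤ) * ((k : ℕ) : ℤ)))))
    (s t : Matrix.SpecialLinearGroup (Fin 2) (ZMod (p : ℕ)))
    (hs : (s : Matrix (Fin 2) (Fin 2) (ZMod (p : ℕ))) = !![0, -1; 1, 0])
    (ht : (t : Matrix (Fin 2) (Fin 2) (ZMod (p : ℕ))) = !![1, 1; 0, 1])
    (ξ : Matrix.SpecialLinearGroup (Fin 2) (ZMod (p : ℕ)) →*
      (Matrix (Fin (r + 1)) (Fin (r + 1)) (CyclotomicField p ℚ))ˣ)
    (hξs : ((ξ s : (Matrix (Fin (r + 1)) (Fin (r + 1)) (CyclotomicField p ℚ))ˣ) :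
      Matrix (Fin (r + 1)) (Fin (r + 1)) (CyclotomicField p ℚ)) = S)
    (hξt : ((ξ t : (Matrix (Fin (r + 1)) (Fin (r + 1)) (CyclotomicField p ℚ))ˣ) :
      Matrix (Fin (r + 1)) (Fin (r + 1)) (CyclotomicField p ℚ)) = T)
    (w : (ZMod (p : ℕ))ˣ) (n : ℕ) (hn : (n : ZMod (p : ℕ)) = (w : ZMod (p : ℕ)) ^ 2)
    (τ : CyclotomicField p ℚ ≃+* CyclotomicField p ℚ) (hτ : τ ζ = ζ ^ n)
    (σ : Fin (r + 1) ≃ Fin (r + 1))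
    (hσ : ∀ j : Fin (r + 1), (((σ j : ℕ) : ZMod (p : ℕ)) =
        (w : ZMod (p : ℕ)) * ((j : ℕ) : ZMod (p : ℕ)) ∨
      ((σ j : ℕ) : ZMod (p : ℕ)) =
        -((w : ZMod (p : ℕ)) * ((j : ℕ) : ZMod (p : ℕ))))) :
    ∀ g : Matrix.SpecialLinearGroup (Fin 2) (ZMod (p : ℕ)), ∀ j k : Fin (r + 1),
      τ (((ξ g : (Matrix (Fin (r + 1)) (Fin (r + 1)) (CyclotomicField p ℚ))ˣ) :
          Matrix (Fin (r + 1)) (Fin (r + 1)) (CyclotomicField p ℚ)) j k) =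
        ((ξ g : (Matrix (Fin (r + 1)) (Fin (r + 1)) (CyclotomicField p ℚ))ˣ) :
          Matrix (Fin (r + 1)) (Fin (r + 1)) (CyclotomicField p ℚ)) (σ j) (σ k) := by
  have hτz (a : ℤ) : τ (ζ ^ a) = ζ ^ ((n : ℤ) * a) := by
    rw [map_zpow₀, hτ, ← zpow_natCast, ← zpow_mul]
  have hσ0 : σ 0 = 0 := by
    have h : ((σ 0 : ℕ) : ZMod (p : ℕ)) = 0 := by simpa using hσ 0
    rw [ZMod.natCast_eq_zero_iff] at h
    have hlt : (σ 0 : ℕ) < p := by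
      have := (σ 0).isLt
      have := hp.out.two_le
      lia
    exact Fin.ext (Nat.eq_zero_of_dvd_of_lt h hlt)
  have hσne {j : Fin (r + 1)} (hj : j ≠ 0) : σ j ≠ 0 := fun h ↦
    hj (σ.injective (h.trans hσ0.symm))
  have hcoef : τ ((ε : CyclotomicField p ℚ) * γ / ((p : ℕ) : CyclotomicField p ℚ)) =
      (ε : CyclotomicField p ℚ) * γ / ((p : ℕ) : CyclotomicField p ℚ) := by
    rw [map_div₀, map_mul, map_intCast, map_natCast, hγ,
      hζ.map_quadraticGaussSum c w hn τ hτ]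
  have hSτ (j k : Fin (r + 1)) : τ (S j k) = S (σ j) (σ k) := by
    rcases eq_or_ne k 0 with rfl | hk
    · rw [hσ0, hS0, hS0, hcoef]
    rcases eq_or_ne j 0 with rfl | hj
    · rw [hσ0, hS1 k hk, hS1 _ (hσne hk), map_mul, hcoef, map_ofNat]
    rw [hS2 j k hj hk, hS2 _ _ (hσne hj) (hσne hk), map_mul, hcoef, map_add, hτz, hτz]
    congr 1
    have hcases : ((σ j : ℕ) : ZMod (p : ℕ)) * ((σ k : ℕ) : ZMod (p : ℕ)) =
          (n : ZMod (p : ℕ)) * ((j : ℕ) : ZMod (p : ℕ)) * ((k : ℕ) : ZMod (p : ℕ)) ∨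
        ((σ j : ℕ) : ZMod (p : ℕ)) * ((σ k : ℕ) : ZMod (p : ℕ)) =
          -((n : ZMod (p : ℕ)) * ((j : ℕ) : ZMod (p : ℕ)) * ((k : ℕ) : ZMod (p : ℕ))) := by
      rw [hn]
      rcases hσ j with h | h <;> rcases hσ k with h' | h' <;> rw [h, h'] <;> grind
    rcases hcases with h | h
    · congr 1 <;> apply hζ.zpow_eq_zpow_of_zmod_eq <;> push_cast
      · linear_combination -2 * (c : ZMod (p : ℕ)) * h
      · linear_combination 2 * (c : ZMod (p : ℕ)) * h
    · rw [add_comm]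
      congr 1 <;> apply hζ.zpow_eq_zpow_of_zmod_eq <;> push_cast
      · linear_combination -2 * (c : ZMod (p : ℕ)) * h
      · linear_combination 2 * (c : ZMod (p : ℕ)) * h
  have hTτ (j k : Fin (r + 1)) : τ (T j k) = T (σ j) (σ k) := by
    subst hT
    rcases eq_or_ne j k with rfl | hjk
    · rw [Matrix.diagonal_apply_eq, Matrix.diagonal_apply_eq, hτz]
      apply hζ.zpow_eq_zpow_of_zmod_eq
      push_cast
      rw [hn]
      rcases hσ j with h | h <;> rw [h] <;> ring
    · rw [Matrix.diagonal_apply_ne _ hjk, Matrix.diagonal_apply_ne _ (σ.injective.ne hjk), map_zero]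
  have hhom :
      (Units.map (MonoidHomClass.toMonoidHom (τ.mapMatrix (m := Fin (r + 1))))).comp ξ =
        (Units.map (MonoidHomClass.toMonoidHom
          (Matrix.reindexAlgEquiv ℚ (CyclotomicField p ℚ) σ.symm))).comp ξ := by
    refine MonoidHom.eq_of_eqOn_dense
      (Matrix.SpecialLinearGroup.closure_pair_eq_top_zmod (p : ℕ) hs ht) ?_
    rintro g (rfl | rfl) <;> ext j k
    · simpa [hξs] using hSτ j k
    · simpa [hξt] using hTτ j k
  intro g j k
  simpa using Matrix.ext_iff.mpr (Units.ext_iff.mp (DFunLike.congr_fun hhom g)) j k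
end
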